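/- For every integer n ≥ 2 there exist ε > 0 and c > 0, depending only on n, such that for every prime power q and every generating set A of the group L = PSL(n,q), either A³ = L or |A³| ≥ c·|A|^{1+ε}. -/

import Mathlib

namespace ProductPSL

set_option linter.unusedSectionVars false

open MvPolynomial

section Bezout

variable {σ K : Type} [Fintype σ] [DecidableEq σ] [Field K]

/-- Substitution `X ↦ X + z`. -/
noncomputable def shift (z : σ → K) : MvPolynomial σ K →ₐ[K] MvPolynomial σ K :=
  aeval fun i => X i + C (z i)

lemma constantCoeff_shift (z : σ → K) (p : MvPolynomial σ K) :
    coeff 0 (shift z p) = eval z p := by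
  have h : ((constantCoeff (σ := σ) (R := K)).comp (shift z : MvPolynomial σ K →+* _)) = eval z := by
    ext i <;> simp [shift]
  exact congrArg (fun φ => φ p) h

lemma mem_idealOfVars_iff (p : MvPolynomial σ K) : p ∈ idealOfVars σ K ↔ coeff 0 p = 0 := by
  rw [← pow_one (idealOfVars σ K), mem_pow_idealOfVars_iff']
  constructor
  · intro h; exact h 0 (by simp)
  · intro h x hx
    have : x = 0 := (Finsupp.degree_eq_zero_iff x).1 (by omega)
    rw [this, h]

lemma sub_linear_mem (p : MvPolynomial σ K) :
    p - C (coeff 0 p) - ∑ j, C (coeff (Finsupp.single j 1) p) * X j ∈ idealOfVars σ K ^ 2 := by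
  rw [mem_pow_idealOfVars_iff']
  intro x hx
  have : x.degree = 0 ∨ x.degree = 1 := by omega
  rcases this with h | h
  · have : x = 0 := (Finsupp.degree_eq_zero_iff x).1 h
    subst this
    simp [coeff_sum]
  · obtain ⟨j, rfl⟩ : ∃ j, x = Finsupp.single j 1 := by
      have hne : x ≠ 0 := by rintro rfl; simp at h
      obtain ⟨j, hj⟩ := Finsupp.ne_iff.1 hne
      have hj : x j ≠ 0 := by simpa using hj
      refine ⟨j, ?_⟩
      rw [Finsupp.degree_eq_sum, ← Finset.add_sum_erase _ _ (Finset.mem_univ j)] at h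
      have h1 : ∑ i ∈ Finset.univ.erase j, x i = 0 := by omega
      ext i
      by_cases hij : j = i
      · subst hij; simp; omega
      · rw [Finsupp.single_eq_of_ne (Ne.symm hij)]
        exact Finset.sum_eq_zero_iff.1 h1 i (Finset.mem_erase.2 ⟨Ne.symm hij, Finset.mem_univ _⟩)
    simp only [coeff_sub, coeff_sum, coeff_C_mul, coeff_X, coeff_C]
    rw [Finset.sum_eq_single j]
    · simp [Finsupp.single_eq_zero, eq_comm]
    · intro b _ hb
      simp [Finsupp.single_left_inj, hb]
    · simp

lemma prod_pow_sub_mem {R : Type} [CommRing R] (I : Ideal R) (f g : σ → R)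
    (hg : ∀ i, g i ∈ I) (hfg : ∀ i, f i - g i ∈ I ^ 2) (α : σ → ℕ) :
    ∏ i, f i ^ α i ∈ I ^ (∑ i, α i) ∧ ∏ i, g i ^ α i ∈ I ^ (∑ i, α i) ∧
      ∏ i, f i ^ α i - ∏ i, g i ^ α i ∈ I ^ ((∑ i, α i) + 1) := by
  have key : ∀ a b c d : R, ∀ m n : ℕ, (a ∈ I ^ m ∧ b ∈ I ^ m ∧ a - b ∈ I ^ (m + 1)) →
      (c ∈ I ^ n ∧ d ∈ I ^ n ∧ c - d ∈ I ^ (n + 1)) →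
      (a * c ∈ I ^ (m + n) ∧ b * d ∈ I ^ (m + n) ∧ a * c - b * d ∈ I ^ (m + n + 1)) := by
    rintro a b c d m n ⟨h1, h2, h3⟩ ⟨h4, h5, h6⟩
    refine ⟨?_, ?_, ?_⟩
    · rw [pow_add]; exact Ideal.mul_mem_mul h1 h4
    · rw [pow_add]; exact Ideal.mul_mem_mul h2 h5
    · have : a * c - b * d = (a - b) * c + b * (c - d) := by ring
      rw [this]
      refine Ideal.add_mem _ ?_ ?_
      · have := Ideal.mul_mem_mul h3 h4
        rwa [← pow_add, show m + 1 + n = m + n + 1 by ring] at this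
      · have := Ideal.mul_mem_mul h2 h6
        rwa [← pow_add, show m + (n + 1) = m + n + 1 by ring] at this
  have hpow : ∀ i, ∀ k : ℕ, f i ^ k ∈ I ^ k ∧ g i ^ k ∈ I ^ k ∧ f i ^ k - g i ^ k ∈ I ^ (k + 1) := by
    intro i k
    induction k with
    | zero => simp
    | succ k ih =>
      have := key (f i ^ k) (g i ^ k) (f i) (g i) k 1 ih ⟨?_, by simpa using hg i, by simpa using hfg i⟩
      · simpa [pow_succ] using this
      · have h := Ideal.add_mem I (Ideal.pow_le_self two_ne_zero (hfg i)) (hg i)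
        simpa using h
  induction (Finset.univ : Finset σ) using Finset.induction_on with
  | empty => simp
  | insert i s hi ih =>
    rw [Finset.prod_insert hi, Finset.prod_insert hi, Finset.sum_insert hi]
    exact key _ _ _ _ _ _ (hpow i _) ih

lemma finrank_restrictTotalDegree_le (M : ℕ) :
    Module.Finite K (restrictTotalDegree σ K M) ∧
    Module.finrank K (restrictTotalDegree σ K M) ≤ (M + 1) ^ Fintype.card σ := by
  have hb := basisRestrictSupport K {a : σ →₀ ℕ | ∀ i, a i ≤ M}
  let e : {a : σ →₀ ℕ | ∀ i, a i ≤ M} → (σ → Fin (M + 1)) :=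
    fun a i => ⟨a.1 i, Nat.lt_succ_of_le (a.2 i)⟩
  have he : Function.Injective e := by
    intro a b h
    ext i
    have := congrFun h i
    simpa [e] using this
  have : Finite {a : σ →₀ ℕ | ∀ i, a i ≤ M} := Finite.of_injective e he
  have := Fintype.ofFinite {a : σ →₀ ℕ | ∀ i, a i ≤ M}
  have hfin : Module.Finite K (restrictSupport K {a : σ →₀ ℕ | ∀ i, a i ≤ M}) :=
    Module.Finite.of_basis hb
  have hle : restrictTotalDegree σ K M ≤ restrictSupport K {a : σ →₀ ℕ | ∀ i, a i ≤ M} :=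
    restrictTotalDegree_le_restrictDegree σ K M
  refine ⟨Submodule.finiteDimensional_of_le hle, ?_⟩
  calc _ ≤ Module.finrank K (restrictSupport K {a : σ →₀ ℕ | ∀ i, a i ≤ M}) :=
        Submodule.finrank_mono hle
    _ = Fintype.card {a : σ →₀ ℕ | ∀ i, a i ≤ M} := Module.finrank_eq_card_basis hb
    _ ≤ Fintype.card (σ → Fin (M + 1)) := Fintype.card_le_of_injective e he
    _ = _ := by simp

open Classical in
lemma exists_lagrange (Z : Finset (σ → K)) : ∃ e : (σ → K) → MvPolynomial σ K,
    ∀ z ∈ Z, ∀ z' ∈ Z, eval z' (e z) = if z' = z then 1 else 0 := by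
  have h1 : ∀ z z' : σ → K, z ≠ z' → ∃ p : MvPolynomial σ K, eval z p = 1 ∧ eval z' p = 0 := by
    intro z z' h
    obtain ⟨i, hi⟩ := Function.ne_iff.1 h
    refine ⟨C (z i - z' i)⁻¹ * (X i - C (z' i)), ?_, ?_⟩
    · simp [inv_mul_cancel₀ (sub_ne_zero.2 hi)]
    · simp
  choose! p hp using h1
  refine ⟨fun z => ∏ z' ∈ Z.erase z, p z z', fun z hz z' hz' => ?_⟩
  rw [map_prod]
  split_ifs with h
  · subst h
    refine Finset.prod_eq_one fun y hy => (hp _ _ ?_).1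
    exact (Finset.ne_of_mem_erase hy).symm
  · exact Finset.prod_eq_zero (Finset.mem_erase.2 ⟨h, hz'⟩) (hp _ _ (Ne.symm h)).2

lemma card_le_of_normalized (Z : Finset (σ → K)) (D : ℕ)
    (f : (σ → K) → σ → MvPolynomial σ K)
    (hdeg : ∀ z ∈ Z, ∀ i, (f z i).totalDegree ≤ D)
    (hvan : ∀ z ∈ Z, ∀ z' ∈ Z, ∀ i, eval z' (f z i) = 0)
    (hlin : ∀ z ∈ Z, ∀ i, shift z (f z i) - X i ∈ idealOfVars σ K ^ 2) :
    Z.card ≤ (Fintype.card σ * D + 1) ^ Fintype.card σ := by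
  classical
  obtain ⟨e, he⟩ := exists_lagrange Z
  set E := Z.sup fun z => (e z).totalDegree
  set N := Fintype.card σ
  set s := E + 1
  set M := E + N * E * D
  let v : Z × (σ → Fin s) → MvPolynomial σ K := fun x => e x.1 * ∏ i, f x.1 i ^ (x.2 i : ℕ)
  have hmem : ∀ x, v x ∈ restrictTotalDegree σ K M := by
    intro x
    rw [mem_restrictTotalDegree]
    refine (totalDegree_mul _ _).trans ?_
    refine Nat.add_le_add (Finset.le_sup (f := fun z => (e z).totalDegree) x.1.2) ?_
    refine (totalDegree_finsetProd _ _).trans ?_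
    calc _ ≤ ∑ i : σ, E * D := Finset.sum_le_sum fun i _ =>
          (totalDegree_pow _ _).trans (Nat.mul_le_mul (Nat.lt_succ_iff.1 (x.2 i).2)
            (hdeg _ x.1.2 i))
      _ = _ := by simp [N, mul_assoc]
  have hli : LinearIndependent K v := by
    rw [Fintype.linearIndependent_iff]
    intro g hg
    by_contra! hne
    -- minimal total exponent with nonzero coefficient
    let T : Set ℕ := {t | ∃ x, g x ≠ 0 ∧ ∑ i, (x.2 i : ℕ) = t}
    have hT : T.Nonempty := by
      obtain ⟨x, hx⟩ := hne
      exact ⟨_, x, hx, rfl⟩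
    obtain ⟨⟨z, α⟩, hx0, hxt⟩ := Nat.sInf_mem hT
    set t := sInf T
    have hmin : ∀ x, ∑ i, (x.2 i : ℕ) < t → g x = 0 := by
      intro x hx
      by_contra h
      exact Nat.notMem_of_lt_sInf hx ⟨x, h, rfl⟩
    set I := idealOfVars σ K
    -- membership facts after the shift
    have hfI : ∀ y : Z, ∀ i, shift (z : σ → K) (f y i) ∈ I := fun y i => by
      rw [mem_idealOfVars_iff, constantCoeff_shift]; exact hvan _ y.2 _ z.2 i
    have hprodI : ∀ x : Z × (σ → Fin s),
        shift (z : σ → K) (∏ i, f x.1 i ^ (x.2 i : ℕ)) ∈ I ^ (∑ i, (x.2 i : ℕ)) := by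
      intro x
      rw [map_prod]
      simp_rw [map_pow]
      exact (prod_pow_sub_mem I (fun i => shift (z : σ → K) (f x.1 i)) _ (hfI x.1)
        (fun i => by simp) fun i => (x.2 i : ℕ)).1
    have hterm : ∀ x : Z × (σ → Fin s),
        g x • shift (z : σ → K) (v x) -
          (if x.1 = z ∧ ∑ i, (x.2 i : ℕ) = t then g x • ∏ i, X i ^ (x.2 i : ℕ) else 0) ∈ I ^ (t + 1) := by
      intro x
      rcases lt_trichotomy (∑ i, (x.2 i : ℕ)) t with h | h | h
      · rw [hmin x h]; simp
      · by_cases hz : x.1 = z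
        · rw [if_pos ⟨hz, h⟩, ← smul_sub]
          refine Submodule.smul_of_tower_mem _ _ ?_
          have h1 := (prod_pow_sub_mem I (fun i => shift (z : σ → K) (f x.1 i)) X
            (fun i => by rw [mem_idealOfVars_iff]; simp)
            (by rw [hz]; exact hlin _ z.2) fun i => (x.2 i : ℕ)).2.2
          have h2 : shift (z : σ → K) (e x.1) - 1 ∈ I := by
            rw [mem_idealOfVars_iff, coeff_sub, constantCoeff_shift, hz, he _ z.2 _ z.2]
            simp
          have h3 := Ideal.mul_mem_mul h2 (hprodI x)
          rw [h, ← pow_succ'] at h3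
          rw [h] at h1
          have := Ideal.add_mem _ h3 h1
          convert this using 1
          simp only [v, map_mul, map_prod, map_pow]
          ring
        · rw [if_neg (fun h => hz h.1), sub_zero]
          refine Submodule.smul_of_tower_mem _ _ ?_
          have h2 : shift (z : σ → K) (e x.1) ∈ I := by
            rw [mem_idealOfVars_iff, constantCoeff_shift, he _ x.1.2 _ z.2, if_neg]
            exact fun h => hz (Subtype.ext h.symm)
          have h3 := Ideal.mul_mem_mul h2 (hprodI x)
          rw [h, ← pow_succ'] at h3
          simpa [v] using h3
      · rw [if_neg (fun h' => h.ne' h'.2), sub_zero]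
        refine Submodule.smul_of_tower_mem _ _ ?_
        rw [show v x = e x.1 * ∏ i, f x.1 i ^ (x.2 i : ℕ) from rfl, map_mul]
        exact Ideal.mul_mem_left _ _ (Ideal.pow_le_pow_right h (hprodI x))
    have hsum := Ideal.sum_mem (I ^ (t + 1)) fun x (_ : x ∈ Finset.univ) => hterm x
    rw [Finset.sum_sub_distrib] at hsum
    have h0 : ∑ x, g x • shift (z : σ → K) (v x) = 0 := by
      have := congrArg (shift (z : σ → K)) hg
      simpa using this
    rw [h0, zero_sub, Ideal.neg_mem_iff, mem_pow_idealOfVars_iff'] at hsum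
    have hα := hsum (Finsupp.equivFunOnFinite.symm fun i => (α i : ℕ)) (by
      rw [Finsupp.degree_eq_sum]; simp [← hxt])
    rw [coeff_sum] at hα
    apply hx0
    have hmon : ∀ β : σ → Fin s, (∏ i, X i ^ (β i : ℕ) : MvPolynomial σ K) =
        monomial (Finsupp.equivFunOnFinite.symm fun i => (β i : ℕ)) 1 := by
      intro β
      rw [monomial_eq, C_1, one_mul, Finsupp.prod_fintype _ _ (by simp)]
      simp
    rw [Finset.sum_eq_single (z, α)] at hα
    · rw [if_pos ⟨rfl, hxt⟩, hmon] at hα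
      simpa using hα
    · rintro ⟨y, β⟩ _ hb
      split_ifs with h
      · rw [hmon, coeff_smul, coeff_monomial, if_neg, smul_zero]
        intro h'
        apply hb
        rw [Prod.mk.injEq]
        refine ⟨h.1, ?_⟩
        ext i
        have := congrFun (Finsupp.equivFunOnFinite.symm.injective h') i
        exact this
      · simp
    · exact fun h => absurd (Finset.mem_univ _) h
  obtain ⟨hf, hr⟩ := finrank_restrictTotalDegree_le (σ := σ) (K := K) M
  have hli' : LinearIndependent K fun x => (⟨v x, hmem x⟩ : restrictTotalDegree σ K M) :=
    LinearIndependent.of_comp (restrictTotalDegree σ K M).subtype hli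
  have hcard := hli'.fintype_card_le_finrank.trans hr
  simp only [Fintype.card_prod, Fintype.card_coe, Fintype.card_fun, Fintype.card_fin] at hcard
  have hM : M + 1 ≤ s * (N * D + 1) := by simp only [M, s]; nlinarith [Nat.zero_le (N * D)]
  have : Z.card * s ^ N ≤ (N * D + 1) ^ N * s ^ N := by
    calc _ ≤ (M + 1) ^ N := hcard
      _ ≤ (s * (N * D + 1)) ^ N := Nat.pow_le_pow_left hM N
      _ = _ := by rw [mul_pow, mul_comm]
  exact Nat.le_of_mul_le_mul_right this (by positivity)

open DualNumber in
lemma aeval_dual_of_shift (z v : σ → K) (p : MvPolynomial σ K) :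
    aeval (fun j => algebraMap K (DualNumber K) (z j) + v j • ε) p =
      algebraMap K (DualNumber K) (eval z p) +
        (∑ j, coeff (Finsupp.single j 1) (shift z p) * v j) • (ε : DualNumber K) := by
  have h1 : (aeval (fun j => algebraMap K (DualNumber K) (z j) + v j • ε) : _ →ₐ[K] DualNumber K) =
      (aeval (fun j => v j • (ε : DualNumber K))).comp (shift z) := by
    ext i : 1; simp [shift, add_comm]
  rw [h1, AlgHom.comp_apply]
  set q := shift z p
  set φ : MvPolynomial σ K →ₐ[K] DualNumber K := aeval (fun j => v j • (ε : DualNumber K))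
  have hφ : ∀ r ∈ idealOfVars σ K ^ 2, φ r = 0 := by
    have h : idealOfVars σ K ≤ (Ideal.span {(ε : DualNumber K)}).comap (φ : _ →+* DualNumber K) := by
      rw [idealOfVars, Ideal.span_le]
      rintro _ ⟨i, rfl⟩
      simp only [Ideal.coe_comap, Set.mem_preimage, SetLike.mem_coe]
      change φ (X i) ∈ _
      simp only [φ, aeval_X]
      exact Submodule.smul_of_tower_mem _ _ (Ideal.subset_span rfl)
    have h2 : idealOfVars σ K ^ 2 ≤ (⊥ : Ideal (DualNumber K)).comap (φ : _ →+* DualNumber K) := by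
      refine (Ideal.pow_right_mono h 2).trans ((Ideal.le_comap_pow _ 2).trans ?_)
      refine Ideal.comap_mono ?_
      rw [Ideal.span_singleton_pow, sq, DualNumber.eps_mul_eps]
      simp
    intro r hr
    simpa using h2 hr
  have h := hφ _ (sub_linear_mem q)
  rw [map_sub, map_sub, sub_sub, sub_eq_zero] at h
  rw [h, constantCoeff_shift]
  congr 1
  · exact φ.commutes _
  · rw [map_sum, Finset.sum_smul]
    refine Finset.sum_congr rfl fun j _ => ?_
    have hX : φ (X j) = v j • ε := by simp [φ]
    have hC : φ (C (coeff (Finsupp.single j 1) q)) = algebraMap K _ (coeff (Finsupp.single j 1) q) :=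
      φ.commutes _
    rw [map_mul, hX, hC, ← Algebra.smul_def, smul_smul]

open DualNumber in
/-- A weak form of Bezout's theorem: a system of polynomials of degree at most `D` in `N` variables
has at most `(N * D + 1) ^ N` nondegenerate zeros. -/
theorem card_nondegenerate_zeros_le {ι : Type} [Fintype ι] (D : ℕ) (f : ι → MvPolynomial σ K)
    (hdeg : ∀ i, (f i).totalDegree ≤ D) (Z : Finset (σ → K))
    (hvan : ∀ z ∈ Z, ∀ i, eval z (f i) = 0)
    (hnd : ∀ z ∈ Z, ∀ v : σ → K,
      (∀ i, aeval (fun j => algebraMap K (DualNumber K) (z j) + v j • ε) (f i) = 0) → v = 0) :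
    Z.card ≤ (Fintype.card σ * D + 1) ^ Fintype.card σ := by
  classical
  have key : ∀ z ∈ Z, ∃ g : σ → ι → K, ∀ s j,
      ∑ i, g s i * coeff (Finsupp.single j 1) (shift z (f i)) = if s = j then 1 else 0 := by
    intro z hz
    let A : Matrix ι σ K := fun i j => coeff (Finsupp.single j 1) (shift z (f i))
    have hinj : LinearMap.ker (Matrix.toLin' A) = ⊥ := by
      rw [LinearMap.ker_eq_bot']
      intro v hv
      apply hnd z hz v
      intro i
      rw [aeval_dual_of_shift, hvan z hz i]
      have : ∑ j, coeff (Finsupp.single j 1) (shift z (f i)) * v j = 0 := congrFun hv i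
      rw [this]; simp
    obtain ⟨g, hg⟩ := LinearMap.exists_leftInverse_of_injective _ hinj
    have hG : LinearMap.toMatrix' g * A = 1 := by
      have := congrArg LinearMap.toMatrix' hg
      rwa [LinearMap.toMatrix'_comp, LinearMap.toMatrix'_toLin', LinearMap.toMatrix'_id] at this
    refine ⟨LinearMap.toMatrix' g, fun s j => ?_⟩
    have := congrFun (congrFun hG s) j
    rw [Matrix.mul_apply, Matrix.one_apply] at this
    exact this
  choose! g hg using key
  refine card_le_of_normalized Z D (fun z s => ∑ i, C (g z s i) * f i) ?_ ?_ ?_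
  · intro z _ s
    refine totalDegree_finsetSum_le fun i _ => ?_
    rw [← smul_eq_C_mul]
    exact (totalDegree_smul_le _ _).trans (hdeg i)
  · intro z _ z' hz' s
    rw [map_sum]
    exact Finset.sum_eq_zero fun i _ => by rw [map_mul, hvan z' hz' i, mul_zero]
  · intro z hz s
    have h := sub_linear_mem (shift z (∑ i, C (g z s i) * f i))
    rw [constantCoeff_shift] at h
    have h0 : eval z (∑ i, C (g z s i) * f i) = 0 := by
      rw [map_sum]
      exact Finset.sum_eq_zero fun i _ => by rw [map_mul, hvan z hz i, mul_zero]
    have h1 : ∀ j, coeff (Finsupp.single j 1) (shift z (∑ i, C (g z s i) * f i)) =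
        if s = j then 1 else 0 := by
      intro j
      rw [← hg z hz s j, map_sum, coeff_sum]
      refine Finset.sum_congr rfl fun i _ => ?_
      rw [← smul_eq_C_mul, map_smul, coeff_smul, smul_eq_mul]
    simp_rw [h0, h1] at h
    simpa [ite_mul] using h

end Bezout

open Matrix
open scoped Pointwise

section SLGen

variable {ι : Type} [Fintype ι] [DecidableEq ι] {K : Type} [Field K]

/-- The matrix underlying an element of the special linear group. -/
def mat {R : Type} [CommRing R] (g : SpecialLinearGroup ι R) : Matrix ι ι R := g.1

section mat

variable {R : Type} [CommRing R] (g h : SpecialLinearGroup ι R)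

lemma mat_mul : mat (g * h) = mat g * mat h := rfl

lemma mat_one : mat (1 : SpecialLinearGroup ι R) = 1 := rfl

lemma det_mat : (mat g).det = 1 := g.2

lemma mat_mul_mat_inv : mat g * mat g⁻¹ = 1 := by
  rw [← mat_mul, mul_inv_cancel, mat_one]

lemma mat_inv_mul_mat : mat g⁻¹ * mat g = 1 := by
  rw [← mat_mul, inv_mul_cancel, mat_one]

lemma mat_injective : Function.Injective (mat : SpecialLinearGroup ι R → Matrix ι ι R) :=
  Subtype.val_injective

lemma mat_transvection {i j : ι} (hij : i ≠ j) (t : R) :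
    mat (SpecialLinearGroup.transvection hij t) = 1 + Matrix.single i j t :=
  SpecialLinearGroup.transvection_coe hij t

end mat

lemma diag2n_eq_prod {i j : ι} (hij : i ≠ j) (c : K) (hc : c ≠ 0) :
    SpecialLinearGroup.diag2n hij c hc =
      SpecialLinearGroup.transvection hij c * SpecialLinearGroup.transvection hij.symm (-c⁻¹) *
      SpecialLinearGroup.transvection hij c * SpecialLinearGroup.transvection hij (-1) *
      SpecialLinearGroup.transvection hij.symm 1 * SpecialLinearGroup.transvection hij (-1) := by
  have hact : ∀ {a b : ι} (hab : a ≠ b) (t : K) (v : ι → K),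
      mat (SpecialLinearGroup.transvection hab t) *ᵥ v = fun k => v k + if k = a then t * v b else 0 := by
    intro a b hab t v
    rw [mat_transvection]
    ext k
    simp [add_mulVec, single_mulVec, Function.update_apply]
  apply mat_injective
  refine Matrix.toLin'.injective (LinearMap.ext fun v => ?_)
  have hd : mat (SpecialLinearGroup.diag2n hij c hc) =
    diagonal (fun k => if k = i then c else if k = j then c⁻¹ else 1) := rfl
  simp only [mat_mul, Matrix.toLin'_apply, ← mulVec_mulVec, hact, hd]
  ext k
  rw [mulVec_diagonal]
  by_cases h1 : k = i
  · subst h1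
    simp [hij, hij.symm]
    field_simp
    ring
  · by_cases h2 : k = j
    · subst h2
      simp [hij, hij.symm]
      field_simp
      ring
    · simp [h1, h2]

/-- Transvections generate the special linear group as a monoid. -/
lemma mem_of_transvection_mem [Nontrivial ι] (M : Submonoid (SpecialLinearGroup ι K))
    (h : ∀ (i j : ι) (hij : i ≠ j) (t : K), SpecialLinearGroup.transvection hij t ∈ M)
    (g : SpecialLinearGroup ι K) : g ∈ M := by
  refine SpecialLinearGroup.diagonal_transvection_induction' (· ∈ M) g ?_ h fun _ _ => M.mul_mem
  intro i j hij c hc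
  rw [diag2n_eq_prod]
  have := h
  exact M.mul_mem (M.mul_mem (M.mul_mem (M.mul_mem (M.mul_mem (h _ _ _ _) (h _ _ _ _))
    (h _ _ _ _)) (h _ _ _ _)) (h _ _ _ _)) (h _ _ _ _)

end SLGen

section Escape

variable {ι : Type} [Fintype ι] [DecidableEq ι]
variable {J : Type} [Fintype J] [DecidableEq J]

/-- The coordinates of a tuple of matrices. -/
def coords {R : Type} (b : J → Matrix ι ι R) : J × ι × ι → R := fun x => b x.1 x.2.1 x.2.2

variable {K : Type} [Field K]

lemma totalDegree_aeval_le {σ τ : Type} (p : MvPolynomial σ K) (f : σ → MvPolynomial τ K)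
    (hf : ∀ i, (f i).totalDegree ≤ 1) : (aeval f p).totalDegree ≤ p.totalDegree := by
  rw [aeval_def, eval₂]
  refine totalDegree_finsetSum_le fun d hd => ?_
  change (MvPolynomial.C _ * _).totalDegree ≤ _
  rw [← smul_eq_C_mul]
  refine (totalDegree_smul_le _ _).trans ?_
  refine (totalDegree_finsetProd _ _).trans ?_
  refine le_trans (Finset.sum_le_sum fun i _ => ?_) (le_totalDegree hd)
  refine (totalDegree_pow _ _).trans ?_
  calc _ ≤ d i * 1 := Nat.mul_le_mul le_rfl (hf i)
    _ = _ := mul_one _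

/-- Right translation of a polynomial in tuples of matrices. -/
noncomputable def rmul (b : J → Matrix ι ι K) :
    MvPolynomial (J × ι × ι) K →ₐ[K] MvPolynomial (J × ι × ι) K :=
  aeval fun x => ∑ k, MvPolynomial.C (b x.1 k x.2.2) * X (x.1, x.2.1, k)

lemma eval_rmul (b g : J → Matrix ι ι K) (p : MvPolynomial (J × ι × ι) K) :
    eval (coords g) (rmul b p) = eval (coords (g * b)) p := by
  have h : ((eval (coords g)).comp (rmul b : _ →+* MvPolynomial (J × ι × ι) K)) =
      eval (coords (g * b)) := by
    ext x
    · simp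
    · simp [rmul, coords, Matrix.mul_apply, mul_comm]
  exact congrArg (fun φ => φ p) h

lemma totalDegree_rmul_le (b : J → Matrix ι ι K) (p : MvPolynomial (J × ι × ι) K) :
    (rmul b p).totalDegree ≤ p.totalDegree := by
  refine totalDegree_aeval_le _ _ fun x => totalDegree_finsetSum_le fun k _ => ?_
  rw [← smul_eq_C_mul]
  exact (totalDegree_smul_le _ _).trans (by simp)

variable {F : Type} [Field F] [Fintype F] [Algebra F K]

/-- Extension of scalars for tuples of special linear matrices. -/
def ext (K : Type) [Field K] [Algebra F K] (g : J → SpecialLinearGroup ι F) : J → Matrix ι ι K :=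
  fun c => (mat (g c)).map (algebraMap F K)

lemma ext_mul (g h : J → SpecialLinearGroup ι F) : ext K (g * h) = ext K g * ext K h := by
  funext c
  simp [ext, mat_mul, Matrix.map_mul]

lemma eval_eq_zero_of_forall_ext [Nontrivial ι] (D : ℕ) (hD : D < Fintype.card F)
    (p : MvPolynomial (J × ι × ι) K) (hp : p.totalDegree ≤ D)
    (hvan : ∀ g : J → SpecialLinearGroup ι F, eval (coords (ext K g)) p = 0)
    (b : J → SpecialLinearGroup ι K) : eval (coords fun c => mat (b c)) p = 0 := by
  let V : Set (MvPolynomial (J × ι × ι) K) := {p | p.totalDegree ≤ D ∧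
    ∀ g : J → SpecialLinearGroup ι F, eval (coords (ext K g)) p = 0}
  let S : Submonoid (J → SpecialLinearGroup ι K) :=
    { carrier := {b | ∀ p ∈ V, rmul (fun c => mat (b c)) p ∈ V}
      one_mem' := by
        intro p hp
        have : rmul (fun c : J => mat ((1 : J → SpecialLinearGroup ι K) c)) p = p := by
          have h : rmul (fun c : J => mat ((1 : J → SpecialLinearGroup ι K) c)) = AlgHom.id K _ := by
            apply MvPolynomial.algHom_ext
            rintro ⟨c, i, j⟩
            simp [rmul, mat_one, Matrix.one_apply, apply_ite, ite_mul]
          rw [h]; rfl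
        rw [this]; exact hp
      mul_mem' := by
        intro a b ha hb p hp
        have h : rmul (fun c : J => mat ((a * b) c)) p =
            rmul (fun c => mat (a c)) (rmul (fun c => mat (b c)) p) := by
          have h : rmul (fun c : J => mat ((a * b) c)) =
              (rmul (fun c => mat (a c))).comp (rmul (fun c => mat (b c))) := by
            apply MvPolynomial.algHom_ext
            rintro ⟨c, i, j⟩
            simp only [rmul, Pi.mul_apply, mat_mul, Matrix.mul_apply, aeval_X,
              AlgHom.comp_apply, map_sum, map_mul, Finset.sum_mul, Finset.mul_sum]
            rw [Finset.sum_comm]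
            refine Finset.sum_congr rfl fun k _ => Finset.sum_congr rfl fun l _ => ?_
            rw [show (aeval _ (MvPolynomial.C (mat (b c) k j)) : MvPolynomial (J × ι × ι) K) =
              MvPolynomial.C (mat (b c) k j) from AlgHom.commutes _ _]
            ring
          rw [h]; rfl
        rw [h]
        exact ha _ (hb _ hp) }
  have hS : ∀ b, b ∈ S := by
    intro b
    refine Submonoid.pi_mem_of_mulSingle_mem b fun c => ?_
    refine mem_of_transvection_mem (S.comap (MonoidHom.mulSingle (fun _ : J => SpecialLinearGroup ι K) c)) ?_ (b c)
    intro i j hij t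
    rw [Submonoid.mem_comap]
    intro p hp
    refine ⟨(totalDegree_rmul_le _ _).trans hp.1, fun g => ?_⟩
    rw [eval_rmul]
    -- one-parameter polynomial
    let f : J × ι × ι → Polynomial K := fun x =>
      Polynomial.C (coords (ext K g) x) +
        Polynomial.C (if x.1 = c ∧ x.2.2 = j then ext K g c x.2.1 i else 0) * Polynomial.X
    have hf : ∀ x, (f x).natDegree ≤ 1 := fun x => by
      simp only [f]; compute_degree
    have hdeg : (aeval f p).natDegree ≤ D := by
      simpa using aeval_natDegree_le p hp.1 f hf
    have hmulSingle : ∀ t : K, ∀ x, (f x).eval t = coords (ext K g * fun c' =>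
        mat ((Pi.mulSingle c (SpecialLinearGroup.transvection hij t) :
          J → SpecialLinearGroup ι K) c')) x := by
      rintro t ⟨c', k, l⟩
      simp only [f, coords, Polynomial.eval_add, Polynomial.eval_C, Polynomial.eval_mul,
        Polynomial.eval_X, Pi.mul_apply]
      by_cases hc : c' = c
      · subst hc
        simp only [Pi.mulSingle_eq_same, mat_transvection, Matrix.mul_add,
          Matrix.mul_one, Matrix.add_apply, true_and]
        congr 1
        by_cases hl : l = j
        · subst hl; simp
        · rw [if_neg hl, Matrix.mul_single_apply_of_ne _ _ _ _ _ hl]; simp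
      · simp [hc, mat_one]
    have heval : ∀ t : K, (aeval f p).eval t = eval (coords (ext K g * fun c' =>
        mat ((Pi.mulSingle c (SpecialLinearGroup.transvection hij t) :
          J → SpecialLinearGroup ι K) c'))) p := by
      intro t
      have h : ((Polynomial.evalRingHom t).comp (aeval f : _ →ₐ[K] Polynomial K).toRingHom) =
          eval (coords (ext K g * fun c' =>
        mat ((Pi.mulSingle c (SpecialLinearGroup.transvection hij t) :
          J → SpecialLinearGroup ι K) c'))) := by
        ext x
        · simp
        · simp [hmulSingle]
      exact congrArg (fun φ => φ p) h
    have hzero : aeval f p = 0 := by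
      refine Polynomial.eq_zero_of_natDegree_lt_card_of_eval_eq_zero (aeval f p)
        (ι := F) (f := algebraMap F K) (algebraMap F K).injective ?_ (hdeg.trans_lt hD)
      intro u
      rw [heval, ← hp.2 (g * Pi.mulSingle c (SpecialLinearGroup.transvection hij u)), ext_mul]
      congr 3
      funext c'
      rw [Pi.mul_apply, Pi.mul_apply]
      congr 1
      by_cases hc : c' = c
      · subst hc
        simp only [ext, Pi.mulSingle_eq_same, mat_transvection]
        rw [Matrix.map_add _ (map_add _), Matrix.map_one _ (map_zero _) (map_one _),
          Matrix.map_single]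
      · simp [ext, Pi.mulSingle_eq_of_ne hc, mat_one]
    have := heval t
    rw [hzero, Polynomial.eval_zero] at this
    exact this.symm
  have := (hS b p ⟨hp, hvan⟩).2 1
  rw [eval_rmul] at this
  have h1 : (ext K (1 : J → SpecialLinearGroup ι F) * fun c => mat (b c)) = fun c => mat (b c) := by
    funext c
    rw [Pi.mul_apply]
    simp [ext, mat_one]
  rwa [h1] at this

lemma antitone_stabilizes {V : Type} [AddCommGroup V] [Module K V] (W : ℕ → Submodule K V)
    (hW : ∀ j, W (j + 1) ≤ W j) (hs : ∀ j, W (j + 1) = W j → W (j + 2) = W (j + 1))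
    [Module.Finite K (W 0)] (r : ℕ) (hr : Module.finrank K (W 0) ≤ r) (i : ℕ) :
    W (r + i) = W r := by
  have hanti : Antitone W := antitone_nat_of_succ_le hW
  have hst : ∀ j, W (j + 1) = W j → ∀ i, j ≤ i → W i = W j := by
    intro j hj i hi
    have h2 : ∀ k, W (j + k + 1) = W (j + k) := by
      intro k
      induction k with
      | zero => exact hj
      | succ k ih => exact hs _ ih
    obtain ⟨k, rfl⟩ := Nat.exists_eq_add_of_le hi
    induction k with
    | zero => rfl
    | succ k ih => rw [← add_assoc, h2, ih (Nat.le_add_right _ _)]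
  have hfin : ∀ j, Module.Finite K (W j) := fun j =>
    Submodule.finiteDimensional_of_le (hanti (Nat.zero_le j))
  have key : ∀ j, Module.finrank K (W j) + j ≤ r ∨ ∃ i < j, W (i + 1) = W i := by
    intro j
    induction j with
    | zero => left; simpa using hr
    | succ j ih =>
      rcases ih with h | ⟨i, hi, h⟩
      · by_cases he : W (j + 1) = W j
        · exact Or.inr ⟨j, Nat.lt_succ_self _, he⟩
        · left
          have := Submodule.finrank_lt_finrank_of_lt (lt_of_le_of_ne (hW j) he)
          omega
      · exact Or.inr ⟨i, hi.trans (Nat.lt_succ_self _), h⟩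
  rcases key (r + 1) with h | ⟨j, hj, h⟩
  · omega
  · rw [hst j h (r + i) (by omega), hst j h r (by omega)]

lemma exists_mem_pow_of_closure {G : Type} [Group G] [Finite G] (H : Set G) (h1 : (1 : G) ∈ H)
    (hcl : Subgroup.closure H = ⊤) : ∃ j, ∀ g, g ∈ H ^ j := by
  have hmono : Monotone fun j : ℕ => H ^ j := fun a b hab => Set.pow_subset_pow_right h1 hab
  have h : ∀ g : G, ∃ j, g ∈ H ^ j := by
    intro g
    have hg : g ∈ (Subgroup.closure H).toSubmonoid := by rw [hcl]; trivial
    rw [Subgroup.closure_toSubmonoid_of_finite] at hg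
    induction hg using Submonoid.closure_induction with
    | mem x hx => exact ⟨1, by simpa using hx⟩
    | one => exact ⟨0, by simp⟩
    | mul x y _ _ hx hy =>
      obtain ⟨a, ha⟩ := hx
      obtain ⟨b, hb⟩ := hy
      exact ⟨a + b, by rw [pow_add]; exact Set.mul_mem_mul ha hb⟩
  choose j hj using h
  obtain ⟨B, hB⟩ := (Set.finite_range j).bddAbove
  exact ⟨B, fun g => hmono (hB ⟨g, rfl⟩) (hj g)⟩

variable (ι J) in
/-- Escape from subvarieties: a nonzero function of bounded degree is nonzero at some member of a
bounded test set whose entries are short words in a given generating set. -/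
theorem escape [Nontrivial ι] (D : ℕ) : ∃ k N : ℕ, ∀ (F K : Type) [Field F] [Fintype F] [Field K]
    [Algebra F K], D < Fintype.card F → ∀ H : Set (SpecialLinearGroup ι F), (1 : _) ∈ H →
    Subgroup.closure H = ⊤ → ∃ S : Finset (J → SpecialLinearGroup ι F), S.card ≤ N ∧
      (∀ s ∈ S, ∀ c, s c ∈ H ^ k) ∧
      ∀ p : MvPolynomial (J × ι × ι) K, p.totalDegree ≤ D →
        (∃ b : J → SpecialLinearGroup ι K, eval (coords fun c => mat (b c)) p ≠ 0) →
        ∃ s ∈ S, eval (coords (ext K s)) p ≠ 0 := by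
  set r := (D + 1) ^ Fintype.card (J × ι × ι)
  refine ⟨r, r, ?_⟩
  intro F K _ _ _ _ hD H h1 hcl
  obtain ⟨hfin, hrank⟩ := finrank_restrictTotalDegree_le (σ := J × ι × ι) (K := K) D
  let W : ℕ → Submodule K (MvPolynomial (J × ι × ι) K) := fun j =>
    { carrier := {p | p.totalDegree ≤ D ∧ ∀ s : J → SpecialLinearGroup ι F, (∀ c, s c ∈ H ^ j) →
        eval (coords (ext K s)) p = 0}
      zero_mem' := by simp
      add_mem' := by
        rintro a b ⟨ha, ha'⟩ ⟨hb, hb'⟩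
        refine ⟨(totalDegree_add _ _).trans (max_le ha hb), fun s hs => ?_⟩
        rw [map_add, ha' s hs, hb' s hs, add_zero]
      smul_mem' := by
        rintro c a ⟨ha, ha'⟩
        refine ⟨(totalDegree_smul_le _ _).trans ha, fun s hs => ?_⟩
        rw [smul_eval, ha' s hs, mul_zero] }
  have hW0 : W 0 ≤ restrictTotalDegree _ K D := fun p hp => (mem_restrictTotalDegree _ _ _).2 hp.1
  have : Module.Finite K (W 0) := Submodule.finiteDimensional_of_le hW0
  have hstab := antitone_stabilizes W (fun j p hp => ⟨hp.1, fun s hs => hp.2 s fun c =>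
      Set.pow_subset_pow_right h1 (Nat.le_succ j) (hs c)⟩) (by
      intro j hj
      refine le_antisymm (fun p hp => ⟨hp.1, fun s hs => hp.2 s fun c =>
        Set.pow_subset_pow_right h1 (Nat.le_succ _) (hs c)⟩) ?_
      intro p hp
      refine ⟨hp.1, fun s hs => ?_⟩
      have h2 : ∀ c, ∃ a ∈ H ^ (j + 1), ∃ b ∈ H, a * b = s c := by
        intro c
        have := hs c
        rwa [show j + 2 = (j + 1) + 1 from rfl, pow_succ] at this
      choose a ha b hb hab using h2
      have hs' : s = a * b := funext fun c => (hab c).symm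
      have hmem : rmul (ext K b) p ∈ W j := by
        refine ⟨(totalDegree_rmul_le _ _).trans hp.1, fun t ht => ?_⟩
        rw [eval_rmul, ← ext_mul]
        exact hp.2 _ fun c => by rw [pow_succ]; exact Set.mul_mem_mul (ht c) (hb c)
      rw [← hj] at hmem
      have := hmem.2 a ha
      rwa [eval_rmul, ← ext_mul, ← hs'] at this)
    r ((Submodule.finrank_mono hW0).trans hrank)
  -- test functionals
  let ev : (J → SpecialLinearGroup ι F) → Module.Dual K (restrictTotalDegree (J × ι × ι) K D) :=
    fun s => (aeval (coords (ext K s)) : _ →ₐ[K] K).toLinearMap.comp (Submodule.subtype _)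
  let Y : Set (J → SpecialLinearGroup ι F) := {s | ∀ c, s c ∈ H ^ r}
  obtain ⟨B, hBsub, hBspan, hBli⟩ := exists_linearIndependent K (ev '' Y)
  have hBfin : B.Finite := hBli.setFinite
  have := hBfin.fintype
  have hBcard : Fintype.card B ≤ r := by
    refine hBli.fintype_card_le_finrank.trans ?_
    rw [Subspace.dual_finrank_eq]; exact hrank
  have hch : ∀ x : B, ∃ s, s ∈ Y ∧ ev s = x.1 := fun x => hBsub x.2
  choose φ hφ hφ' using hch
  classical
  refine ⟨Finset.univ.image φ, Finset.card_image_le.trans (by simpa using hBcard), ?_, ?_⟩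
  · intro s hs
    obtain ⟨x, _, rfl⟩ := Finset.mem_image.1 hs
    exact hφ x
  · intro p hp ⟨b, hb⟩
    by_contra! hcon
    apply hb
    refine eval_eq_zero_of_forall_ext (F := F) D hD p hp ?_ b
    have hpW : p ∈ W r := by
      refine ⟨hp, fun s hs => ?_⟩
      have hin : ev s ∈ Submodule.span K B := by
        rw [hBspan]; exact Submodule.subset_span ⟨s, hs, rfl⟩
      have hle : Submodule.span K B ≤ LinearMap.ker (LinearMap.applyₗ
          (⟨p, (mem_restrictTotalDegree _ _ _).2 hp⟩ : restrictTotalDegree (J × ι × ι) K D) :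
          Module.Dual K (restrictTotalDegree (J × ι × ι) K D) →ₗ[K] K) := by
        rw [Submodule.span_le]
        intro x hx
        have h3 := hcon (φ ⟨x, hx⟩) (Finset.mem_image_of_mem _ (Finset.mem_univ _))
        have h4 := hφ' ⟨x, hx⟩
        simp only [SetLike.mem_coe, LinearMap.mem_ker, LinearMap.applyₗ_apply_apply]
        rw [← show ev (φ ⟨x, hx⟩) = x from h4]
        simpa [ev, aeval_eq_eval] using h3
      have h5 := hle hin
      simpa [ev, aeval_eq_eval] using h5
    obtain ⟨j, hj⟩ := exists_mem_pow_of_closure H h1 hcl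
    rw [← hstab j] at hpW
    exact fun g => hpW.2 g fun c => Set.pow_subset_pow_right h1 (Nat.le_add_left _ _) (hj (g c))

end Escape

section Natural

/-- A function of parameters `τ → R` and variables `σ → R`, defined uniformly in the commutative
ring `R` and compatible with ring homomorphisms: a polynomial with integer coefficients. -/
structure NatFun (τ σ : Type) where
  toFun : ∀ (R : Type) [CommRing R], (τ → R) → (σ → R) → R
  map_toFun : ∀ (R S : Type) [CommRing R] [CommRing S] (f : R →+* S) (w : τ → R) (b : σ → R),
    f (toFun R w b) = toFun S (f ∘ w) (f ∘ b)

variable {τ σ : Type}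

lemma NatFun.exists_poly (Φ : NatFun τ σ) : ∃ D, ∀ (K : Type) [Field K] (w : τ → K),
    ∃ p : MvPolynomial σ K, p.totalDegree ≤ D ∧ ∀ (S : Type) [CommRing S] [Algebra K S] (b : σ → S),
      aeval b p = Φ.toFun S (algebraMap K S ∘ w) b := by
  let P : MvPolynomial (τ ⊕ σ) ℤ := Φ.toFun _ (X ∘ Sum.inl) (X ∘ Sum.inr)
  refine ⟨P.totalDegree, fun K _ w => ?_⟩
  let f : τ ⊕ σ → MvPolynomial σ K := Sum.elim (C ∘ w) X
  refine ⟨aeval f P, ?_, ?_⟩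
  · rw [aeval_def, eval₂]
    refine totalDegree_finsetSum_le fun d hd => ?_
    refine (totalDegree_mul _ _).trans ?_
    have h0 : (algebraMap ℤ (MvPolynomial σ K) (coeff d P)).totalDegree = 0 := by
      rw [← totalDegree_C (σ := σ) ((coeff d P : ℤ) : K)]
      simp
    change (algebraMap ℤ (MvPolynomial σ K) (coeff d P)).totalDegree + _ ≤ _
    rw [h0, zero_add]
    refine (totalDegree_finsetProd _ _).trans ?_
    refine le_trans (Finset.sum_le_sum fun i _ => ?_) (le_totalDegree hd)
    refine (totalDegree_pow _ _).trans ?_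
    calc _ ≤ d i * 1 := Nat.mul_le_mul le_rfl (by cases i <;> simp [f])
      _ = _ := mul_one _
  · intro S _ _ b
    have h1 := Φ.map_toFun _ _ ((aeval b : MvPolynomial σ K →ₐ[K] S).toRingHom.comp
      (aeval f : MvPolynomial (τ ⊕ σ) ℤ →ₐ[ℤ] MvPolynomial σ K).toRingHom)
      (X ∘ Sum.inl) (X ∘ Sum.inr)
    refine h1.trans ?_
    congr 1
    · funext i; simp [f]
    · funext i; simp [f]

lemma NatFun.exists_bound {ι : Type} [Fintype ι] (Φ : ι → NatFun τ σ) : ∃ D,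
    ∀ (K : Type) [Field K] (w : τ → K), ∃ p : ι → MvPolynomial σ K, ∀ i, (p i).totalDegree ≤ D ∧
      ∀ (S : Type) [CommRing S] [Algebra K S] (b : σ → S),
      aeval b (p i) = (Φ i).toFun S (algebraMap K S ∘ w) b := by
  choose D hD using fun i => (Φ i).exists_poly
  refine ⟨Finset.univ.sup D, fun K _ w => ?_⟩
  choose p hp using fun i => hD i K w
  exact ⟨p, fun i => ⟨(hp i).1.trans (Finset.le_sup (Finset.mem_univ i)), (hp i).2⟩⟩

open DualNumber in
lemma natural_bezout [Fintype σ] [DecidableEq σ] {ι : Type} [Fintype ι] (Φ : ι → NatFun τ σ) :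
    ∃ M : ℕ, ∀ (K : Type) [Field K] (w : τ → K) (Z : Finset (σ → K)),
      (∀ z ∈ Z, ∀ i, (Φ i).toFun K w z = 0) →
      (∀ z ∈ Z, ∀ v : σ → K, (∀ i, (Φ i).toFun (DualNumber K) (algebraMap K (DualNumber K) ∘ w)
        (fun j => algebraMap K (DualNumber K) (z j) + v j • ε) = 0) → v = 0) →
      Z.card ≤ M := by
  obtain ⟨D, hD⟩ := NatFun.exists_bound Φ
  refine ⟨(Fintype.card σ * D + 1) ^ Fintype.card σ, fun K _ w Z h1 h2 => ?_⟩
  obtain ⟨p, hp⟩ := hD K w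
  refine card_nondegenerate_zeros_le D p (fun i => (hp i).1) Z ?_ ?_
  · intro z hz i
    rw [← aeval_eq_eval, (hp i).2 K z]
    exact h1 z hz i
  · intro z hz v hv
    refine h2 z hz v fun i => ?_
    rw [← (hp i).2]
    exact hv i

variable (ι J : Type) [Fintype ι] [DecidableEq ι] [Fintype J] [DecidableEq J]

lemma natural_escape [Nontrivial ι] (Φ : NatFun τ (J × ι × ι)) : ∃ k N Q : ℕ,
    ∀ (F K : Type) [Field F] [Fintype F] [Field K] [Algebra F K], Q < Fintype.card F →
    ∀ H : Set (SpecialLinearGroup ι F), (1 : _) ∈ H → Subgroup.closure H = ⊤ →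
    ∃ S : Finset (J → SpecialLinearGroup ι F), S.card ≤ N ∧ (∀ s ∈ S, ∀ c, s c ∈ H ^ k) ∧
      ∀ w : τ → K, (∃ b : J → SpecialLinearGroup ι K,
        Φ.toFun K w (coords fun c => mat (b c)) ≠ 0) →
        ∃ s ∈ S, Φ.toFun K w (coords (ext K s)) ≠ 0 := by
  obtain ⟨D, hD⟩ := Φ.exists_poly
  obtain ⟨k, N, h⟩ := escape ι J D
  refine ⟨k, N, D, fun F K _ _ _ _ hQ H h1 hcl => ?_⟩
  obtain ⟨S, hS, hSk, hSp⟩ := h F K hQ H h1 hcl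
  refine ⟨S, hS, hSk, fun w hb => ?_⟩
  obtain ⟨p, hp, hp'⟩ := hD K w
  have hev : ∀ b : J × ι × ι → K, eval b p = Φ.toFun K w b := fun b => by
    rw [← aeval_eq_eval]; exact hp' K b
  have := hSp p hp
  simp_rw [hev] at this
  exact this hb

end Natural

section Regular

variable {ι : Type} [Fintype ι] [DecidableEq ι] {K : Type} [Field K]

/-- `A = p diag(l) p⁻¹` with `p` in the special linear group. -/
def DiagBy (A : Matrix ι ι K) (p : SpecialLinearGroup ι K) (l : ι → K) : Prop :=
  A = mat p * diagonal l * mat p⁻¹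

/-- The value of the derivative of the characteristic polynomial. -/
noncomputable def disc {R : Type} [CommRing R] (A : Matrix ι ι R) : R :=
  (Polynomial.aeval A (Polynomial.derivative A.charpoly)).det

lemma map_disc {R S : Type} [CommRing R] [CommRing S] (f : R →+* S) (A : Matrix ι ι R) :
    f (disc A) = disc (A.map f) := by
  rw [disc, disc, RingHom.map_det]
  congr 1
  rw [Matrix.charpoly_map, Polynomial.derivative_map, Polynomial.aeval_eq_sum_range,
    Polynomial.aeval_eq_sum_range' (Nat.lt_succ_of_le Polynomial.natDegree_map_le), map_sum]
  refine Finset.sum_congr rfl fun i _ => ?_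
  rw [Polynomial.coeff_map, ← RingHom.mapMatrix_apply, ← map_pow]
  ext a b
  simp

lemma aeval_diagonal (q : Polynomial K) (l : ι → K) :
    Polynomial.aeval (diagonal l) q = diagonal fun i => q.eval (l i) := by
  have h := Polynomial.aeval_algHom_apply (Matrix.diagonalAlgHom K (n := ι) (α := K)) l q
  rw [Matrix.diagonalAlgHom_apply] at h
  rw [h, Matrix.diagonalAlgHom_apply]
  congr 1
  funext i
  simp [Polynomial.aeval_def, Polynomial.eval₂_eq_eval_map]

lemma disc_diagonal_ne_zero (l : ι → K) (hl : Function.Injective l) : disc (diagonal l) ≠ 0 := by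
  rw [disc, Matrix.charpoly_diagonal, aeval_diagonal, det_diagonal]
  refine Finset.prod_ne_zero_iff.2 fun i _ => ?_
  have hsep : (∏ i, (Polynomial.X - Polynomial.C (l i))).Separable :=
    Polynomial.separable_prod_X_sub_C_iff.2 hl
  have := hsep.aeval_derivative_ne_zero (x := l i) (by
    rw [Polynomial.coe_aeval_eq_eval, Polynomial.eval_prod]
    exact Finset.prod_eq_zero (Finset.mem_univ i) (by simp))
  simpa [Polynomial.coe_aeval_eq_eval] using this

lemma exists_diagBy_of_disc_ne_zero [IsAlgClosed K] [Nonempty ι] (A : Matrix ι ι K) (h : disc A ≠ 0) :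
    ∃ p l, DiagBy A p l ∧ Function.Injective l := by
  classical
  have hmul : ∀ μ : K, ∀ v : ι → K, A *ᵥ v = μ • v → ∀ q : Polynomial K,
      (Polynomial.aeval A q) *ᵥ v = q.eval μ • v := by
    intro μ v hv q
    induction q using Polynomial.induction_on' with
    | add p q hp hq => simp [add_mulVec, hp, hq, add_smul]
    | monomial n a =>
      have : ∀ n : ℕ, (A ^ n) *ᵥ v = μ ^ n • v := by
        intro n
        induction n with
        | zero => simp
        | succ n ih => rw [pow_succ, ← mulVec_mulVec, hv, mulVec_smul, ih, smul_smul, pow_succ']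
      rw [Polynomial.aeval_monomial, ← Algebra.smul_def, Polynomial.eval_monomial, smul_mulVec, this,
        smul_smul]
  have heig : ∀ μ ∈ A.charpoly.roots, ∃ v : ι → K, v ≠ 0 ∧ A *ᵥ v = μ • v := by
    intro μ hμ
    have h1 := (Polynomial.mem_roots'.1 hμ).2
    rw [Polynomial.IsRoot, Matrix.eval_charpoly] at h1
    obtain ⟨v, hv, hv'⟩ := Matrix.exists_mulVec_eq_zero_iff.2 h1
    refine ⟨v, hv, ?_⟩
    rw [sub_mulVec, sub_eq_zero] at hv'
    rw [← hv']
    simp [Matrix.scalar_apply]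
  have hder : ∀ μ ∈ A.charpoly.roots, (Polynomial.derivative A.charpoly).eval μ ≠ 0 := by
    intro μ hμ h0
    obtain ⟨v, hv, hv'⟩ := heig μ hμ
    apply h
    rw [disc]
    refine Matrix.exists_mulVec_eq_zero_iff.1 ⟨v, hv, ?_⟩
    rw [hmul μ v hv', h0, zero_smul]
  have hne : A.charpoly ≠ 0 := A.charpoly_monic.ne_zero
  have hnodup : A.charpoly.roots.Nodup := by
    rw [Multiset.nodup_iff_count_le_one]
    intro μ
    rw [Polynomial.count_roots]
    by_contra! hlt
    have hroot := (Polynomial.one_lt_rootMultiplicity_iff_isRoot hne).1 hlt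
    exact hder μ ((Polynomial.mem_roots hne).2 hroot.1) hroot.2
  have hcard : A.charpoly.roots.toFinset.card = Fintype.card ι := by
    rw [Multiset.toFinset_card_of_nodup hnodup,
      IsAlgClosed.card_roots_eq_natDegree, Matrix.charpoly_natDegree_eq_dim]
  have e : ι ≃ A.charpoly.roots.toFinset := Fintype.equivOfCardEq (by simp [hcard])
  set l : ι → K := fun i => (e i).1
  have hl : Function.Injective l := fun i j hij => e.injective (Subtype.ext hij)
  have hlr : ∀ i, l i ∈ A.charpoly.roots := fun i => Multiset.mem_toFinset.1 (e i).2
  choose v hv hv' using fun i => heig (l i) (hlr i)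
  have hli : LinearIndependent K v := by
    refine Module.End.eigenvectors_linearIndependent' (Matrix.toLin' A) l hl v fun i => ?_
    rw [Module.End.hasEigenvector_iff, Module.End.mem_eigenspace_iff]
    exact ⟨by rw [Matrix.toLin'_apply]; exact hv' i, hv i⟩
  -- normalise the determinant
  set P : Matrix ι ι K := (Matrix.of v)ᵀ
  have hP : P.det ≠ 0 := by
    rw [Matrix.det_transpose]
    exact (Matrix.isUnit_iff_isUnit_det _).1 (Matrix.linearIndependent_rows_iff_isUnit.1 hli) |>.ne_zero
  have hAP : A * P = P * diagonal l := by
    ext i j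
    rw [mul_diagonal]
    have := congrFun (hv' j) i
    simpa [P, Matrix.mul_apply, mulVec, dotProduct, mul_comm] using this
  obtain ⟨i₀⟩ := ‹Nonempty ι›
  set d : ι → K := fun i => if i = i₀ then P.det⁻¹ else 1
  have hdet : (P * diagonal d).det = 1 := by
    rw [det_mul, det_diagonal]
    simp [d, hP]
  refine ⟨⟨P * diagonal d, hdet⟩, l, ?_, hl⟩
  set p : SpecialLinearGroup ι K := ⟨P * diagonal d, hdet⟩
  have hp : mat p = P * diagonal d := rfl
  have : A * mat p = mat p * diagonal l := by
    rw [hp, ← Matrix.mul_assoc, hAP, Matrix.mul_assoc, Matrix.mul_assoc, diagonal_mul_diagonal,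
      diagonal_mul_diagonal]
    simp_rw [mul_comm]
  rw [DiagBy, ← this, Matrix.mul_assoc, mat_mul_mat_inv, Matrix.mul_one]

lemma exists_disc_ne_zero [IsAlgClosed K] [Nonempty ι] :
    ∃ g : SpecialLinearGroup ι K, disc (mat g) ≠ 0 := by
  have : Infinite K := IsAlgClosed.instInfinite
  have hinf : Infinite {x : K // x ≠ 0} :=
    Set.infinite_coe_iff.2 (Set.finite_singleton (0 : K)).infinite_compl
  let μ : ι ↪ {x : K // x ≠ 0} := (Fintype.equivFin ι).toEmbedding.trans
    (Fin.valEmbedding.trans (Infinite.natEmbedding _))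
  obtain ⟨z, hz⟩ := IsAlgClosed.exists_pow_nat_eq ((∏ i, (μ i : K))⁻¹) (Fintype.card_pos (α := ι))
  have hprod : ∏ i, (μ i : K) ≠ 0 := Finset.prod_ne_zero_iff.2 fun i _ => (μ i).2
  have hz0 : z ≠ 0 := by
    rintro rfl
    rw [zero_pow Fintype.card_ne_zero] at hz
    exact inv_ne_zero hprod hz.symm
  have hdet : (diagonal fun i => z * (μ i : K)).det = 1 := by
    rw [det_diagonal, Finset.prod_mul_distrib, Finset.prod_const, Finset.card_univ, hz,
      inv_mul_cancel₀ hprod]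
  refine ⟨⟨_, hdet⟩, ?_⟩
  refine disc_diagonal_ne_zero _ fun i j hij => ?_
  exact μ.injective (Subtype.ext (mul_left_cancel₀ hz0 hij))

end Regular

section Tools

variable {ι : Type} [Fintype ι] [DecidableEq ι]

/-- Extension of scalars for special linear groups. -/
def emb {F : Type} (K : Type) [Field F] [Field K] [Algebra F K] :
    SpecialLinearGroup ι F →* SpecialLinearGroup ι K :=
  SpecialLinearGroup.map (algebraMap F K)

section emb

variable {F K : Type} [Field F] [Field K] [Algebra F K]

lemma mat_emb (g : SpecialLinearGroup ι F) : mat (emb K g) = (mat g).map (algebraMap F K) := rfl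

lemma ext_eq {J : Type} (s : J → SpecialLinearGroup ι F) : ext K s = fun c => mat (emb K (s c)) := rfl

lemma emb_injective : Function.Injective (emb K : SpecialLinearGroup ι F →* SpecialLinearGroup ι K) := by
  intro a b h
  apply mat_injective
  have := congrArg mat h
  rw [mat_emb, mat_emb] at this
  exact Matrix.map_injective (algebraMap F K).injective this

end emb

lemma adjugate_mat {R : Type} [CommRing R] (g : SpecialLinearGroup ι R) :
    (mat g).adjugate = mat g⁻¹ := rfl

/-- The unipotent element `1 + u vᵀ`. -/
def unip {R : Type} [CommRing R] (u v : ι → R) (h : v ⬝ᵥ u = 0) : SpecialLinearGroup ι R :=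
  ⟨1 + vecMulVec u v, by
    rw [vecMulVec_eq Unit, det_one_add_replicateCol_mul_replicateRow, h, add_zero]⟩

lemma mat_unip {R : Type} [CommRing R] (u v : ι → R) (h : v ⬝ᵥ u = 0) :
    mat (unip u v h) = 1 + vecMulVec u v := rfl

lemma mat_unip_inv {R : Type} [CommRing R] (u v : ι → R) (h : v ⬝ᵥ u = 0) :
    mat (unip u v h)⁻¹ = 1 - vecMulVec u v := by
  have h1 : mat (unip u v h) * (1 - vecMulVec u v) = 1 := by
    rw [mat_unip, Matrix.add_mul, Matrix.one_mul, Matrix.mul_sub, Matrix.mul_one,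
      vecMulVec_mul_vecMulVec, h, zero_smul, vecMulVec_zero]
    simp
  calc mat (unip u v h)⁻¹ = mat (unip u v h)⁻¹ * (mat (unip u v h) * (1 - vecMulVec u v)) := by
        rw [h1, Matrix.mul_one]
    _ = _ := by rw [← Matrix.mul_assoc, mat_inv_mul_mat, Matrix.one_mul]

section Dual

open DualNumber

variable {K : Type} [Field K]

/-- The value part of a matrix of dual numbers. -/
def fs (M : Matrix ι ι (DualNumber K)) : Matrix ι ι K := M.map TrivSqZeroExt.fst

/-- The derivative part of a matrix of dual numbers. -/
def sn (M : Matrix ι ι (DualNumber K)) : Matrix ι ι K := M.map TrivSqZeroExt.snd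

/-- Constant matrices of dual numbers. -/
def lift (M : Matrix ι ι K) : Matrix ι ι (DualNumber K) := M.map (algebraMap K (DualNumber K))

lemma fs_mul (M N : Matrix ι ι (DualNumber K)) : fs (M * N) = fs M * fs N := by
  ext i j
  simp [fs, Matrix.mul_apply, TrivSqZeroExt.fst_sum]

lemma sn_mul (M N : Matrix ι ι (DualNumber K)) : sn (M * N) = fs M * sn N + sn M * fs N := by
  ext i j
  simp [fs, sn, Matrix.mul_apply, TrivSqZeroExt.snd_sum, Finset.sum_add_distrib, mul_comm]

lemma fs_lift (M : Matrix ι ι K) : fs (lift M) = M := by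
  ext i j; simp [fs, lift, TrivSqZeroExt.algebraMap_eq_inl]

lemma sn_lift (M : Matrix ι ι K) : sn (lift M) = 0 := by
  ext i j; simp [sn, lift, TrivSqZeroExt.algebraMap_eq_inl]

lemma fs_sub (M N : Matrix ι ι (DualNumber K)) : fs (M - N) = fs M - fs N := by
  ext i j; simp [fs]

lemma sn_sub (M N : Matrix ι ι (DualNumber K)) : sn (M - N) = sn M - sn N := by
  ext i j; simp [sn]

/-- First order expansion of the determinant at a singular diagonal matrix. -/
lemma sn_apply_eq_zero_of_det (M : Matrix ι ι (DualNumber K)) (d : ι → K) (j : ι)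
    (hM : fs M = diagonal d) (hj : d j = 0) (hd : ∀ i, i ≠ j → d i ≠ 0) (hdet : M.det = 0) :
    sn M j j = 0 := by
  have hrow : M = M.updateRow j ((ε : DualNumber K) • fun k => algebraMap K (DualNumber K) (sn M j k)) := by
    refine Matrix.ext fun i k => ?_
    by_cases hi : i = j
    · subst hi
      rw [updateRow_self]
      have h1 : (M i k).fst = 0 := by
        have := congrFun (congrFun hM i) k
        simp only [fs, Matrix.map_apply] at this
        rw [this, diagonal_apply]
        split_ifs <;> simp [hj]
      refine TrivSqZeroExt.ext ?_ ?_
      · rw [h1]; simp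
      · simp [sn, TrivSqZeroExt.algebraMap_eq_inl]
    · rw [updateRow_ne hi]
  rw [hrow, det_updateRow_smul] at hdet
  have h2 := congrArg TrivSqZeroExt.snd hdet
  set N := M.updateRow j fun k => algebraMap K (DualNumber K) (sn M j k) with hN
  have h3 : (N.det).fst = 0 := by
    simpa using h2
  have h4 : (N.det).fst = ((diagonal d).updateRow j (sn M j)).det := by
    rw [← hM]
    have := RingHom.map_det (TrivSqZeroExt.fstHom K K K : DualNumber K →+* K) N
    refine this.trans ?_
    congr 1
    ext i k
    by_cases hi : i = j
    · subst hi
      simp [hN, TrivSqZeroExt.algebraMap_eq_inl]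
    · simp [hN, updateRow_ne hi, fs]
  rw [h4, ← cramer_transpose_apply, cramer_eq_adjugate_mulVec, diagonal_transpose,
    adjugate_diagonal, mulVec_diagonal] at h3
  refine (mul_eq_zero.1 h3).resolve_left (Finset.prod_ne_zero_iff.2 fun i hi => ?_)
  exact hd i (Finset.ne_of_mem_erase hi)

end Dual

end Tools

section RegularClass

variable {ι : Type} [Fintype ι] [DecidableEq ι]

/-- The `c`-th matrix of a tuple given by coordinates. -/
def slice {R J : Type} (w : J × ι × ι → R) (c : J) : Matrix ι ι R := of fun i j => w (c, i, j)

lemma slice_map {R S J : Type} [CommRing R] [CommRing S] (f : R →+* S) (w : J × ι × ι → R) (c : J) :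
    slice (f ∘ w) c = f.mapMatrix (slice w c) := rfl

lemma slice_coords {R J : Type} (b : J → Matrix ι ι R) (c : J) : slice (coords b) c = b c := rfl

/-- The copy used by a given matrix position. -/
def cp (x : ι × ι) : Option ι := if x.1 = x.2 then none else some x.1

variable (ι) in
/-- The determinant of the conjugated projectors. -/
def projDet : NatFun ((Option ι × ι) × ι × ι) (Option ι × ι × ι) where
  toFun R _ w b := (of fun x y : ι × ι => (slice b (cp x) * slice w (cp x, x.2) *
    (slice b (cp x)).adjugate) y.1 y.2).det
  map_toFun R S _ _ f w b := by
    rw [RingHom.map_det]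
    congr 1
    refine Matrix.ext fun x y => ?_
    simp only [slice_map, ← RingHom.map_adjugate, ← map_mul]
    rfl

/-- The rank one projector onto the `j`-th column of `p`. -/
def prj {R : Type} [CommRing R] (p : SpecialLinearGroup ι R) (j : ι) : Matrix ι ι R :=
  mat p * Matrix.single j j 1 * mat p⁻¹

lemma conj_prj {R : Type} [CommRing R] (b p : SpecialLinearGroup ι R) (j : ι) :
    mat b * prj p j * mat b⁻¹ = prj (b * p) j := by
  simp only [prj, mat_mul, _root_.mul_inv_rev, Matrix.mul_assoc]

lemma trace_prj_mul {R : Type} [CommRing R] (p : SpecialLinearGroup ι R) (j : ι) (W : Matrix ι ι R) :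
    (prj p j * W).trace = (mat p⁻¹ * W * mat p) j j := by
  rw [prj, Matrix.mul_assoc, Matrix.mul_assoc, Matrix.trace_mul_comm, Matrix.mul_assoc,
    Matrix.trace_single_mul]
  simp

variable {K : Type} [Field K]

lemma projDet_apply (p b : Option ι → SpecialLinearGroup ι K) :
    (projDet ι).toFun K (coords fun c => prj (p c.1) c.2) (coords fun c => mat (b c)) =
      (of fun x y : ι × ι => prj (b (cp x) * p (cp x)) x.2 y.1 y.2).det := by
  simp only [projDet, slice_coords, adjugate_mat, conj_prj]

lemma eq_zero_of_trace_prj (r : Option ι → SpecialLinearGroup ι K)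
    (h : (of fun x y : ι × ι => prj (r (cp x)) x.2 y.1 y.2).det ≠ 0) (W : Matrix ι ι K)
    (hW : ∀ x : ι × ι, (mat (r (cp x))⁻¹ * W * mat (r (cp x))) x.2 x.2 = 0) : W = 0 := by
  by_contra hne
  refine h (Matrix.exists_mulVec_eq_zero_iff.1 ⟨fun y => W y.2 y.1, ?_, ?_⟩)
  · intro h0
    refine hne (Matrix.ext fun i j => congrFun h0 (j, i))
  · funext x
    have := hW x
    rw [← trace_prj_mul, Matrix.trace] at this
    simp only [Matrix.diag_apply, Matrix.mul_apply] at this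
    simp only [mulVec, dotProduct, of_apply, Pi.zero_apply, Fintype.sum_prod_type]
    exact this

/-- The row vector with entry `0` at `i` and `1` elsewhere. -/
def offRow (K : Type) [Field K] (i : ι) : ι → K := fun j => if j = i then 0 else 1

lemma offRow_dot (i : ι) : offRow K i ⬝ᵥ Pi.single i 1 = 0 := by
  simp [offRow]

/-- The element `1 + ∑_{j ≠ i} E_ij`. -/
def offUnip (K : Type) [Field K] (i : ι) : SpecialLinearGroup ι K :=
  unip (Pi.single i 1) (offRow K i) (offRow_dot i)

lemma prj_unip (u v : ι → K) (h : v ⬝ᵥ u = 0) (j : ι) : prj (unip u v h) j =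
    vecMulVec (Pi.single j 1 + v j • u) (Pi.single j 1 - u j • v) := by
  have h1 : Matrix.single j j (1 : K) = vecMulVec (Pi.single j 1) (Pi.single j 1) := by
    rw [← single_eq_single_vecMulVec_single]
  rw [prj, mat_unip, mat_unip_inv, h1, mul_vecMulVec, vecMulVec_mul]
  congr 1
  · ext k; simp [Matrix.one_apply, vecMulVec_apply, Pi.single_apply, mul_comm]
  · ext k; simp [vecMul_sub, vecMul_vecMulVec]

lemma prj_offUnip_of_ne {i j : ι} (hij : j ≠ i) : prj (offUnip K i) j =
    Matrix.single j j 1 + Matrix.single i j 1 := by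
  rw [offUnip, prj_unip]
  simp [offRow, hij, add_vecMulVec, single_eq_single_vecMulVec_single]

lemma prj_one (j : ι) : prj (1 : SpecialLinearGroup ι K) j = Matrix.single j j 1 := by
  simp [prj, mat_one]

/-- The base tuple at which the conjugated projectors are independent. -/
def baseTuple (K : Type) [Field K] : Option ι → SpecialLinearGroup ι K
  | none => 1
  | some i => offUnip K i

lemma projDet_baseTuple :
    (of fun x y : ι × ι => prj (baseTuple K (cp x)) x.2 y.1 y.2).det ≠ 0 := by
  intro h0
  obtain ⟨c, hc, hc0⟩ := Matrix.exists_vecMul_eq_zero_iff.2 h0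
  have hval : ∀ x : ι × ι, prj (baseTuple K (cp x)) x.2 = Matrix.single x.2 x.2 1 +
      if x.1 = x.2 then 0 else Matrix.single x.1 x.2 1 := by
    rintro ⟨i, j⟩
    by_cases h : i = j
    · simp [cp, h, baseTuple, prj_one]
    · simp only [cp, h, if_false, baseTuple]
      exact prj_offUnip_of_ne (Ne.symm h)
  have hent : ∀ k l, ∑ i, ∑ j, c (i, j) * ((if j = k ∧ j = l then 1 else 0) +
      if i = j then 0 else if i = k ∧ j = l then 1 else 0) = 0 := by
    intro k l
    have := congrFun hc0 (k, l)
    simp only [vecMul, dotProduct, of_apply, hval, Fintype.sum_prod_type, Pi.zero_apply] at this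
    refine Eq.trans ?_ this
    refine Finset.sum_congr rfl fun i _ => Finset.sum_congr rfl fun j _ => ?_
    by_cases hij : i = j <;> simp [hij, Matrix.single_apply]
  have hoff : ∀ k l, k ≠ l → c (k, l) = 0 := by
    intro k l hkl
    have := hent k l
    rw [Finset.sum_eq_single k, Finset.sum_eq_single l] at this
    · simpa [hkl, Ne.symm hkl] using this
    · intro j _ hj
      simp [hj]
    · simp
    · intro i _ hi
      refine Finset.sum_eq_zero fun j _ => ?_
      have : ¬ (j = k ∧ j = l) := fun h => hkl (h.1.symm.trans h.2)
      simp [hi, this]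
    · simp
  refine hc (funext fun ⟨k, l⟩ => ?_)
  by_cases hkl : k = l
  · subst hkl
    have := hent k k
    rw [Finset.sum_eq_single k, Finset.sum_eq_single k] at this
    · simpa using this
    · intro j _ hj
      rw [hoff k j hj.symm, zero_mul]
    · simp
    · intro i _ hi
      refine Finset.sum_eq_zero fun j _ => ?_
      by_cases hij : i = j
      · subst hij; simp [hi]
      · rw [hoff i j hij, zero_mul]
    · simp
  · exact hoff k l hkl

lemma exists_projDet_ne_zero (p : Option ι → SpecialLinearGroup ι K) :
    ∃ b : Option ι → SpecialLinearGroup ι K,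
      (projDet ι).toFun K (coords fun c => prj (p c.1) c.2) (coords fun c => mat (b c)) ≠ 0 := by
  refine ⟨fun c => baseTuple K c * (p c)⁻¹, ?_⟩
  rw [projDet_apply]
  simp only [inv_mul_cancel_right]
  exact projDet_baseTuple

variable (ι) in
/-- The equations saying that the matrices `A_c Y` have the eigenvalues `l j`. -/
def eigEq (x : ι × ι) : NatFun ((Option ι × ι × ι) ⊕ ι) (Unit × ι × ι) where
  toFun R _ w b := (slice (w ∘ Sum.inl) (cp x) * slice b () -
    Matrix.scalar ι (w (Sum.inr x.2))).det
  map_toFun R S _ _ f w b := by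
    rw [RingHom.map_det]
    congr 1
    rw [map_sub, map_mul]
    congr 1
    ext i j
    simp [Matrix.scalar_apply, diagonal_apply, apply_ite f]

open DualNumber in
lemma eq_zero_of_eigEq (A : Option ι → Matrix ι ι K) (Y : SpecialLinearGroup ι K) (l : ι → K)
    (hl : Function.Injective l) (r : Option ι → SpecialLinearGroup ι K)
    (hA : ∀ c, DiagBy (A c * mat Y) (r c) l) (hl0 : ∀ i, l i ≠ 0)
    (h : (of fun x y : ι × ι => prj (r (cp x)) x.2 y.1 y.2).det ≠ 0) (v : Unit × ι × ι → K)
    (hv : ∀ x : ι × ι, (eigEq ι x).toFun (DualNumber K)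
      (algebraMap K (DualNumber K) ∘ Sum.elim (coords A) l)
      (fun j => algebraMap K (DualNumber K) (coords (fun _ => mat Y) j) + v j • ε) = 0) : v = 0 := by
  set V : Matrix ι ι K := slice v () with hV
  set Z : Matrix ι ι (DualNumber K) :=
    slice (fun j => algebraMap K (DualNumber K) (coords (fun _ => mat Y) j) + v j • ε) () with hZ
  have hZf : fs Z = mat Y := by
    ext i j
    simp [fs, hZ, slice, coords, TrivSqZeroExt.algebraMap_eq_inl]
  have hZs : sn Z = V := by
    ext i j
    simp [sn, hZ, hV, slice, TrivSqZeroExt.algebraMap_eq_inl]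
  have key : mat Y⁻¹ * V = 0 := by
    refine eq_zero_of_trace_prj r h _ fun x => ?_
    set c := cp x
    set M := lift (mat (r c)⁻¹) * (lift (A c) * Z - lift (Matrix.scalar ι (l x.2))) *
      lift (mat (r c)) with hM
    have hAY := hA c
    rw [DiagBy] at hAY
    have hdet : M.det = 0 := by
      have h1 := hv x
      have h2 : (lift (A c) * Z - lift (Matrix.scalar ι (l x.2))).det = 0 := by
        rw [← h1]
        simp only [eigEq]
        congr 2
        refine Matrix.ext fun i j => ?_
        simp [lift, Matrix.scalar_apply, diagonal_apply, apply_ite (algebraMap K (DualNumber K))]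
      rw [hM, det_mul, det_mul, h2]
      simp
    have hfs : fs M = diagonal fun i => l i - l x.2 := by
      rw [hM]
      simp only [fs_mul, fs_sub, fs_lift, hZf]
      rw [hAY, Matrix.mul_sub, Matrix.sub_mul, Matrix.mul_assoc (mat (r c)⁻¹) _ (mat (r c)),
        Matrix.mul_assoc _ (mat (r c)⁻¹) (mat (r c)), mat_inv_mul_mat, Matrix.mul_one,
        ← Matrix.mul_assoc, mat_inv_mul_mat, Matrix.one_mul, ← Matrix.scalar_comm,
        Matrix.mul_assoc, mat_inv_mul_mat, Matrix.mul_one]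
      · ext i j
        simp [Matrix.scalar_apply, diagonal_apply]
        split_ifs <;> simp
      · intro; exact mul_comm _ _
    have hsn : sn M = diagonal l * (mat (r c)⁻¹ * (mat Y⁻¹ * V) * mat (r c)) := by
      rw [hM]
      simp only [sn_mul, fs_mul, fs_sub, sn_sub, fs_lift, sn_lift, hZf, hZs]
      have h3 : A c = mat (r c) * diagonal l * mat (r c)⁻¹ * mat Y⁻¹ := by
        rw [← hAY, Matrix.mul_assoc, mat_mul_mat_inv, Matrix.mul_one]
      simp only [Matrix.mul_zero, Matrix.zero_mul, add_zero, zero_add, sub_zero]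
      rw [h3]
      simp only [Matrix.mul_assoc]
      rw [← Matrix.mul_assoc (mat (r c)⁻¹) (mat (r c)), mat_inv_mul_mat, Matrix.one_mul]
    have h4 := sn_apply_eq_zero_of_det M _ x.2 hfs (by simp)
      (fun i hi => sub_ne_zero.2 (hl.ne hi)) hdet
    rw [hsn, diagonal_mul] at h4
    exact (mul_eq_zero.1 h4).resolve_left (hl0 _)
  have hV0 : V = 0 := by
    rw [← Matrix.one_mul V, ← mat_mul_mat_inv Y, Matrix.mul_assoc, key, Matrix.mul_zero]
  funext ⟨u, i, j⟩
  exact congrFun (congrFun hV0 i) j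

end RegularClass

section ClassBound

variable {ι : Type} [Fintype ι] [DecidableEq ι] {K : Type} [Field K]

lemma DiagBy.conj {A p : SpecialLinearGroup ι K} {l : ι → K} (h : DiagBy (mat A) p l)
    (s : SpecialLinearGroup ι K) : DiagBy (mat (s * A * s⁻¹)) (s * p) l := by
  rw [DiagBy] at *
  simp only [mat_mul, _root_.mul_inv_rev, h, Matrix.mul_assoc]

lemma DiagBy.ne_zero {A p : SpecialLinearGroup ι K} {l : ι → K} (h : DiagBy (mat A) p l) (i : ι) :
    l i ≠ 0 := by
  have h1 := congrArg Matrix.det h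
  rw [det_mul, det_mul, det_mat, det_mat, det_mat, det_diagonal, one_mul, mul_one] at h1
  exact fun h0 => one_ne_zero (h1.trans (Finset.prod_eq_zero (Finset.mem_univ i) h0))

lemma DiagBy.det_sub {A : Matrix ι ι K} {p : SpecialLinearGroup ι K} {l : ι → K} (h : DiagBy A p l)
    (j : ι) : (A - Matrix.scalar ι (l j)).det = 0 := by
  refine Matrix.exists_mulVec_eq_zero_iff.1 ⟨mat p *ᵥ Pi.single j 1, ?_, ?_⟩
  · intro h0
    have := congrArg (mat p⁻¹ *ᵥ ·) h0
    simp only [mulVec_mulVec, mat_inv_mul_mat, one_mulVec, mulVec_zero] at this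
    simpa using congrFun this j
  · have h' : A = mat p * diagonal l * mat p⁻¹ := h
    rw [sub_mulVec, h', mulVec_mulVec, Matrix.mul_assoc, mat_inv_mul_mat,
      Matrix.mul_one, ← mulVec_mulVec, diagonal_mulVec_single]
    simp [Matrix.scalar_apply]

lemma inv_mem_pow {G : Type} [Group G] {H : Set G} (hs : H⁻¹ = H) {k : ℕ} {x : G} (hx : x ∈ H ^ k) :
    x⁻¹ ∈ H ^ k := by
  have : (H ^ k)⁻¹ = H ^ k := by rw [← inv_pow, hs]
  rw [← this]; simpa using hx

lemma mul_mem_pow {G : Type} [Group G] {H : Set G} {k l : ℕ} {x y : G} (hx : x ∈ H ^ k)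
    (hy : y ∈ H ^ l) : x * y ∈ H ^ (k + l) := by
  rw [pow_add]; exact Set.mul_mem_mul hx hy

variable (ι) in
/-- Elements of a growing set with prescribed distinct eigenvalues satisfy a dimension bound. -/
theorem exists_class_bound [Nontrivial ι] (j : ℕ) : ∃ k C Q : ℕ, ∀ (F K : Type) [Field F] [Fintype F]
    [Field K] [Algebra F K], Q < Fintype.card F → ∀ H : Set (SpecialLinearGroup ι F),
    (1 : _) ∈ H → H⁻¹ = H → Subgroup.closure H = ⊤ → ∀ l : ι → K, Function.Injective l →
    ∀ X : Finset (SpecialLinearGroup ι F), (∀ x ∈ X, x ∈ H ^ j) →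
    (∀ x ∈ X, ∃ p, DiagBy (mat (emb K x)) p l) →
    X.card ^ (Fintype.card ι + 1) ≤ C * (H ^ k).ncard ^ Fintype.card ι := by
  classical
  obtain ⟨k, N, Q, hesc⟩ := natural_escape ι (Option ι) (projDet ι)
  obtain ⟨M, hM⟩ := natural_bezout (eigEq ι)
  refine ⟨(k + j + k) + (k + j + k), M * N, Q, ?_⟩
  intro F K _ _ _ _ hQ H h1 hs hcl l hl X hXj hX
  obtain ⟨S, hSN, hSk, hS⟩ := hesc F K hQ H h1 hcl
  choose! p hp using hX
  have hch : ∀ x : Option ι → SpecialLinearGroup ι F, ∃ s ∈ S, (of fun a b : ι × ι =>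
      prj (emb K (s (cp a)) * p (x (cp a))) a.2 b.1 b.2).det ≠ 0 := by
    intro x
    obtain ⟨s, hs, hs'⟩ := hS (coords fun c => prj (p (x c.1)) c.2)
      (exists_projDet_ne_zero fun c => p (x c))
    refine ⟨s, hs, ?_⟩
    have := projDet_apply (fun c => p (x c)) (fun c => emb K (s c))
    rw [← this]
    exact hs'
  choose s hsS hsdet using hch
  set z : (Option ι → SpecialLinearGroup ι F) → Option ι → SpecialLinearGroup ι F :=
    fun x c => s x c * x c * (s x c)⁻¹ with hz
  set E := Fintype.piFinset fun _ : Option ι => X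
  set Hk := (H ^ ((k + j + k) + (k + j + k))).toFinite.toFinset
  set T := S ×ˢ Fintype.piFinset fun _ : ι => Hk
  have hEcard : E.card = X.card ^ (Fintype.card ι + 1) := by
    simp [E, Fintype.card_option]
  have hTcard : T.card ≤ N * (H ^ ((k + j + k) + (k + j + k))).ncard ^ Fintype.card ι := by
    rw [Finset.card_product, Fintype.card_piFinset, Finset.prod_const, Finset.card_univ,
      Set.ncard_eq_toFinset_card _]
    exact Nat.mul_le_mul_right _ hSN
  have hmem : ∀ x ∈ E, ∀ c, x c ∈ X := fun x hx c => Fintype.mem_piFinset.1 hx c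
  rw [← hEcard]
  refine (Finset.card_le_mul_card_image_of_maps_to (t := T)
    (f := fun x => (s x, fun i => z x (some i) * (z x none)⁻¹)) ?_ M ?_).trans ?_
  · intro x hx
    have hzm : ∀ c, z x c ∈ H ^ (k + j + k) := fun c =>
      mul_mem_pow (mul_mem_pow (hSk _ (hsS x) c) (hXj _ (hmem x hx c)))
        (inv_mem_pow hs (hSk _ (hsS x) c))
    refine Finset.mem_product.2 ⟨hsS x, Fintype.mem_piFinset.2 fun i => ?_⟩
    exact (Set.Finite.mem_toFinset _).2 (mul_mem_pow (hzm _) (inv_mem_pow hs (hzm _)))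
  · rintro ⟨s₀, y⟩ -
    set y' : Option ι → SpecialLinearGroup ι F := fun c => c.elim 1 y
    have hfib : ∀ x, x ∈ E.filter (fun x => (s x, fun i => z x (some i) * (z x none)⁻¹) = (s₀, y)) →
        x ∈ E ∧ s x = s₀ ∧ ∀ c, y' c * z x none = z x c := by
      intro x hx
      obtain ⟨hxE, hx⟩ := Finset.mem_filter.1 hx
      obtain ⟨h2, h3⟩ := Prod.mk.inj hx
      refine ⟨hxE, h2, fun c => ?_⟩
      cases c with
      | none => simp [y']
      | some i => simp [y', ← h3]
    have hd : ∀ x ∈ E, ∀ c, DiagBy (mat (emb K (z x c))) (emb K (s x c) * p (x c)) l := by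
      intro x hx c
      have := (hp _ (hmem x hx c)).conj (emb K (s x c))
      rwa [← map_inv, ← map_mul, ← map_mul] at this
    rw [← Finset.card_image_of_injOn (f := fun x => coords fun _ : Unit => mat (emb K (z x none)))]
    · refine hM K (Sum.elim (coords fun c => mat (emb K (y' c))) l) _ ?_ ?_
      · intro w hw i
        obtain ⟨x, hx, rfl⟩ := Finset.mem_image.1 hw
        obtain ⟨hxE, hxs, hxy⟩ := hfib x hx
        have := (hd x hxE (cp i)).det_sub i.2
        rw [← hxy, map_mul, mat_mul] at this
        exact this
      · intro w hw v hv
        obtain ⟨x, hx, rfl⟩ := Finset.mem_image.1 hw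
        obtain ⟨hxE, hxs, hxy⟩ := hfib x hx
        refine eq_zero_of_eigEq (fun c => mat (emb K (y' c))) (emb K (z x none)) l hl
          (fun c => emb K (s x c) * p (x c)) ?_ (hd x hxE none).ne_zero (hsdet x) v hv
        intro c
        rw [← mat_mul, ← map_mul, hxy]
        exact hd x hxE c
    · intro x hx x' hx' hxx
      obtain ⟨hxE, hxs, hxy⟩ := hfib x hx
      obtain ⟨hxE', hxs', hxy'⟩ := hfib x' hx'
      have h2 : z x none = z x' none := by
        refine emb_injective (K := K) (mat_injective (Matrix.ext fun a b => ?_))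
        exact congrFun hxx ((), a, b)
      funext c
      have h3 : z x c = z x' c := by rw [← hxy, ← hxy', h2]
      simp only [hz, hxs, hxs'] at h3
      exact mul_left_cancel (mul_right_cancel h3)
  · rw [Nat.mul_assoc]
    exact Nat.mul_le_mul_left _ hTcard

end ClassBound

section Prod

lemma map_partialProd {M N : Type} [Monoid M] [Monoid N] (f : M →* N) {m : ℕ} (g : Fin m → M)
    (i : Fin (m + 1)) : f (Fin.partialProd g i) = Fin.partialProd (fun c => f (g c)) i := by
  induction i using Fin.induction with
  | zero => simp
  | succ i ih => rw [Fin.partialProd_succ, Fin.partialProd_succ, map_mul, ih]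

lemma partialSum_last {M : Type} [AddCommMonoid M] {m : ℕ} (g : Fin m → M) :
    Fin.partialSum g (Fin.last m) = ∑ c, g c := by
  simp [Fin.partialSum, List.take_of_length_le, List.sum_ofFn]

lemma exists_partialProd_mul_eq {G : Type} [Group G] {m : ℕ} (t u : Fin (m + 1) → G) :
    ∃ b : Fin (m + 1) → G, ∀ c, Fin.partialProd (fun c => b c * t c) c.castSucc * b c = u c := by
  refine ⟨Fin.cases (u 0) fun i => (u i.castSucc * t i.castSucc)⁻¹ * u i.succ, fun c => ?_⟩
  induction c using Fin.induction with
  | zero => simp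
  | succ i ih =>
    rw [← Fin.succ_castSucc, Fin.partialProd_succ, ← mul_assoc, ih]
    simp [mul_assoc]

lemma mul_partialProd_mem {G : Type} [Group G] {H : Set G} {m k j : ℕ} (b t : Fin m → G)
    (hb : ∀ c, b c ∈ H ^ k) (ht : ∀ c, t c ∈ H ^ j) (i : Fin (m + 1)) :
    Fin.partialProd (fun c => b c * t c) i ∈ H ^ (i.val * (k + j)) := by
  induction i using Fin.induction with
  | zero => simp
  | succ i ih =>
    rw [Fin.partialProd_succ, Fin.val_succ, Nat.add_mul, one_mul]
    exact mul_mem_pow ih (mul_mem_pow (hb _) (ht _))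

end Prod

section Torus

variable {ι : Type} [Fintype ι] [DecidableEq ι] {K : Type} [Field K] (a b : ι)

/-- The indices different from `a` and `b`. -/
abbrev Rest := {j : ι // j ≠ a ∧ j ≠ b}

/-- The element `1 - (∑_{j ≠ a, b} e_j) e_aᵀ`. -/
def extraUnip (K : Type) [Field K] : SpecialLinearGroup ι K :=
  unip (fun j => if j = a ∨ j = b then 0 else -1) (Pi.single a 1) (by simp)

/-- The tuple at which the conjugated projectors are independent. -/
def torTuple (K : Type) [Field K] : Option (Option ι) → SpecialLinearGroup ι K
  | none => extraUnip a b K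
  | some c => baseTuple K c

lemma prj_extraUnip {j : ι} (hj : j ≠ a ∧ j ≠ b) (k l : ι) : prj (extraUnip a b K) j k l =
    if k = j then (if l = j then 1 else 0) + (if l = a then 1 else 0) else 0 := by
  rw [extraUnip, prj_unip, vecMulVec_apply]
  simp only [hj.1, hj.2, ne_eq, not_false_eq_true, Pi.single_eq_of_ne, zero_smul, add_zero, or_self,
    if_false, Pi.single_apply, Pi.sub_apply, Pi.smul_apply, smul_eq_mul]
  split_ifs <;> simp

lemma prj_offUnip (i j k l : ι) : prj (offUnip K i) j k l =
    ((if k = j then 1 else 0) + if j ≠ i ∧ k = i then 1 else 0) *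
      ((if l = j then 1 else 0) - if j = i ∧ l ≠ i then 1 else 0) := by
  rw [offUnip, prj_unip, vecMulVec_apply]
  simp only [Pi.add_apply, Pi.sub_apply, Pi.smul_apply, smul_eq_mul, Pi.single_apply, offRow]
  congr 2
  · split_ifs <;> simp_all
  · split_ifs <;> simp_all

lemma torTuple_independent (hab : a ≠ b) (x0 : K) (x : Option (Option ι) → Rest a b → K)
    (h : x0 • (1 : Matrix ι ι K) + ∑ c, ∑ j, x c j • prj (torTuple a b K c) j.1 = 0) :
    x0 = 0 ∧ ∀ c j, x c j = 0 := by
  have hent : ∀ k l, x0 * (if k = l then 1 else 0) +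
      ((∑ j : Rest a b, x none j * prj (extraUnip a b K) j.1 k l) +
      ((∑ j : Rest a b, x (some none) j * (if k = j.1 ∧ l = j.1 then 1 else 0)) +
        ∑ i, ∑ j : Rest a b, x (some (some i)) j * prj (offUnip K i) j.1 k l)) = 0 := by
    intro k l
    have := congrFun (congrFun h k) l
    simp only [Fintype.sum_option, torTuple, baseTuple, Matrix.add_apply, Matrix.smul_apply,
      Matrix.sum_apply, smul_eq_mul, Matrix.one_apply, Matrix.zero_apply, prj_one,
      Matrix.single_apply] at this
    refine Eq.trans ?_ this
    congr 3
    refine Finset.sum_congr rfl fun j _ => ?_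
    simp only [eq_comm]
  have hRa : ∀ j : Rest a b, a ≠ j.1 := fun j => j.2.1.symm
  have hRb : ∀ j : Rest a b, b ≠ j.1 := fun j => j.2.2.symm
  have hex := fun j : Rest a b => prj_extraUnip (K := K) a b j.2
  have hdiff : ∀ k, x0 * (if k = a then 1 else 0) - x0 * (if k = b then 1 else 0) +
      ∑ j : Rest a b, x none j * (if k = j.1 then 1 else 0) = 0 := by
    intro k
    have h1 := hent k a
    have h2 := hent k b
    simp only [hex, prj_offUnip, hRa, hRb, hab.symm, and_false, if_false,
      mul_zero, Finset.sum_const_zero, zero_add, if_true] at h1 h2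
    have h3 : ∀ i, ∀ j : Rest a b, (if j.1 = i ∧ a ≠ i then (1 : K) else 0) =
        (if j.1 = i ∧ b ≠ i then (1 : K) else 0) := by
      intro i j
      by_cases hji : j.1 = i
      · subst hji; simp [hRa, hRb]
      · simp [hji]
    simp only [h3] at h1
    simp only [ite_self, mul_zero, Finset.sum_const_zero, zero_add] at h1 h2
    linear_combination h1 - h2
  have hx0 : x0 = 0 := by
    simpa [hab, hRa] using hdiff a
  subst hx0
  have hxn : ∀ j, x none j = 0 := by
    intro j
    have := hdiff j.1
    simp only [zero_mul, sub_self, zero_add] at this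
    rw [Finset.sum_eq_single j] at this
    · simpa using this
    · intro j' _ hj'
      have : j.1 ≠ j'.1 := fun h => hj' (Subtype.ext h.symm)
      simp [this]
    · simp
  simp only [hxn, zero_mul, Finset.sum_const_zero, zero_add] at hent
  have hdiag : ∀ j : Rest a b, x (some (some j.1)) j = 0 := by
    intro j
    have h1 := hent j.1 a
    simp only [prj_offUnip, hRa, and_false, if_false, mul_zero, Finset.sum_const_zero, zero_add] at h1
    rw [Finset.sum_eq_single j.1, Finset.sum_eq_single j] at h1
    · simpa [hRa] using h1
    · intro j' _ hj'
      have : j'.1 ≠ j.1 := fun h => hj' (Subtype.ext h)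
      simp [this]
    · simp
    · intro i _ hi
      refine Finset.sum_eq_zero fun j' _ => ?_
      by_cases hj' : j'.1 = i
      · simp [hj', hi.symm]
      · simp [hj']
    · simp
  have hoff : ∀ k, ∀ l : Rest a b, k ≠ l.1 → x (some (some k)) l = 0 := by
    intro k l hkl
    have h1 := hent k l.1
    have h2 : ∀ j : Rest a b, ¬ (k = j.1 ∧ l.1 = j.1) := fun j hj => hkl (hj.1.trans hj.2.symm)
    simp only [h2, if_false, mul_zero, Finset.sum_const_zero, zero_add] at h1
    rw [Finset.sum_eq_single k, Finset.sum_eq_single l] at h1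
    · simpa [prj_offUnip, hkl, Ne.symm hkl] using h1
    · intro j _ hj
      have hlj : l.1 ≠ j.1 := fun h => hj (Subtype.ext h.symm)
      by_cases hjk : j.1 = k
      · subst hjk
        rw [hdiag j, zero_mul]
      · simp [prj_offUnip, hlj, hjk]
    · simp
    · intro i _ hi
      refine Finset.sum_eq_zero fun j _ => ?_
      by_cases hji : j.1 = i
      · subst hji; rw [hdiag j, zero_mul]
      · by_cases hlj : l.1 = j.1
        · have : k ≠ j.1 := fun h => hkl (h.trans hlj.symm)
          simp [prj_offUnip, this, hi.symm]
        · simp [prj_offUnip, hlj, hji]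
    · simp
  have hall : ∀ i j, x (some (some i)) j = 0 := by
    intro i j
    by_cases hij : i = j.1
    · subst hij; exact hdiag j
    · exact hoff i j hij
  simp only [hall, zero_mul, Finset.sum_const_zero, add_zero] at hent
  refine ⟨rfl, fun c j => ?_⟩
  match c with
  | none => exact hxn j
  | some (some i) => exact hall i j
  | some none =>
    have h1 := hent j.1 j.1
    rw [Finset.sum_eq_single j] at h1
    · simpa using h1
    · intro j' _ hj'
      have : j.1 ≠ j'.1 := fun h => hj' (Subtype.ext h.symm)
      simp [this]
    · simp

end Torus

section Singular

variable {ι : Type} [Fintype ι] [DecidableEq ι] (a b : ι) (m : ℕ)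

/-- The combination of projectors with coefficient one at `a` and `b`. -/
def torElt {R : Type} [CommRing R] (P : ι → Matrix ι ι R) (z : Rest a b → R) : Matrix ι ι R :=
  P a + P b + ∑ j, z j • P j.1

lemma map_torElt {R S : Type} [CommRing R] [CommRing S] (f : R →+* S) (P : ι → Matrix ι ι R)
    (z : Rest a b → R) : f.mapMatrix (torElt a b P z) =
      torElt a b (fun j => f.mapMatrix (P j)) (f ∘ z) := by
  have h : ∀ (c : R) (M : Matrix ι ι R), f.mapMatrix (c • M) = f c • f.mapMatrix M := by
    intro c M
    refine Matrix.ext fun i k => ?_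
    simp
  simp only [torElt, map_add, map_sum, h, Function.comp]

/-- The entries of the equation satisfied by a product of translated torus elements. -/
def torEq (x : ι × ι) : NatFun ((Fin m × ι × ι) ⊕ (Unit × ι × ι) ⊕ (ι × ι × ι))
    (Option (Fin m × Rest a b)) where
  toFun R _ w z := (Fin.partialProd (fun c => slice (w ∘ Sum.inl) c *
      torElt a b (slice (w ∘ Sum.inr ∘ Sum.inr)) fun j => z (some (c, j))) (Fin.last m) -
    z none • slice (w ∘ Sum.inr ∘ Sum.inl) ()) x.1 x.2
  map_toFun R S _ _ f w z := by
    simp only [Function.comp_assoc f, slice_map]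
    have h := map_partialProd (f.mapMatrix : Matrix ι ι R →+* Matrix ι ι S).toMonoidHom
      (fun c => slice (w ∘ Sum.inl) c * torElt a b (slice (w ∘ Sum.inr ∘ Sum.inr))
        fun j => z (some (c, j))) (Fin.last m)
    simp only [RingHom.toMonoidHom_eq_coe, MonoidHom.coe_coe, map_mul, map_torElt] at h
    rw [Matrix.sub_apply, map_sub, Matrix.sub_apply]
    congr 1
    · exact congrFun (congrFun h x.1) x.2
    · simp

/-- A partial product of translated torus elements. -/
def pre {M : Type} [Monoid M] {m : ℕ} (b t : Fin m → M) (c : Fin m) : M :=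
  Fin.partialProd (fun c => b c * t c) c.castSucc * b c

lemma map_pre {M N : Type} [Monoid M] [Monoid N] (f : M →* N) {m : ℕ} (b t : Fin m → M)
    (c : Fin m) : f (pre b t c) = pre (fun c => f (b c)) (fun c => f (t c)) c := by
  simp only [pre, map_mul, map_partialProd]

lemma mat_pre {R : Type} [CommRing R] {m : ℕ} (b t : Fin m → SpecialLinearGroup ι R) (c : Fin m) :
    pre (fun c => mat (b c)) (fun c => mat (t c)) c = mat (pre b t c) :=
  (map_pre (⟨⟨mat, mat_one⟩, mat_mul⟩ : SpecialLinearGroup ι R →* Matrix ι ι R) b t c).symm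

/-- The rows formed by the identity and conjugated projectors. -/
def torRows {R : Type} [CommRing R] {m : ℕ} (U : Fin m → Matrix ι ι R) (P : ι → Matrix ι ι R) :
    Matrix (Option (Fin m × Rest a b)) (ι × ι) R :=
  of fun x y => x.elim (1 : Matrix ι ι R) (fun x => U x.1 * P x.2.1 * (U x.1).adjugate) y.1 y.2

/-- A minor of the matrix of conjugated projectors. -/
def torDet : NatFun ((Fin m × ι × ι) ⊕ (ι × ι × ι) ⊕ ((ι × ι) × Option (Fin m × Rest a b)))
    (Fin m × ι × ι) where
  toFun R _ w s := (torRows a b (pre (slice s) (slice (w ∘ Sum.inl)))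
    (slice (w ∘ Sum.inr ∘ Sum.inl)) * of fun y x => w (Sum.inr (Sum.inr (y, x)))).det
  map_toFun R S _ _ f w s := by
    rw [RingHom.map_det, RingHom.mapMatrix_apply, Matrix.map_mul]
    congr 2
    refine Matrix.ext fun x y => ?_
    cases x with
    | none => simp [torRows, Matrix.one_apply, apply_ite f]
    | some x =>
      have h := map_pre (f.mapMatrix : Matrix ι ι R →+* Matrix ι ι S).toMonoidHom
        (slice s) (slice (w ∘ Sum.inl)) x.1
      have h2 : f.mapMatrix (pre (slice s) (slice (w ∘ Sum.inl)) x.1) =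
          pre (slice (f ∘ s)) (slice ((f ∘ w) ∘ Sum.inl)) x.1 := h
      have h3 : f.mapMatrix (pre (slice s) (slice (w ∘ Sum.inl)) x.1 *
          slice (w ∘ Sum.inr ∘ Sum.inl) x.2.1 *
          (pre (slice s) (slice (w ∘ Sum.inl)) x.1).adjugate) =
          pre (slice (f ∘ s)) (slice ((f ∘ w) ∘ Sum.inl)) x.1 *
            slice ((f ∘ w) ∘ Sum.inr ∘ Sum.inl) x.2.1 *
            (pre (slice (f ∘ s)) (slice ((f ∘ w) ∘ Sum.inl)) x.1).adjugate := by
        rw [map_mul, map_mul, RingHom.map_adjugate, h2]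
        rfl
      exact congrFun (congrFun h3 y.1) y.2

variable {a b m} {K : Type} [Field K]

lemma torRows_apply (u : Fin m → SpecialLinearGroup ι K) (p : SpecialLinearGroup ι K) :
    torRows a b (fun c => mat (u c)) (prj p) = of fun x y =>
      x.elim (1 : Matrix ι ι K) (fun x => prj (u x.1 * p) x.2.1) y.1 y.2 := by
  simp only [torRows, adjugate_mat, conj_prj]

lemma vecMul_torRows (u : Fin m → SpecialLinearGroup ι K) (p : SpecialLinearGroup ι K)
    (x : Option (Fin m × Rest a b) → K) (y : ι × ι) :
    (x ᵥ* torRows a b (fun c => mat (u c)) (prj p)) y = (x none • (1 : Matrix ι ι K) +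
      ∑ c, ∑ j, x (some (c, j)) • prj (u c * p) j.1) y.1 y.2 := by
  rw [torRows_apply]
  simp [vecMul, dotProduct, Fintype.sum_option, Fintype.sum_prod_type, Matrix.sum_apply]

lemma exists_right_inverse_of_vecMul {κ τ : Type} [Fintype κ] [DecidableEq κ] [Fintype τ]
    [DecidableEq τ] (V : Matrix κ τ K) (hV : ∀ x, x ᵥ* V = 0 → x = 0) :
    ∃ L : Matrix τ κ K, V * L = 1 := by
  obtain ⟨g, hg⟩ := LinearMap.exists_leftInverse_of_injective V.vecMulLinear
    (LinearMap.ker_eq_bot'.2 hV)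
  refine ⟨of fun i y => g (Pi.single i 1) y, ?_⟩
  refine Matrix.ext fun x y => ?_
  have h1 : g (V x) = Pi.single x 1 := by
    have := LinearMap.congr_fun hg (Pi.single x 1)
    simpa [Matrix.row] using this
  have h2 : V x = ∑ i, V x i • Pi.single i (1 : K) := by
    funext i
    simp [Finset.sum_apply, Pi.single_apply]
  have h3 := congrFun h1 y
  rw [h2, map_sum] at h3
  simp only [map_smul, Finset.sum_apply, Pi.smul_apply, smul_eq_mul] at h3
  rw [Matrix.mul_apply]
  simp only [of_apply]
  rw [h3, Matrix.one_apply, Pi.single_apply]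
  simp only [eq_comm]

lemma exists_torDet_ne_zero (hab : a ≠ b) (e : Fin (m + 1) ≃ Option (Option ι))
    (t : Fin (m + 1) → SpecialLinearGroup ι K) (p : SpecialLinearGroup ι K) :
    ∃ L : (ι × ι) × Option (Fin (m + 1) × Rest a b) → K,
    ∃ s : Fin (m + 1) → SpecialLinearGroup ι K, (torDet a b (m + 1)).toFun K
      (Sum.elim (coords fun c => mat (t c)) (Sum.elim (coords (prj p)) L))
      (coords fun c => mat (s c)) ≠ 0 := by
  obtain ⟨s, hs⟩ := exists_partialProd_mul_eq t fun c => torTuple a b K (e c) * p⁻¹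
  obtain ⟨L, hL⟩ := exists_right_inverse_of_vecMul
    (torRows a b (fun c => mat (pre s t c)) (prj p)) (by
      intro x hx
      have h1 : x none • (1 : Matrix ι ι K) +
          ∑ c, ∑ j, x (some (e.symm c, j)) • prj (torTuple a b K c) j.1 = 0 := by
        rw [← e.sum_comp]
        refine Matrix.ext fun i k => ?_
        have h2 := congrFun hx (i, k)
        rw [vecMul_torRows] at h2
        have h3 : ∀ c, pre s t c * p = torTuple a b K (e c) := by
          intro c
          rw [pre, hs, inv_mul_cancel_right]
        simp only [h3] at h2
        simpa using h2
      obtain ⟨h4, h5⟩ := torTuple_independent a b hab _ (fun c j => x (some (e.symm c, j))) h1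
      funext y
      match y with
      | none => exact h4
      | some (c, j) => simpa using h5 (e c) j)
  refine ⟨fun x => L x.1 x.2, s, ?_⟩
  have h1 : (torDet a b (m + 1)).toFun K
      (Sum.elim (coords fun c => mat (t c)) (Sum.elim (coords (prj p)) fun x => L x.1 x.2))
      (coords fun c => mat (s c)) = 1 := by
    rw [← det_one (n := Option (Fin (m + 1) × Rest a b)), ← hL]
    simp only [← mat_pre]
    rfl
  rw [h1]
  exact one_ne_zero

lemma independent_of_torDet (t s : Fin m → SpecialLinearGroup ι K) (p : SpecialLinearGroup ι K)
    (L : (ι × ι) × Option (Fin m × Rest a b) → K) (h : (torDet a b m).toFun K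
      (Sum.elim (coords fun c => mat (t c)) (Sum.elim (coords (prj p)) L))
      (coords fun c => mat (s c)) ≠ 0) (x : Option (Fin m × Rest a b) → K)
    (hx : x none • (1 : Matrix ι ι K) +
      ∑ c, ∑ j, x (some (c, j)) • prj (pre s t c * p) j.1 = 0) : x = 0 := by
  have h1 : (torRows a b (fun c => mat (pre s t c)) (prj p) * of fun y x => L (y, x)).det ≠ 0 := by
    simp only [← mat_pre]
    exact h
  refine Matrix.eq_zero_of_vecMul_eq_zero h1 ?_
  rw [← vecMul_vecMul]
  have h2 : x ᵥ* torRows a b (fun c => mat (pre s t c)) (prj p) = 0 := by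
    funext y
    rw [vecMul_torRows, hx]
    rfl
  rw [h2, zero_vecMul]

end Singular

section Singular

variable {ι : Type} [Fintype ι] [DecidableEq ι] {a b : ι} {m : ℕ} {K : Type} [Field K]

lemma sum_eq_add_sum_rest {M : Type} [AddCommMonoid M] (hab : a ≠ b) (f : ι → M) :
    ∑ j, f j = f a + f b + ∑ j : Rest a b, f j.1 := by
  rw [← Finset.add_sum_erase _ _ (Finset.mem_univ a), ← Finset.add_sum_erase _ _
    (Finset.mem_erase.2 ⟨hab.symm, Finset.mem_univ b⟩), add_assoc]
  congr 2
  refine Finset.sum_subtype _ (fun j => ?_) f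
  simp [and_comm]

lemma prj_mul_prj (p : SpecialLinearGroup ι K) (j k : ι) :
    prj p j * prj p k = if j = k then prj p j else 0 := by
  have h : prj p j * prj p k = mat p * (Matrix.single j j 1 * (mat p⁻¹ * mat p) *
      Matrix.single k k 1) * mat p⁻¹ := by
    simp only [prj, Matrix.mul_assoc]
  rw [h, mat_inv_mul_mat, Matrix.mul_one]
  split_ifs with hjk
  · subst hjk; simp [prj]
  · rw [Matrix.single_mul_single_of_ne _ _ _ _ hjk]; simp

lemma prj_mul_torElt (p : SpecialLinearGroup ι K) (z : Rest a b → K) (j : Rest a b) :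
    prj p j.1 * torElt a b (prj p) z = z j • prj p j.1 := by
  simp only [torElt, Matrix.mul_add, prj_mul_prj, j.2.1, j.2.2, if_false, zero_add,
    Matrix.mul_sum, Matrix.mul_smul]
  rw [Finset.sum_eq_single j]
  · simp
  · intro k _ hk
    have : j.1 ≠ k.1 := fun h => hk (Subtype.ext h.symm)
    simp [this]
  · simp

lemma DiagBy.eq_sum {A : Matrix ι ι K} {p : SpecialLinearGroup ι K} {l : ι → K}
    (h : DiagBy A p l) : A = ∑ j, l j • prj p j := by
  have h1 : diagonal l = ∑ j, l j • Matrix.single j j (1 : K) := by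
    refine Matrix.ext fun i k => ?_
    simp only [Matrix.sum_apply, Matrix.smul_apply, Matrix.single_apply, diagonal_apply,
      smul_eq_mul, mul_ite, mul_one, mul_zero, ite_and, Finset.sum_ite_eq', Finset.mem_univ,
      if_true]
  have h' : A = mat p * diagonal l * mat p⁻¹ := h
  rw [h', h1, Matrix.mul_sum, Matrix.sum_mul]
  simp only [prj, Matrix.mul_smul, Matrix.smul_mul]

lemma DiagBy.eq_torElt (hab : a ≠ b) {A : Matrix ι ι K} {p : SpecialLinearGroup ι K} {x : ι → K}
    {s : K} (h : DiagBy A p (s • x)) (ha : x a = 1) (hb : x b = 1) :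
    A = s • torElt a b (prj p) fun j => x j.1 := by
  rw [h.eq_sum, sum_eq_add_sum_rest hab]
  simp [torElt, ha, hb, Finset.smul_sum, mul_smul]

lemma mat_mul_prj (u p : SpecialLinearGroup ι K) (j : ι) :
    mat u * prj p j = prj (u * p) j * mat u := by
  rw [← conj_prj, Matrix.mul_assoc _ (mat u⁻¹), mat_inv_mul_mat, Matrix.mul_one]

open DualNumber in
lemma sn_partialProd (t s : Fin m → SpecialLinearGroup ι K) (p : SpecialLinearGroup ι K)
    (r : Fin m → K) (x v : Fin m → Rest a b → K) (hx : ∀ c j, x c j ≠ 0) (hr : ∀ c, r c ≠ 0)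
    (ht : ∀ c, mat (t c) = r c • torElt a b (prj p) (x c))
    (T : Fin m → Matrix ι ι (DualNumber K)) (hT : ∀ c, fs (T c) = torElt a b (prj p) (x c))
    (hT' : ∀ c, sn (T c) = ∑ j, v c j • prj p j.1) (i : Fin (m + 1)) :
    (∃ q : K, q ≠ 0 ∧ fs (Fin.partialProd (fun c => lift (mat (s c)) * T c) i) =
      q • mat (Fin.partialProd (fun c => s c * t c) i)) ∧
    sn (Fin.partialProd (fun c => lift (mat (s c)) * T c) i) =
      Fin.partialSum (fun c => ∑ j, (v c j / x c j) • prj (pre s t c * p) j.1) i *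
        fs (Fin.partialProd (fun c => lift (mat (s c)) * T c) i) := by
  induction i using Fin.induction with
  | zero =>
    simp only [Fin.partialProd_zero, Fin.partialSum_zero, Matrix.zero_mul, mat_one]
    refine ⟨⟨1, one_ne_zero, ?_⟩, ?_⟩
    · rw [one_smul, ← fs_lift (1 : Matrix ι ι K)]
      congr 1
      simp [lift]
    · have : (1 : Matrix ι ι (DualNumber K)) = lift 1 := by simp [lift]
      rw [this, sn_lift]
  | succ i ih =>
    obtain ⟨⟨q, hq, hqf⟩, hsn⟩ := ih
    rw [Fin.partialProd_succ, Fin.partialSum_succ, Fin.partialProd_succ]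
    set Q := Fin.partialProd (fun c => lift (mat (s c)) * T c) i.castSucc
    have hTt : torElt a b (prj p) (x i) = (r i)⁻¹ • mat (t i) := by
      rw [ht, smul_smul, inv_mul_cancel₀ (hr i), one_smul]
    have hfQ : fs Q * mat (s i) = q • mat (pre s t i) := by
      rw [hqf, pre, mat_mul, Matrix.smul_mul]
    refine ⟨⟨q * (r i)⁻¹, mul_ne_zero hq (inv_ne_zero (hr i)), ?_⟩, ?_⟩
    · simp only [fs_mul, fs_lift, hT, hTt, hqf, mat_mul, Matrix.smul_mul, Matrix.mul_smul,
        smul_smul, mul_comm q]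
    · have h1 : sn (T i) = (∑ j, (v i j / x i j) • prj p j.1) * fs (T i) := by
        rw [hT', hT, Matrix.sum_mul]
        refine Finset.sum_congr rfl fun j _ => ?_
        rw [Matrix.smul_mul, prj_mul_torElt, smul_smul, div_mul_cancel₀ _ (hx i j)]
      have h2 : fs Q * mat (s i) * (∑ j : Rest a b, (v i j / x i j) • prj p j.1) =
          (∑ j : Rest a b, (v i j / x i j) • prj (pre s t i * p) j.1) * (fs Q * mat (s i)) := by
        rw [hfQ, Matrix.mul_sum, Matrix.sum_mul]
        refine Finset.sum_congr rfl fun j _ => ?_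
        simp only [Matrix.smul_mul, Matrix.mul_smul, mat_mul_prj]
        rw [smul_comm]
      simp only [sn_mul, fs_mul, fs_lift, sn_lift, Matrix.zero_mul, add_zero, hsn]
      rw [h1, ← Matrix.mul_assoc, ← Matrix.mul_assoc, h2, Matrix.add_mul, add_comm]
      simp only [Matrix.mul_assoc]

open DualNumber in
lemma eq_zero_of_torEq (t s : Fin m → SpecialLinearGroup ι K) (p : SpecialLinearGroup ι K)
    (y : Matrix ι ι K) (r : Fin m → K) (x : Option (Fin m × Rest a b) → K) (hx : ∀ k, x k ≠ 0)
    (hr : ∀ c, r c ≠ 0) (ht : ∀ c, mat (t c) = r c • torElt a b (prj p) fun j => x (some (c, j)))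
    (hind : ∀ x : Option (Fin m × Rest a b) → K, x none • (1 : Matrix ι ι K) +
      ∑ c, ∑ j, x (some (c, j)) • prj (pre s t c * p) j.1 = 0 → x = 0)
    (v : Option (Fin m × Rest a b) → K)
    (hv : ∀ i : ι × ι, (torEq a b m i).toFun (DualNumber K)
      (algebraMap K (DualNumber K) ∘ Sum.elim (coords fun c => mat (s c))
        (Sum.elim (coords fun _ => y) (coords (prj p))))
      (fun j => algebraMap K (DualNumber K) (x j) + v j • ε) = 0) : v = 0 := by
  set T : Fin m → Matrix ι ι (DualNumber K) := fun c => torElt a b (fun j => lift (prj p j))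
    fun j => algebraMap K (DualNumber K) (x (some (c, j))) + v (some (c, j)) • ε with hTd
  have hT : ∀ c, fs (T c) = torElt a b (prj p) fun j => x (some (c, j)) := by
    intro c
    refine Matrix.ext fun i k => ?_
    simp [hTd, fs, lift, torElt, Matrix.sum_apply, TrivSqZeroExt.fst_sum,
      TrivSqZeroExt.algebraMap_eq_inl]
  have hT' : ∀ c, sn (T c) = ∑ j, v (some (c, j)) • prj p j.1 := by
    intro c
    refine Matrix.ext fun i k => ?_
    simp [hTd, sn, lift, torElt, Matrix.sum_apply, TrivSqZeroExt.snd_sum,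
      TrivSqZeroExt.algebraMap_eq_inl, mul_comm]
  obtain ⟨⟨q, hq, hqf⟩, hsn⟩ := sn_partialProd t s p r (fun c j => x (some (c, j)))
    (fun c j => v (some (c, j))) (fun c j => hx _) hr ht T hT hT' (Fin.last m)
  set Q := Fin.partialProd (fun c => lift (mat (s c)) * T c) (Fin.last m) with hQ
  have hQy : Q = (algebraMap K (DualNumber K) (x none) + v none • ε) • lift y := by
    refine Matrix.ext fun i k => ?_
    exact sub_eq_zero.1 (hv (i, k))
  have h1 : fs Q = x none • y := by
    rw [hQy]
    refine Matrix.ext fun i k => ?_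
    simp [fs, lift, TrivSqZeroExt.algebraMap_eq_inl]
  have h2 : sn Q = v none • y := by
    rw [hQy]
    refine Matrix.ext fun i k => ?_
    simp [sn, lift, TrivSqZeroExt.algebraMap_eq_inl, mul_comm]
  rw [partialSum_last] at hsn
  set D := ∑ c, ∑ j : Rest a b, (v (some (c, j)) / x (some (c, j))) • prj (pre s t c * p) j.1
    with hD
  have h3 : (D - (v none / x none) • 1) * (q • mat (Fin.partialProd (fun c => s c * t c)
      (Fin.last m))) = 0 := by
    rw [← hqf, Matrix.sub_mul, ← hsn, h2, h1, Matrix.smul_mul, Matrix.one_mul, smul_smul,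
      div_mul_cancel₀ _ (hx none), sub_self]
  have h4 : D - (v none / x none) • 1 = 0 := by
    rw [Matrix.mul_smul] at h3
    have h5 := (smul_eq_zero.1 h3).resolve_left hq
    have h6 := congrArg (· * mat (Fin.partialProd (fun c => s c * t c) (Fin.last m))⁻¹) h5
    simpa only [Matrix.mul_assoc, mat_mul_mat_inv, Matrix.mul_one, Matrix.zero_mul] using h6
  have h7 := hind (fun k => k.elim (-(v none / x none)) fun k => v (some k) / x (some k)) (by
    rw [← h4]
    simp only [Option.elim, neg_smul, hD]
    abel)
  funext k
  have h8 := congrFun h7 k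
  have h9 := hx k
  cases k with
  | none =>
    simp only [Option.elim, Pi.zero_apply, neg_eq_zero, div_eq_zero_iff, h9, or_false] at h8
    exact h8
  | some k =>
    simp only [Option.elim, Pi.zero_apply, div_eq_zero_iff, h9, or_false] at h8
    exact h8

end Singular

section Singular

variable {ι : Type} [Fintype ι] [DecidableEq ι] {a b : ι}

lemma partialProd_smul {K : Type} [Field K] {m : ℕ} (r : Fin m → K) (A : Fin m → Matrix ι ι K)
    (i : Fin (m + 1)) : Fin.partialProd (fun c => r c • A c) i =
      Fin.partialProd r i • Fin.partialProd A i := by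
  induction i using Fin.induction with
  | zero => simp
  | succ i ih =>
    simp only [Fin.partialProd_succ, ih, Matrix.smul_mul, Matrix.mul_smul, smul_smul]
    rw [mul_comm]

lemma partialProd_ne_zero {K : Type} [Field K] {m : ℕ} (r : Fin m → K) (hr : ∀ c, r c ≠ 0)
    (i : Fin (m + 1)) : Fin.partialProd r i ≠ 0 := by
  induction i using Fin.induction with
  | zero => simp
  | succ i ih => rw [Fin.partialProd_succ]; exact mul_ne_zero ih (hr _)

/-- Elements of a growing set in a fixed torus with two fixed coordinates equal satisfy a strict
dimension bound. -/
theorem exists_line_bound (hab : a ≠ b) (j : ℕ) : ∃ k C Q : ℕ, ∀ (F K : Type) [Field F] [Fintype F]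
    [Field K] [Algebra F K], Q < Fintype.card F → ∀ H : Set (SpecialLinearGroup ι F),
    (1 : _) ∈ H → Subgroup.closure H = ⊤ → ∀ (p : SpecialLinearGroup ι K) (W : Finset (ι → K))
    (t : (ι → K) → SpecialLinearGroup ι F) (r : (ι → K) → K), (∀ x ∈ W, x a = 1 ∧ x b = 1 ∧
      DiagBy (mat (emb K (t x))) p (r x • x) ∧ t x ∈ H ^ j) →
    W.card ^ (Fintype.card ι + 2) ≤ C * (H ^ k).ncard := by
  classical
  have : Nontrivial ι := ⟨⟨a, b, hab⟩⟩
  set m := Fintype.card ι + 1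
  have e : Fin (m + 1) ≃ Option (Option ι) := Fintype.equivOfCardEq (by simp [m, Fintype.card_option])
  obtain ⟨k, N, Q, hesc⟩ := natural_escape ι (Fin (m + 1)) (torDet a b (m + 1))
  obtain ⟨M, hM⟩ := natural_bezout (torEq a b (m + 1))
  refine ⟨(m + 1) * (k + j), M * N, Q, ?_⟩
  intro F K _ _ _ _ hQ H h1 hcl p W t r hW
  obtain ⟨S, hSN, hSk, hS⟩ := hesc F K hQ H h1 hcl
  have hch : ∀ x : Fin (m + 1) → ι → K, ∃ s ∈ S, ∀ z : Option (Fin (m + 1) × Rest a b) → K,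
      z none • (1 : Matrix ι ι K) + ∑ c, ∑ j, z (some (c, j)) •
        prj (pre (fun c => emb K (s c)) (fun c => emb K (t (x c))) c * p) j.1 = 0 → z = 0 := by
    intro x
    obtain ⟨L, hL⟩ := exists_torDet_ne_zero hab e (fun c => emb K (t (x c))) p
    obtain ⟨s, hs, hs'⟩ := hS _ hL
    rw [ext_eq] at hs'
    exact ⟨s, hs, fun z hz => independent_of_torDet _ _ _ L hs' z hz⟩
  choose s hsS hind using hch
  set E := Fintype.piFinset fun _ : Fin (m + 1) => W
  set Hk := (H ^ ((m + 1) * (k + j))).toFinite.toFinset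
  have hmem : ∀ x ∈ E, ∀ c, x c ∈ W := fun x hx c => Fintype.mem_piFinset.1 hx c
  have hEcard : E.card = W.card ^ (Fintype.card ι + 2) := by
    simp [E, m]
  have hTcard : (S ×ˢ Hk).card ≤ N * (H ^ ((m + 1) * (k + j))).ncard := by
    rw [Finset.card_product, Set.ncard_eq_toFinset_card _]
    exact Nat.mul_le_mul_right _ hSN
  rw [← hEcard]
  refine (Finset.card_le_mul_card_image_of_maps_to (t := S ×ˢ Hk)
    (f := fun x => (s x, Fin.partialProd (fun c => s x c * t (x c)) (Fin.last _))) ?_ M ?_).trans ?_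
  · intro x hx
    refine Finset.mem_product.2 ⟨hsS x, (Set.Finite.mem_toFinset _).2 ?_⟩
    exact mul_partialProd_mem _ _ (hSk _ (hsS x)) (fun c => (hW _ (hmem x hx c)).2.2.2) (Fin.last _)
  · rintro ⟨s₀, y⟩ -
    have hfib : ∀ x, x ∈ E.filter (fun x =>
        (s x, Fin.partialProd (fun c => s x c * t (x c)) (Fin.last _)) = (s₀, y)) →
        x ∈ E ∧ s x = s₀ ∧ Fin.partialProd (fun c => s₀ c * t (x c)) (Fin.last _) = y := by
      intro x hx
      obtain ⟨hxE, hx⟩ := Finset.mem_filter.1 hx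
      obtain ⟨h2, h3⟩ := Prod.mk.inj hx
      exact ⟨hxE, h2, by rw [← h3, h2]⟩
    have hr : ∀ x ∈ W, r x ≠ 0 ∧ ∀ i, x i ≠ 0 := by
      intro x hx
      have h2 := (hW x hx).2.2.1.ne_zero
      refine ⟨fun h => h2 a (by simp [h]), fun i h => h2 i (by simp [h])⟩
    have ht : ∀ x ∈ W, mat (emb K (t x)) = r x • torElt a b (prj p) fun j => x j.1 :=
      fun x hx => (hW x hx).2.2.1.eq_torElt hab (hW x hx).1 (hW x hx).2.1
    rw [← Finset.card_image_of_injOn (f := fun x (k : Option (Fin (m + 1) × Rest a b)) =>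
      k.elim (Fin.partialProd (fun c => r (x c)) (Fin.last _))⁻¹ fun k => x k.1 k.2.1)]
    · refine hM K (Sum.elim (coords fun c => mat (emb K (s₀ c)))
        (Sum.elim (coords fun _ => mat (emb K y)) (coords (prj p)))) _ ?_ ?_
      · intro w hw i
        obtain ⟨x, hx, rfl⟩ := Finset.mem_image.1 hw
        obtain ⟨hxE, hxs, hxy⟩ := hfib x hx
        have h2 : Fin.partialProd (fun c => mat (emb K (s₀ c)) * torElt a b (prj p)
            fun j => x c j.1) (Fin.last _) =
            (Fin.partialProd (fun c => r (x c)) (Fin.last _))⁻¹ • mat (emb K y) := by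
          have h3 : mat (emb K y) = Fin.partialProd (fun c => r (x c) • (mat (emb K (s₀ c)) *
              torElt a b (prj p) fun j => x c j.1)) (Fin.last _) := by
            rw [← hxy, map_partialProd]
            refine (map_partialProd (⟨⟨mat, mat_one⟩, mat_mul⟩ : SpecialLinearGroup ι K →*
              Matrix ι ι K) _ _).trans ?_
            congr 1
            funext c
            change mat (emb K (s₀ c * t (x c))) = _
            rw [map_mul, mat_mul, ht _ (hmem x hxE c), Matrix.mul_smul]
          rw [h3, partialProd_smul, smul_smul, inv_mul_cancel₀, one_smul]
          exact partialProd_ne_zero _ (fun c => (hr _ (hmem x hxE c)).1) _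
        have h4 := congrFun (congrFun h2 i.1) i.2
        exact sub_eq_zero.2 h4
      · intro w hw v hv
        obtain ⟨x, hx, rfl⟩ := Finset.mem_image.1 hw
        obtain ⟨hxE, hxs, hxy⟩ := hfib x hx
        refine eq_zero_of_torEq (fun c => emb K (t (x c))) (fun c => emb K (s₀ c)) p
          (mat (emb K y)) (fun c => r (x c)) _ ?_ (fun c => (hr _ (hmem x hxE c)).1)
          (fun c => ht _ (hmem x hxE c)) (hxs ▸ hind x) v hv
        intro k
        cases k with
        | none => exact inv_ne_zero (partialProd_ne_zero _ (fun c => (hr _ (hmem x hxE c)).1) _)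
        | some k => exact (hr _ (hmem x hxE k.1)).2 _
    · intro x hx x' hx' hxx
      obtain ⟨hxE, -⟩ := hfib x hx
      obtain ⟨hxE', -⟩ := hfib x' hx'
      funext c i
      by_cases hia : i = a
      · rw [hia, (hW _ (hmem x hxE c)).1, (hW _ (hmem x' hxE' c)).1]
      by_cases hib : i = b
      · rw [hib, (hW _ (hmem x hxE c)).2.1, (hW _ (hmem x' hxE' c)).2.1]
      exact congrFun hxx (some (c, ⟨i, hia, hib⟩))
  · rw [Nat.mul_assoc]
    exact Nat.mul_le_mul_left _ hTcard

lemma DiagBy.prod_eq_one {K : Type} [Field K] {A p : SpecialLinearGroup ι K} {l : ι → K}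
    (h : DiagBy (mat A) p l) : ∏ i, l i = 1 := by
  have h1 := congrArg Matrix.det h
  rw [det_mul, det_mul, det_mat, det_mat, det_mat, det_diagonal, one_mul, mul_one] at h1
  exact h1.symm

lemma DiagBy.eq_of_eq {K : Type} [Field K] {A B p : SpecialLinearGroup ι K} {l : ι → K}
    (h : DiagBy (mat A) p l) (h' : DiagBy (mat B) p l) : A = B :=
  mat_injective (Eq.trans h h'.symm)

lemma ncard_pow_le {G : Type} [Group G] [Finite G] {H : Set G} (h1 : (1 : G) ∈ H) {k l : ℕ}
    (hkl : k ≤ l) : (H ^ k).ncard ≤ (H ^ l).ncard :=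
  Set.ncard_le_ncard (Set.pow_subset_pow_right h1 hkl) (Set.toFinite _)

variable (ι) in
/-- Singular elements of a growing set in a fixed torus satisfy a strict dimension bound. -/
theorem exists_singular_bound [Nontrivial ι] (j : ℕ) : ∃ k C Q : ℕ, ∀ (F K : Type) [Field F]
    [Fintype F] [Field K] [Algebra F K], Q < Fintype.card F → ∀ H : Set (SpecialLinearGroup ι F),
    (1 : _) ∈ H → Subgroup.closure H = ⊤ → ∀ (p : SpecialLinearGroup ι K)
    (X : Finset (SpecialLinearGroup ι F)), (∀ x ∈ X, x ∈ H ^ j ∧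
      ∃ l, ¬ Function.Injective l ∧ DiagBy (mat (emb K x)) p l) →
    X.card ^ (Fintype.card ι + 2) ≤ C * (H ^ k).ncard := by
  classical
  have hline := fun ab : {ab : ι × ι // ab.1 ≠ ab.2} => exists_line_bound ab.2 j
  choose k C Q hkCQ using hline
  set n := Fintype.card ι
  refine ⟨Finset.univ.sup k, (n * n * n) ^ (n + 2) * Finset.univ.sup C, Finset.univ.sup Q, ?_⟩
  intro F K _ _ _ _ hQ H h1 hcl p X hX
  choose! hXj l hl hdiag using hX
  have hpair : ∀ x ∈ X, ∃ ab : {ab : ι × ι // ab.1 ≠ ab.2}, l x ab.1.1 = l x ab.1.2 := by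
    intro x hx
    have := hl x hx
    simp only [Function.Injective, not_forall] at this
    obtain ⟨a, b, hlab, hab⟩ := this
    exact ⟨⟨(a, b), hab⟩, hlab⟩
  have hpairs : ∃ ab : {ab : ι × ι // ab.1 ≠ ab.2},
      X.card ≤ n * n * (X.filter fun x => l x ab.1.1 = l x ab.1.2).card := by
    have hne : (Finset.univ : Finset {ab : ι × ι // ab.1 ≠ ab.2}).Nonempty := by
      obtain ⟨a, b, hab⟩ := exists_pair_ne ι
      exact ⟨⟨(a, b), hab⟩, Finset.mem_univ _⟩
    obtain ⟨ab, -, hab⟩ := Finset.exists_max_image Finset.univ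
      (fun ab : {ab : ι × ι // ab.1 ≠ ab.2} => (X.filter fun x => l x ab.1.1 = l x ab.1.2).card) hne
    refine ⟨ab, ?_⟩
    have hsub : X ⊆ Finset.univ.biUnion fun ab : {ab : ι × ι // ab.1 ≠ ab.2} =>
        X.filter fun x => l x ab.1.1 = l x ab.1.2 := by
      intro x hx
      obtain ⟨ab, h⟩ := hpair x hx
      exact Finset.mem_biUnion.2 ⟨ab, Finset.mem_univ _, Finset.mem_filter.2 ⟨hx, h⟩⟩
    refine ((Finset.card_le_card hsub).trans (Finset.card_biUnion_le_card_mul _ _ _ hab)).trans ?_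
    refine Nat.mul_le_mul_right _ ?_
    rw [Finset.card_univ]
    refine (Fintype.card_subtype_le _).trans ?_
    rw [Fintype.card_prod]
  obtain ⟨⟨⟨a, b⟩, hab⟩, hXab⟩ := hpairs
  set Y := X.filter fun x => l x a = l x b
  have hY : ∀ x ∈ Y, x ∈ X ∧ l x a = l x b := fun x hx => Finset.mem_filter.1 hx
  have hne : ∀ x ∈ Y, ∀ i, l x i ≠ 0 := fun x hx => (hdiag x (hY x hx).1).ne_zero
  set f : SpecialLinearGroup ι F → ι → K := fun x => (l x a)⁻¹ • l x with hf
  set W := Y.image f with hWdef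
  have hYW : Y.card ≤ n * W.card := by
    refine Finset.card_le_mul_card_image Y n fun w _ => ?_
    refine (Finset.card_le_card_of_injOn (t := (Polynomial.nthRoots n (∏ i, w i)⁻¹).toFinset)
      (fun x => l x a) ?_ ?_).trans ?_
    · intro x hx
      obtain ⟨hxY, hxw⟩ := Finset.mem_filter.1 hx
      have h2 := (hdiag x (hY x hxY).1).prod_eq_one
      rw [Finset.mem_coe, Multiset.mem_toFinset, Polynomial.mem_nthRoots Fintype.card_pos]
      rw [← hxw]
      simp only [hf, Pi.smul_apply, smul_eq_mul, Finset.prod_mul_distrib, Finset.prod_const,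
        Finset.card_univ, h2, mul_one, inv_pow, inv_inv]
    · intro x hx y hy hxy
      obtain ⟨hxY, hxw⟩ := Finset.mem_filter.1 hx
      obtain ⟨hyY, hyw⟩ := Finset.mem_filter.1 hy
      have h3 : l x = l y := by
        have h4 : f x = f y := hxw.trans hyw.symm
        have hxy' : l x a = l y a := hxy
        simp only [hf, hxy'] at h4
        exact smul_right_injective _ (inv_ne_zero (hne y hyY a)) h4
      refine emb_injective (K := K) ((hdiag x (hY x hxY).1).eq_of_eq (p := p) (l := l x) ?_)
      rw [h3]
      exact hdiag y (hY y hyY).1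
    · exact (Multiset.toFinset_card_le _).trans (Polynomial.card_nthRoots _ _)
  have hch : ∀ w ∈ W, ∃ x ∈ Y, f x = w := fun w hw => Finset.mem_image.1 hw
  choose! t htY htf using hch
  have hQ' : Q ⟨(a, b), hab⟩ < Fintype.card F :=
    lt_of_le_of_lt (Finset.le_sup (f := Q) (Finset.mem_univ _)) hQ
  have hmain := hkCQ ⟨(a, b), hab⟩ F K hQ' H h1 hcl p W t (fun w => l (t w) a) (by
    intro w hw
    have h2 := htf w hw
    have h3 := hY _ (htY w hw)
    have h4 := hne _ (htY w hw) a
    refine ⟨?_, ?_, ?_, hXj _ h3.1⟩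
    · rw [← h2]; simp [hf, h4]
    · rw [← h2]; simp [hf, ← h3.2, h4]
    · have h5 : l (t w) a • w = l (t w) := by
        refine (congrArg (l (t w) a • ·) h2.symm).trans ?_
        simp [hf, smul_smul, h4]
      rw [h5]
      exact hdiag _ h3.1)
  calc X.card ^ (n + 2) ≤ (n * n * n * W.card) ^ (n + 2) := by
        refine Nat.pow_le_pow_left ?_ _
        rw [Nat.mul_assoc (n * n)]
        exact hXab.trans (Nat.mul_le_mul_left _ hYW)
    _ = (n * n * n) ^ (n + 2) * W.card ^ (n + 2) := mul_pow _ _ _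
    _ ≤ (n * n * n) ^ (n + 2) * (C ⟨(a, b), hab⟩ * (H ^ k ⟨(a, b), hab⟩).ncard) :=
        Nat.mul_le_mul_left _ hmain
    _ ≤ (n * n * n) ^ (n + 2) * (Finset.univ.sup C * (H ^ Finset.univ.sup k).ncard) :=
        Nat.mul_le_mul_left _ (Nat.mul_le_mul (Finset.le_sup (f := C) (Finset.mem_univ _))
          (ncard_pow_le h1 (Finset.le_sup (f := k) (Finset.mem_univ _))))
    _ = _ := (Nat.mul_assoc _ _ _).symm

end Singular

section Counting

lemma ncard_le_mul_ncard_image {α β : Type} [Finite α] (S : Set α) (f : α → β) (N : ℕ)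
    (h : ∀ x ∈ S, {y ∈ S | f y = f x}.ncard ≤ N) : S.ncard ≤ N * (f '' S).ncard := by
  classical
  have h1 : (f '' S) = ↑(S.toFinite.toFinset.image f) := by simp
  rw [h1, Set.ncard_coe_finset, Set.ncard_eq_toFinset_card S]
  refine Finset.card_le_mul_card_image _ _ fun b hb => ?_
  obtain ⟨x, hx, rfl⟩ := Finset.mem_image.1 hb
  refine le_trans (le_of_eq ?_) (h x ((Set.Finite.mem_toFinset _).1 hx))
  rw [← Set.ncard_coe_finset]
  congr 1
  ext y
  simp

lemma ncard_le_of_image_subset {α β : Type} [Finite α] [Finite β] {S : Set α} {U : Set β}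
    (f : α → β) {N : ℕ} (hf : ∀ x ∈ S, f x ∈ U) (h : ∀ x ∈ S, {y ∈ S | f y = f x}.ncard ≤ N) :
    S.ncard ≤ N * U.ncard :=
  (ncard_le_mul_ncard_image S f N h).trans
    (Nat.mul_le_mul_left _ (Set.ncard_le_ncard (Set.image_subset_iff.2 hf)))

variable {G : Type} [Group G] [Finite G]

lemma ncard_le_inter_mul_conj (B : Set G) (g : G) (T : Subgroup G)
    (hT : ∀ t, t * g = g * t → t ∈ T) :
    B.ncard ≤ (B⁻¹ * B ∩ T : Set G).ncard * ((fun x => x * g * x⁻¹) '' B).ncard := by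
  refine ncard_le_mul_ncard_image B _ _ fun x hx => ?_
  refine Set.ncard_le_ncard_of_injOn (fun y => x⁻¹ * y) ?_ (fun y _ z _ h => mul_left_cancel h)
  rintro y ⟨hy, hyx⟩
  refine ⟨Set.mul_mem_mul (by simpa using hx) hy, hT _ ?_⟩
  have h1 : y * g = x * g * x⁻¹ * y := by
    rw [← hyx]; group
  rw [mul_assoc, h1]; group

lemma ncard_mul_inter_le (A B : Set G) (T : Subgroup G) :
    A.ncard * (B ∩ T : Set G).ncard ≤ (A⁻¹ * A ∩ T : Set G).ncard * (A * B).ncard := by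
  rw [← Set.ncard_prod]
  refine ncard_le_of_image_subset (fun x => x.1 * x.2)
    (fun x hx => Set.mul_mem_mul hx.1 hx.2.1) ?_
  rintro ⟨a, t⟩ ⟨ha, htB, htT⟩
  refine Set.ncard_le_ncard_of_injOn (fun y => a⁻¹ * y.1) ?_ ?_
  · rintro ⟨a', t'⟩ ⟨⟨ha', -, ht'⟩, h⟩
    refine ⟨Set.mul_mem_mul (by simpa using ha) ha', ?_⟩
    have h1 : a⁻¹ * a' = t * t'⁻¹ := by
      have h2 : a' * t' = a * t := h
      rw [inv_mul_eq_iff_eq_mul, ← mul_assoc, ← h2]; group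
    change a⁻¹ * a' ∈ T
    rw [h1]
    exact T.mul_mem htT (T.inv_mem ht')
  · rintro ⟨a', t'⟩ ⟨-, h⟩ ⟨a'', t''⟩ ⟨-, h'⟩ h2
    have h3 : a' = a'' := mul_left_cancel h2
    subst h3
    exact Prod.ext rfl (mul_left_cancel (h.trans h'.symm))

end Counting

section Tori

variable {ι : Type} [Fintype ι] [DecidableEq ι] {F K : Type} [Field F] [Field K] [Algebra F K]

lemma diagBy_iff {A : Matrix ι ι K} {p : SpecialLinearGroup ι K} {l : ι → K} :
    DiagBy A p l ↔ mat p⁻¹ * A * mat p = diagonal l := by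
  rw [DiagBy]
  constructor
  · rintro rfl
    rw [Matrix.mul_assoc, Matrix.mul_assoc, mat_inv_mul_mat, Matrix.mul_one, ← Matrix.mul_assoc,
      mat_inv_mul_mat, Matrix.one_mul]
  · intro h
    rw [← h, Matrix.mul_assoc, Matrix.mul_assoc, mat_mul_mat_inv, Matrix.mul_one, ← Matrix.mul_assoc,
      mat_mul_mat_inv, Matrix.one_mul]

lemma DiagBy.of_commute {A B : Matrix ι ι K} {p : SpecialLinearGroup ι K} {l : ι → K}
    (h : DiagBy A p l) (hl : Function.Injective l) (hAB : B * A = A * B) :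
    DiagBy B p fun i => (mat p⁻¹ * B * mat p) i i := by
  rw [diagBy_iff] at *
  have h1 : (mat p⁻¹ * B * mat p) * diagonal l = diagonal l * (mat p⁻¹ * B * mat p) := by
    rw [← h]
    have h2 : ∀ X Y : Matrix ι ι K, mat p⁻¹ * X * mat p * (mat p⁻¹ * Y * mat p) =
        mat p⁻¹ * (X * Y) * mat p := by
      intro X Y
      rw [Matrix.mul_assoc _ (mat p), ← Matrix.mul_assoc (mat p), ← Matrix.mul_assoc (mat p),
        mat_mul_mat_inv, Matrix.one_mul]
      simp only [Matrix.mul_assoc]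
    rw [h2, h2, hAB]
  refine Matrix.ext fun i j => ?_
  rw [diagonal_apply]
  split_ifs with hij
  · rw [hij]
  · have h2 := congrFun (congrFun h1 i) j
    rw [mul_diagonal, diagonal_mul, mul_comm (l i)] at h2
    by_contra h0
    exact hij (hl (mul_left_cancel₀ h0 h2)).symm

lemma DiagBy.mul {A B : Matrix ι ι K} {p : SpecialLinearGroup ι K} {l l' : ι → K}
    (h : DiagBy A p l) (h' : DiagBy B p l') : DiagBy (A * B) p fun i => l i * l' i := by
  have h1 : A = _ := h
  have h2 : B = _ := h'
  rw [DiagBy, h1, h2, ← diagonal_mul_diagonal]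
  simp only [Matrix.mul_assoc]
  rw [← Matrix.mul_assoc (mat p⁻¹) (mat p), mat_inv_mul_mat, Matrix.one_mul]

lemma DiagBy.inv {A p : SpecialLinearGroup ι K} {l : ι → K} (h : DiagBy (mat A) p l) :
    DiagBy (mat A⁻¹) p fun i => (l i)⁻¹ := by
  have h1 := h.ne_zero
  have h2 : DiagBy (mat A * (mat p * diagonal (fun i => (l i)⁻¹) * mat p⁻¹)) p
      fun i => l i * (l i)⁻¹ := h.mul rfl
  have h3 : mat A * (mat p * diagonal (fun i => (l i)⁻¹) * mat p⁻¹) = 1 := by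
    have h2' : mat A * (mat p * diagonal (fun i => (l i)⁻¹) * mat p⁻¹) = _ := h2
    rw [h2']
    simp only [fun i => mul_inv_cancel₀ (h1 i)]
    rw [diagonal_one, Matrix.mul_one, mat_mul_mat_inv]
  rw [DiagBy, ← Matrix.one_mul (mat p * _ * _), ← mat_inv_mul_mat A, Matrix.mul_assoc, h3,
    Matrix.mul_one]

variable (F) in
/-- The elements diagonalised by `p`. -/
def torus (p : SpecialLinearGroup ι K) : Subgroup (SpecialLinearGroup ι F) where
  carrier := {x | ∃ l, DiagBy (mat (emb K x)) p l}
  mul_mem' := by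
    rintro x y ⟨l, hl⟩ ⟨l', hl'⟩
    refine ⟨fun i => l i * l' i, ?_⟩
    rw [map_mul, mat_mul]
    exact hl.mul hl'
  one_mem' := ⟨1, by
    rw [diagBy_iff, map_one, mat_one, Matrix.mul_one, mat_inv_mul_mat]
    exact diagonal_one.symm⟩
  inv_mem' := by
    rintro x ⟨l, hl⟩
    refine ⟨fun i => (l i)⁻¹, ?_⟩
    rw [map_inv]
    exact hl.inv

/-- The regular elements diagonalised by `p`. -/
def IsReg (p : SpecialLinearGroup ι K) (x : SpecialLinearGroup ι F) : Prop :=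
  ∃ l, Function.Injective l ∧ DiagBy (mat (emb K x)) p l

lemma IsReg.mem_of_commute {p : SpecialLinearGroup ι K} {x t : SpecialLinearGroup ι F}
    (h : IsReg p x) (ht : t * x = x * t) : t ∈ torus F p := by
  obtain ⟨l, hl, h⟩ := h
  refine ⟨_, h.of_commute hl ?_⟩
  rw [← mat_mul, ← map_mul, ht, map_mul, mat_mul]

lemma conj_mem_torus {p : SpecialLinearGroup ι K} {x : SpecialLinearGroup ι F} (h : x ∈ torus F p)
    (g : SpecialLinearGroup ι F) : g * x * g⁻¹ ∈ torus F (emb K g * p) := by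
  obtain ⟨l, h⟩ := h
  refine ⟨l, ?_⟩
  have := h.conj (emb K g)
  rwa [← map_inv, ← map_mul, ← map_mul] at this

lemma exists_forall_mulVec_ne_zero [Fintype F] (hF : Fintype.card ι < Fintype.card F)
    (p : SpecialLinearGroup ι K) :
    ∃ v : ι → F, ∀ i, (mat p *ᵥ fun j => algebraMap F K (v j)) i ≠ 0 := by
  classical
  by_contra! hcon
  set f : ι → MvPolynomial ι K := fun i => ∑ j, C (mat p i j) * X j with hf
  have hev : ∀ i (v : ι → K), eval v (f i) = (mat p *ᵥ v) i := by
    intro i v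
    simp [hf, mulVec, dotProduct]
  have hf0 : ∀ i, f i ≠ 0 := by
    intro i h0
    have h1 := hev i (mat p⁻¹ *ᵥ Pi.single i 1)
    rw [h0, mulVec_mulVec, mat_mul_mat_inv] at h1
    simp at h1
  have hdeg : (∏ i, f i).totalDegree ≤ Fintype.card ι := by
    refine (totalDegree_finsetProd _ _).trans ?_
    refine (Finset.sum_le_card_nsmul _ _ 1 fun i _ => ?_).trans (by simp)
    refine totalDegree_finsetSum_le fun j _ => ?_
    refine (totalDegree_mul _ _).trans ?_
    simp
  refine Finset.prod_ne_zero_iff.2 (fun i _ => hf0 i)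
    (eq_zero_of_eval_zero_at_prod_finset (∏ i, f i)
      (fun _ => Finset.univ.image (algebraMap F K)) ?_ ?_)
  · intro i
    rw [Finset.card_image_of_injective _ (algebraMap F K).injective, Finset.card_univ]
    exact ((degreeOf_le_totalDegree _ _).trans hdeg).trans_lt hF
  · intro x hx
    have hx' : ∀ j, ∃ y, algebraMap F K y = x j := fun j => by
      obtain ⟨y, -, hy⟩ := Finset.mem_image.1 (hx j)
      exact ⟨y, hy⟩
    choose v hv using hx'
    obtain ⟨i, hi⟩ := hcon v
    rw [map_prod]
    refine Finset.prod_eq_zero (Finset.mem_univ i) ?_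
    rw [hev, ← hi]
    simp only [hv]

/-- The number of rational points of a torus. -/
lemma ncard_torus_mul_le [Nonempty ι] [Fintype F] (hF : Fintype.card ι < Fintype.card F)
    (p : SpecialLinearGroup ι K) : (torus F p : Set (SpecialLinearGroup ι F)).ncard *
      (Fintype.card F - 1) ≤ Fintype.card ι * Fintype.card F ^ Fintype.card ι := by
  classical
  obtain ⟨v, hv⟩ := exists_forall_mulVec_ne_zero hF p⁻¹
  have hU : (Set.univ : Set Fˣ).ncard = Fintype.card F - 1 := by
    rw [Set.ncard_univ, Nat.card_eq_fintype_card, Fintype.card_units]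
  have hV : (Set.univ : Set (ι → F)).ncard = Fintype.card F ^ Fintype.card ι := by
    rw [Set.ncard_univ, Nat.card_eq_fintype_card, Fintype.card_fun]
  rw [← hU, ← Set.ncard_prod, ← hV]
  refine ncard_le_of_image_subset (fun x => x.2.1 • (mat x.1 *ᵥ v)) (fun _ _ => Set.mem_univ _) ?_
  rintro ⟨t, c⟩ ⟨ht, -⟩
  have key : ∀ t' ∈ torus F p, ∀ c' : Fˣ, c'.1 • (mat t' *ᵥ v) = c.1 • (mat t *ᵥ v) →
      c'.1 • mat t' = c.1 • mat t := by
    intro t' ht' c' h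
    obtain ⟨l, hl⟩ := ht
    obtain ⟨l', hl'⟩ := ht'
    have hmap : ∀ (A : SpecialLinearGroup ι F), (mat (emb K A) *ᵥ fun j => algebraMap F K (v j)) =
        fun i => algebraMap F K ((mat A *ᵥ v) i) := by
      intro A
      funext i
      rw [mat_emb]
      simp [mulVec, dotProduct]
    have hd : ∀ (A : SpecialLinearGroup ι F) l, DiagBy (mat (emb K A)) p l → ∀ i,
        (mat p⁻¹ *ᵥ fun j => algebraMap F K ((mat A *ᵥ v) j)) i =
          l i * (mat p⁻¹ *ᵥ fun j => algebraMap F K (v j)) i := by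
      intro A l hA i
      have hA' : mat (emb K A) = _ := hA
      rw [← hmap, hA', mulVec_mulVec, ← Matrix.mul_assoc, ← Matrix.mul_assoc, mat_inv_mul_mat,
        Matrix.one_mul, ← mulVec_mulVec, mulVec_diagonal]
    have hll : ∀ i, algebraMap F K c'.1 * l' i = algebraMap F K c.1 * l i := by
      intro i
      refine mul_right_cancel₀ (hv i) ?_
      rw [mul_assoc, mul_assoc, ← hd _ _ hl, ← hd _ _ hl']
      have h2 : ∀ (c : F) (u : ι → F), algebraMap F K c * (mat p⁻¹ *ᵥ fun j => algebraMap F K (u j)) i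
          = (mat p⁻¹ *ᵥ fun j => algebraMap F K ((c • u) j)) i := by
        intro c u
        simp only [mulVec, dotProduct, Pi.smul_apply, smul_eq_mul, map_mul, Finset.mul_sum]
        exact Finset.sum_congr rfl fun j _ => by ring
      rw [h2, h2, h]
    have h3 : algebraMap F K c'.1 • mat (emb K t') = algebraMap F K c.1 • mat (emb K t) := by
      rw [hl.eq_sum, hl'.eq_sum]
      simp only [Finset.smul_sum, smul_smul, hll]
    refine Matrix.ext fun i j => (algebraMap F K).injective ?_
    have h4 := congrFun (congrFun h3 i) j
    simpa [mat_emb] using h4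
  refine (Set.ncard_le_ncard_of_injOn (t := (Polynomial.nthRoots (Fintype.card ι)
    (c.1 ^ Fintype.card ι)).toFinset) (fun x => x.2.1) ?_ ?_).trans ?_
  · rintro ⟨t', c'⟩ ⟨⟨ht', -⟩, h⟩
    have h2 := congrArg Matrix.det (key t' ht' c' h)
    rw [det_smul, det_smul, det_mat, det_mat, mul_one, mul_one] at h2
    rw [Finset.mem_coe, Multiset.mem_toFinset, Polynomial.mem_nthRoots Fintype.card_pos]
    exact h2
  · rintro ⟨t', c'⟩ ⟨⟨ht', -⟩, h⟩ ⟨t'', c''⟩ ⟨⟨ht'', -⟩, h'⟩ hcc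
    have hc : c' = c'' := Units.ext hcc
    subst hc
    have h2 := (key t' ht' c' h).trans (key t'' ht'' c' h').symm
    have h3 : t' = t'' := mat_injective (smul_right_injective _ c'.ne_zero h2)
    rw [h3]
  · rw [Set.ncard_coe_finset]
    exact (Multiset.toFinset_card_le _).trans (Polynomial.card_nthRoots _ _)

/-- The conjugates of a torus in which a given element is regular are few. -/
lemma ncard_isReg_conj_le [Finite F] [Nonempty ι] (p : SpecialLinearGroup ι K)
    (r : SpecialLinearGroup ι F) :
    {x : SpecialLinearGroup ι F | IsReg (emb K x * p) r}.ncard ≤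
      (torus F p : Set (SpecialLinearGroup ι F)).ncard * Fintype.card ι ^ Fintype.card ι := by
  classical
  set S := {x : SpecialLinearGroup ι F | IsReg (emb K x * p) r}
  have hS : ∀ x ∈ S, ∃ l, Function.Injective l ∧ DiagBy (mat (emb K r)) (emb K x * p) l := fun _ h => h
  choose! l hl hd using hS
  set R := (mat (emb K r)).charpoly.roots.toFinset
  set U := Fintype.piFinset fun _ : ι => R
  have hU : U.card ≤ Fintype.card ι ^ Fintype.card ι := by
    rw [Fintype.card_piFinset, Finset.prod_const, Finset.card_univ]
    refine Nat.pow_le_pow_left ?_ _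
    refine (Multiset.toFinset_card_le _).trans ((Polynomial.card_roots' _).trans ?_)
    rw [charpoly_natDegree_eq_dim]
  refine le_trans ?_ (Nat.mul_le_mul_left _ hU)
  rw [← Set.ncard_coe_finset]
  refine (ncard_le_mul_ncard_image S l _ ?_).trans (Nat.mul_le_mul_left _
    (Set.ncard_le_ncard (Set.image_subset_iff.2 ?_) (Finset.finite_toSet _)))
  · intro x hx
    refine Set.ncard_le_ncard_of_injOn (fun y => x⁻¹ * y) ?_ (fun y _ z _ h => mul_left_cancel h)
    rintro y ⟨hy, hyx⟩
    have h1 := hd x hx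
    have h2 := hd y hy
    rw [hyx] at h2
    rw [diagBy_iff] at h1 h2
    have hreg : IsReg p (x⁻¹ * r * x) := by
      refine ⟨l x, hl x hx, ?_⟩
      rw [diagBy_iff, ← h1]
      simp only [mat_mul, _root_.mul_inv_rev, map_mul, map_inv, Matrix.mul_assoc]
    refine hreg.mem_of_commute ?_
    have h3 : x⁻¹ * r * x = y⁻¹ * r * y := by
      refine emb_injective (K := K) (mat_injective ?_)
      have h4 : DiagBy (mat (emb K (x⁻¹ * r * x))) p (l x) := by
        rw [diagBy_iff, ← h1]
        simp only [mat_mul, _root_.mul_inv_rev, map_mul, map_inv, Matrix.mul_assoc]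
      have h5 : DiagBy (mat (emb K (y⁻¹ * r * y))) p (l x) := by
        rw [diagBy_iff, ← h2]
        simp only [mat_mul, _root_.mul_inv_rev, map_mul, map_inv, Matrix.mul_assoc]
      exact Eq.trans h4 (Eq.symm h5)
    rw [mul_assoc _ y, show y * (x⁻¹ * r * x) = r * y by rw [h3]; group]
    group
  · intro x hx
    refine Fintype.mem_piFinset.2 fun i => ?_
    rw [Multiset.mem_toFinset, Polynomial.mem_roots (charpoly_monic _).ne_zero, Polynomial.IsRoot,
      eval_charpoly]
    have h1 := (hd x hx).det_sub i
    rw [← neg_sub, det_neg, h1, mul_zero]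

end Tori

section Pivot

variable (ι : Type) [Fintype ι] [DecidableEq ι]

/-- The discriminant as a natural function. -/
noncomputable def discFun : NatFun Empty (Unit × ι × ι) where
  toFun _ _ _ b := disc (slice b ())
  map_toFun _ _ _ _ f _ _ := map_disc f _

lemma exists_isReg [Nontrivial ι] : ∃ k Q : ℕ, ∀ (F : Type) [Field F] [Fintype F],
    Q < Fintype.card F → ∀ H : Set (SpecialLinearGroup ι F), (1 : _) ∈ H →
    Subgroup.closure H = ⊤ →
    ∃ g ∈ H ^ k, ∃ p : SpecialLinearGroup ι (AlgebraicClosure F), IsReg p g := by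
  obtain ⟨k, N, Q, h⟩ := natural_escape ι Unit (discFun ι)
  refine ⟨k, Q, fun F _ _ hQ H h1 hcl => ?_⟩
  obtain ⟨S, -, hSk, hS⟩ := h F (AlgebraicClosure F) hQ H h1 hcl
  obtain ⟨b, hb⟩ := exists_disc_ne_zero (ι := ι) (K := AlgebraicClosure F)
  obtain ⟨s, hs, hs'⟩ := hS Empty.elim ⟨fun _ => b, hb⟩
  rw [ext_eq] at hs'
  obtain ⟨p, l, hd, hl⟩ := exists_diagBy_of_disc_ne_zero _ hs'
  exact ⟨s (), hSk s hs (), p, l, hl, hd⟩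

variable {ι} {F K : Type} [Field F] [Field K] [Algebra F K] [Finite F]

/-- The number of elements of a set in a torus. -/
noncomputable def torCard (D : Set (SpecialLinearGroup ι F)) (p : SpecialLinearGroup ι K) : ℕ :=
  (D ∩ torus F p).ncard

/-- The number of regular elements of a set in a torus. -/
noncomputable def regCard (D : Set (SpecialLinearGroup ι F)) (p : SpecialLinearGroup ι K) : ℕ :=
  {x ∈ D | IsReg p x}.ncard

/-- The number of singular elements of a set in a torus. -/
noncomputable def singCard (D : Set (SpecialLinearGroup ι F)) (p : SpecialLinearGroup ι K) : ℕ :=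
  {x ∈ D | x ∈ torus F p ∧ ¬ IsReg p x}.ncard

lemma torCard_le (D : Set (SpecialLinearGroup ι F)) (p : SpecialLinearGroup ι K) :
    torCard D p ≤ regCard D p + singCard D p := by
  refine (Set.ncard_le_ncard ?_).trans (Set.ncard_union_le _ _)
  rintro x ⟨hx, hxp⟩
  by_cases h : IsReg p x
  · exact Or.inl ⟨hx, h⟩
  · exact Or.inr ⟨hx, hxp, h⟩

lemma le_torCard_pow {H : Set (SpecialLinearGroup ι F)} {n k₀ N C κ : ℕ} (hN : 0 < N)
    (hs : H⁻¹ = H) {p : SpecialLinearGroup ι K} {g : SpecialLinearGroup ι F}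
    (hg : g ∈ H ^ (k₀ + k₀)) (hgp : IsReg p g) (hB : N ≤ (H ^ k₀).ncard)
    (hcls : ∀ X : Set (SpecialLinearGroup ι F), X ⊆ H ^ (k₀ + (k₀ + k₀) + k₀) →
      (∀ x ∈ X, ∃ s, x = s * g * s⁻¹) → X.ncard ^ (n + 1) ≤ C * (κ * N) ^ n) :
    N ≤ C * κ ^ n * torCard (H ^ (k₀ + k₀)) p ^ (n + 1) := by
  have hBs : (H ^ k₀)⁻¹ = H ^ k₀ := by rw [← inv_pow, hs]
  have h1 := ncard_le_inter_mul_conj (H ^ k₀) g (torus F p) fun t ht => hgp.mem_of_commute ht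
  rw [hBs, ← pow_add] at h1
  have h2 := hcls ((fun x => x * g * x⁻¹) '' (H ^ k₀)) (by
    rintro _ ⟨x, hx, rfl⟩
    exact mul_mem_pow (mul_mem_pow hx hg) (inv_mem_pow hs hx)) (by
    rintro _ ⟨x, hx, rfl⟩
    exact ⟨x, rfl⟩)
  refine le_of_mul_le_mul_right (a := N ^ n) ?_ (pow_pos hN n)
  calc N * N ^ n = N ^ (n + 1) := by ring
    _ ≤ (torCard (H ^ (k₀ + k₀)) p * ((fun x => x * g * x⁻¹) '' (H ^ k₀)).ncard) ^ (n + 1) :=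
        Nat.pow_le_pow_left (hB.trans h1) _
    _ = torCard (H ^ (k₀ + k₀)) p ^ (n + 1) *
        ((fun x => x * g * x⁻¹) '' (H ^ k₀)).ncard ^ (n + 1) := mul_pow _ _ _
    _ ≤ torCard (H ^ (k₀ + k₀)) p ^ (n + 1) * (C * (κ * N) ^ n) := Nat.mul_le_mul_left _ h2
    _ = C * κ ^ n * torCard (H ^ (k₀ + k₀)) p ^ (n + 1) * N ^ n := by rw [mul_pow]; ring

lemma torCard_le_conj {H : Set (SpecialLinearGroup ι F)} {k₀ N κ : ℕ} (hN : 0 < N)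
    (hs : H⁻¹ = H) (p : SpecialLinearGroup ι K) {x : SpecialLinearGroup ι F} (hx : x ∈ H)
    (hB : N ≤ (H ^ k₀).ncard) (hκ : (H ^ (k₀ + (1 + (k₀ + k₀) + 1))).ncard ≤ κ * N) :
    torCard (H ^ (k₀ + k₀)) p ≤ κ * torCard (H ^ (k₀ + k₀)) (emb K x * p) := by
  have hBs : (H ^ k₀)⁻¹ = H ^ k₀ := by rw [← inv_pow, hs]
  have hx1 : x ∈ H ^ 1 := by simpa using hx
  have h1 : torCard (H ^ (k₀ + k₀)) p ≤
      (H ^ (1 + (k₀ + k₀) + 1) ∩ torus F (emb K x * p) : Set _).ncard := by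
    refine Set.ncard_le_ncard_of_injOn (fun y => x * y * x⁻¹) ?_
      (fun y _ z _ h => mul_left_cancel (mul_right_cancel h))
    rintro y ⟨hy, hyp⟩
    exact ⟨mul_mem_pow (mul_mem_pow hx1 hy) (inv_mem_pow hs hx1), conj_mem_torus hyp x⟩
  have h2 := ncard_mul_inter_le (H ^ k₀) (H ^ (1 + (k₀ + k₀) + 1)) (torus F (emb K x * p))
  rw [hBs, ← pow_add, ← pow_add] at h2
  refine le_of_mul_le_mul_left (a := N) ?_ hN
  calc N * torCard (H ^ (k₀ + k₀)) p ≤ _ := Nat.mul_le_mul hB h1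
    _ ≤ _ := h2
    _ ≤ torCard (H ^ (k₀ + k₀)) (emb K x * p) * (κ * N) := Nat.mul_le_mul_left _ hκ
    _ = _ := by ring

lemma two_mul_le_of_pow_le {n N C₁ C₂ κ e s t : ℕ} (hN : 0 < N)
    (h1 : N ≤ C₁ * κ ^ e * t ^ (n + 1)) (h2 : s ^ (n + 2) ≤ C₂ * (κ * N))
    (hlarge : C₁ ^ (n + 2) * (2 ^ (n + 2) * C₂) ^ (n + 1) * κ ^ (e * (n + 2) + (n + 1)) < N) :
    2 * s ≤ t := by
  by_contra! hlt
  have h3 : t ^ (n + 2) ≤ 2 ^ (n + 2) * C₂ * κ * N := by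
    calc t ^ (n + 2) ≤ (2 * s) ^ (n + 2) := Nat.pow_le_pow_left hlt.le _
      _ = 2 ^ (n + 2) * s ^ (n + 2) := mul_pow _ _ _
      _ ≤ 2 ^ (n + 2) * (C₂ * (κ * N)) := Nat.mul_le_mul_left _ h2
      _ = _ := by ring
  refine absurd ?_ hlarge.not_ge
  refine le_of_mul_le_mul_right (a := N ^ (n + 1)) ?_ (pow_pos hN _)
  calc N * N ^ (n + 1) = N ^ (n + 2) := by ring
    _ ≤ (C₁ * κ ^ e * t ^ (n + 1)) ^ (n + 2) := Nat.pow_le_pow_left h1 _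
    _ = C₁ ^ (n + 2) * κ ^ (e * (n + 2)) * (t ^ (n + 2)) ^ (n + 1) := by
      rw [mul_pow, mul_pow, ← pow_mul, ← pow_mul, ← pow_mul, mul_comm (n + 1)]
    _ ≤ C₁ ^ (n + 2) * κ ^ (e * (n + 2)) * (2 ^ (n + 2) * C₂ * κ * N) ^ (n + 1) :=
      Nat.mul_le_mul_left _ (Nat.pow_le_pow_left h3 _)
    _ = _ := by rw [mul_pow _ N, mul_pow _ κ, pow_add κ]; ring

lemma exists_card_mul_regCard_le [Nonempty ι] (D : Set (SpecialLinearGroup ι F))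
    (p : SpecialLinearGroup ι K) : ∃ x : SpecialLinearGroup ι F,
    Nat.card (SpecialLinearGroup ι F) * regCard D (emb K x * p) ≤
      D.ncard * ((torus F p : Set (SpecialLinearGroup ι F)).ncard *
        Fintype.card ι ^ Fintype.card ι) := by
  classical
  have := Fintype.ofFinite F
  obtain ⟨x, -, hx⟩ := Finset.exists_min_image Finset.univ
    (fun x : SpecialLinearGroup ι F => regCard D (emb K x * p)) Finset.univ_nonempty
  refine ⟨x, ?_⟩
  have h1 : Nat.card (SpecialLinearGroup ι F) * regCard D (emb K x * p) ≤
      ∑ x : SpecialLinearGroup ι F, regCard D (emb K x * p) := by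
    rw [Nat.card_eq_fintype_card, ← Finset.card_univ, ← smul_eq_mul]
    exact Finset.card_nsmul_le_sum _ _ _ fun y hy => hx y hy
  refine h1.trans ?_
  have h2 : ∀ x : SpecialLinearGroup ι F, regCard D (emb K x * p) =
      (D.toFinset.bipartiteAbove (fun x r => IsReg (emb K x * p) r) x).card := by
    intro x
    rw [regCard, ← Set.ncard_coe_finset]
    congr 1
    ext r
    simp [Finset.bipartiteAbove]
  simp only [h2]
  rw [Finset.sum_card_bipartiteAbove_eq_sum_card_bipartiteBelow, Set.ncard_eq_toFinset_card']
  refine (Finset.sum_le_card_nsmul _ _ _ fun r _ => ?_)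
  refine le_trans (le_of_eq ?_) (ncard_isReg_conj_le p r)
  rw [← Set.ncard_coe_finset]
  congr 1
  ext r
  simp [Finset.bipartiteBelow]

end Pivot

section Dichotomy

variable {ι : Type} [Fintype ι] [DecidableEq ι] {F K : Type} [Field F] [Field K] [Algebra F K]

lemma ncard_torus_le [Nonempty ι] [Fintype F] (hF : Fintype.card ι < Fintype.card F)
    (p : SpecialLinearGroup ι K) : (torus F p : Set (SpecialLinearGroup ι F)).ncard ≤
      2 * Fintype.card ι * Fintype.card F ^ (Fintype.card ι - 1) := by
  have h1 := ncard_torus_mul_le hF p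
  have hn : 0 < Fintype.card ι := Fintype.card_pos
  obtain ⟨m, hm⟩ : ∃ m, Fintype.card ι = m + 1 := ⟨_, (Nat.succ_pred_eq_of_pos hn).symm⟩
  obtain ⟨q, hq⟩ : ∃ q, Fintype.card F = q + 1 :=
    ⟨_, (Nat.succ_pred_eq_of_pos (hn.trans hF)).symm⟩
  rw [hq] at hF
  rw [hm, hq, Nat.add_sub_cancel] at h1
  rw [hm, hq, Nat.add_sub_cancel]
  refine le_of_mul_le_mul_right (a := q) ?_ (by omega)
  refine h1.trans ?_
  have h2 : (q + 1) ≤ 2 * q := by omega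
  calc (m + 1) * (q + 1) ^ (m + 1) = (m + 1) * (q + 1) ^ m * (q + 1) := by ring
    _ ≤ (m + 1) * (q + 1) ^ m * (2 * q) := Nat.mul_le_mul_left _ h2
    _ = _ := by ring

/-- Every conjugate of an involved torus is involved, and involved tori are rich. -/
lemma card_pow_le_of_pivot [Fintype F] [Nonempty ι] {H : Set (SpecialLinearGroup ι F)}
    {n k₀ N C₁ C₂ κ : ℕ} (hN : 0 < N) (hn : n = Fintype.card ι)
    (hs : H⁻¹ = H) (h1 : 1 ∈ H) (hcl : Subgroup.closure H = ⊤)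
    (hF : n < Fintype.card F)
    (hB : N ≤ (H ^ k₀).ncard) (hD : (H ^ (k₀ + k₀)).ncard ≤ κ * N)
    (hκ : (H ^ (k₀ + (1 + (k₀ + k₀) + 1))).ncard ≤ κ * N)
    (hcls : ∀ (p : SpecialLinearGroup ι K) (g : SpecialLinearGroup ι F), IsReg p g →
      ∀ X : Set (SpecialLinearGroup ι F), X ⊆ H ^ (k₀ + (k₀ + k₀) + k₀) →
      (∀ x ∈ X, ∃ s, x = s * g * s⁻¹) → X.ncard ^ (n + 1) ≤ C₁ * (κ * N) ^ n)
    (hsing : ∀ p : SpecialLinearGroup ι K, singCard (H ^ (k₀ + k₀)) p ^ (n + 2) ≤ C₂ * (κ * N))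
    {p : SpecialLinearGroup ι K} (hp : ∃ g ∈ H ^ (k₀ + k₀), IsReg p g)
    (hlarge : C₁ ^ (n + 2) * (2 ^ (n + 2) * C₂) ^ (n + 1) *
      κ ^ ((2 * n + 1) * (n + 2) + (n + 1)) < N) :
    Nat.card (SpecialLinearGroup ι F) ^ (n + 1) ≤
      C₁ * (4 * n * n ^ n) ^ (n + 1) * κ ^ (3 * n + 2) *
        Fintype.card F ^ ((n - 1) * (n + 1)) * N ^ n := by
  have hκ0 : 0 < κ := by
    rcases Nat.eq_zero_or_pos κ with rfl | h
    · rw [zero_mul] at hD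
      have : 1 ∈ H ^ (k₀ + k₀) := Set.one_mem_pow h1
      have h2 := (Set.ncard_pos (Set.toFinite _)).2 ⟨1, this⟩
      omega
    · exact h
  have hinv : ∀ p : SpecialLinearGroup ι K, (∃ g ∈ H ^ (k₀ + k₀), IsReg p g) →
      N ≤ C₁ * κ ^ n * torCard (H ^ (k₀ + k₀)) p ^ (n + 1) := fun p ⟨g, hg, hgp⟩ =>
    le_torCard_pow hN hs hg hgp hB (hcls p g hgp)
  have hreg : ∀ p : SpecialLinearGroup ι K,
      N ≤ C₁ * κ ^ (2 * n + 1) * torCard (H ^ (k₀ + k₀)) p ^ (n + 1) →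
      torCard (H ^ (k₀ + k₀)) p ≤ 2 * regCard (H ^ (k₀ + k₀)) p := fun p h => by
    have h2 := two_mul_le_of_pow_le hN h (hsing p) hlarge
    have h3 := torCard_le (H ^ (k₀ + k₀)) p
    omega
  have hstep : ∀ p : SpecialLinearGroup ι K, (∃ g ∈ H ^ (k₀ + k₀), IsReg p g) → ∀ x ∈ H,
      ∃ g ∈ H ^ (k₀ + k₀), IsReg (emb K x * p) g := by
    intro p hp x hx
    have h2 : N ≤ C₁ * κ ^ (2 * n + 1) * torCard (H ^ (k₀ + k₀)) (emb K x * p) ^ (n + 1) := by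
      calc N ≤ _ := hinv p hp
        _ ≤ C₁ * κ ^ n * (κ * torCard (H ^ (k₀ + k₀)) (emb K x * p)) ^ (n + 1) :=
          Nat.mul_le_mul_left _ (Nat.pow_le_pow_left (torCard_le_conj hN hs p hx hB hκ) _)
        _ = _ := by rw [mul_pow]; ring
    have h3 := hreg _ h2
    have h4 : 0 < torCard (H ^ (k₀ + k₀)) (emb K x * p) := by
      refine (Set.ncard_pos (Set.toFinite _)).2 ⟨1, Set.one_mem_pow h1, Subgroup.one_mem _⟩
    have h5 : 0 < regCard (H ^ (k₀ + k₀)) (emb K x * p) := by omega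
    obtain ⟨g, hg⟩ := (Set.ncard_pos (Set.toFinite _)).1 h5
    exact ⟨g, hg.1, hg.2⟩
  have hall : ∀ x : SpecialLinearGroup ι F, ∃ g ∈ H ^ (k₀ + k₀), IsReg (emb K x * p) g := by
    intro x
    have hx : x ∈ Subgroup.closure H := by rw [hcl]; trivial
    induction hx using Subgroup.closure_induction_left with
    | one => simpa using hp
    | mul_left x hx y _ hy =>
      rw [map_mul, mul_assoc]
      exact hstep _ hy x hx
    | inv_mul_cancel x hx y _ hy =>
      rw [map_mul, mul_assoc]
      exact hstep _ hy _ (by rw [← hs]; simpa using hx)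
  obtain ⟨x, hx⟩ := exists_card_mul_regCard_le (H ^ (k₀ + k₀)) p
  have h2 : N ≤ C₁ * κ ^ (2 * n + 1) * torCard (H ^ (k₀ + k₀)) (emb K x * p) ^ (n + 1) := by
    refine (hinv _ (hall x)).trans ?_
    exact Nat.mul_le_mul_right _ (Nat.mul_le_mul_left _ (Nat.pow_le_pow_right hκ0 (by omega)))
  have h3 := hreg _ h2
  rw [← hn] at hx
  have hT := ncard_torus_le (hn ▸ hF) p
  rw [← hn] at hT
  set r := regCard (H ^ (k₀ + k₀)) (emb K x * p)
  set g := Nat.card (SpecialLinearGroup ι F)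
  set q := Fintype.card F
  refine le_of_mul_le_mul_right (a := N) ?_ hN
  calc g ^ (n + 1) * N ≤ g ^ (n + 1) * (C₁ * κ ^ (2 * n + 1) * (2 * r) ^ (n + 1)) :=
        Nat.mul_le_mul_left _ (h2.trans (Nat.mul_le_mul_left _ (Nat.pow_le_pow_left h3 _)))
    _ = C₁ * κ ^ (2 * n + 1) * (2 * (g * r)) ^ (n + 1) := by rw [mul_pow, mul_pow, mul_pow]; ring
    _ ≤ C₁ * κ ^ (2 * n + 1) * (2 * (κ * N * (2 * n * q ^ (n - 1) * n ^ n))) ^ (n + 1) := by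
        refine Nat.mul_le_mul_left _ (Nat.pow_le_pow_left (Nat.mul_le_mul_left _ (hx.trans ?_)) _)
        exact Nat.mul_le_mul hD (Nat.mul_le_mul_right _ hT)
    _ = C₁ * κ ^ (2 * n + 1) * (4 * n * n ^ n * κ * N * q ^ (n - 1)) ^ (n + 1) := by
        congr 2; ring
    _ = _ := by
        rw [mul_pow _ (q ^ _), ← pow_mul, mul_pow _ N, mul_pow _ κ]
        ring

variable (ι) in
theorem exists_pivot_dichotomy [Nontrivial ι] : ∃ k C Q : ℕ, ∀ (F : Type) [Field F] [Fintype F],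
    Q < Fintype.card F → ∀ H : Set (SpecialLinearGroup ι F), 1 ∈ H → H⁻¹ = H →
    Subgroup.closure H = ⊤ → ∀ κ : ℕ, (H ^ k).ncard ≤ κ * H.ncard →
    H.ncard ≤ C * κ ^ C ∨
    Nat.card (SpecialLinearGroup ι F) ^ (Fintype.card ι + 1) ≤
      C * κ ^ C * Fintype.card F ^ ((Fintype.card ι - 1) * (Fintype.card ι + 1)) *
        H.ncard ^ Fintype.card ι := by
  obtain ⟨k₁, Q₁, hreg⟩ := exists_isReg ι
  obtain ⟨k₂, C₁, Q₂, hE1⟩ := exists_class_bound ι ((k₁ + 1) + ((k₁ + 1) + (k₁ + 1)) + (k₁ + 1))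
  obtain ⟨k₃, C₂, Q₃, hE2⟩ := exists_singular_bound ι ((k₁ + 1) + (k₁ + 1))
  set k₀ := k₁ + 1 with hk₀
  set n := Fintype.card ι with hn
  set c₁ := C₁ ^ (n + 2) * (2 ^ (n + 2) * C₂) ^ (n + 1)
  set e₁ := (2 * n + 1) * (n + 2) + (n + 1)
  set c₂ := C₁ * (4 * n * n ^ n) ^ (n + 1)
  set e₂ := 3 * n + 2
  refine ⟨k₂ + k₃ + 4 * k₀ + 2, c₁ + c₂ + e₁ + e₂, Q₁ + Q₂ + Q₃ + n, ?_⟩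
  intro F _ _ hQ H h1 hs hcl κ hk
  have hN : 0 < H.ncard := (Set.ncard_pos (Set.toFinite _)).2 ⟨1, h1⟩
  have hκN : ∀ j ≤ k₂ + k₃ + 4 * k₀ + 2, (H ^ j).ncard ≤ κ * H.ncard := fun j hj =>
    (ncard_pow_le h1 hj).trans hk
  have hκ0 : 0 < κ := by
    rcases Nat.eq_zero_or_pos κ with rfl | h
    · have h2 := hκN 1 (by omega)
      rw [pow_one] at h2
      omega
    · exact h
  have hB : H.ncard ≤ (H ^ k₀).ncard := by
    simpa using ncard_pow_le h1 (show 1 ≤ k₀ by omega)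
  obtain ⟨g, hg, p, hgp⟩ := hreg F (by omega) H h1 hcl
  by_cases hlarge : c₁ * κ ^ e₁ < H.ncard
  · right
    refine (card_pow_le_of_pivot (C₁ := C₁) (C₂ := C₂) (k₀ := k₀) hN hn hs h1 hcl (by omega) hB
      (hκN _ (by omega)) (hκN _ (by omega)) ?_ ?_
      ⟨g, Set.pow_subset_pow_right h1 (by omega) hg, hgp⟩ hlarge).trans ?_
    · rintro p g ⟨l, hl, hd⟩ X hX hXg
      classical
      have h2 := hE1 F (AlgebraicClosure F) (by omega) H h1 hs hcl l hl X.toFinset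
        (fun x hx => hX (by simpa using hx)) (fun x hx => by
          obtain ⟨s, rfl⟩ := hXg x (by simpa using hx)
          refine ⟨emb _ s * p, ?_⟩
          have h3 := hd.conj (emb _ s)
          simpa [mat_mul, map_mul, map_inv] using h3)
      rw [Set.ncard_eq_toFinset_card']
      exact h2.trans (Nat.mul_le_mul_left _ (Nat.pow_le_pow_left (hκN _ (by omega)) _))
    · intro p
      classical
      have h2 := hE2 F (AlgebraicClosure F) (by omega) H h1 hcl p
        {x ∈ H ^ (k₀ + k₀) | x ∈ torus F p ∧ ¬ IsReg p x}.toFinset (fun x hx => by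
          obtain ⟨hx1, ⟨l, hl⟩, hx2⟩ := Set.mem_toFinset.1 hx
          exact ⟨hx1, l, fun h => hx2 ⟨l, h, hl⟩, hl⟩)
      rw [singCard, Set.ncard_eq_toFinset_card']
      exact h2.trans (Nat.mul_le_mul_left _ (hκN _ (by omega)))
    · refine Nat.mul_le_mul_right _ (Nat.mul_le_mul_right _ ?_)
      exact Nat.mul_le_mul (by omega) (Nat.pow_le_pow_right hκ0 (by omega))
  · left
    exact (not_lt.1 hlarge).trans (Nat.mul_le_mul (by omega) (Nat.pow_le_pow_right hκ0 (by omega)))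

end Dichotomy

section Extremal

variable {V : Type} [NormedAddCommGroup V] [InnerProductSpace ℂ V] [FiniteDimensional ℂ V]

/-- The vectors of a subspace which are stretched maximally by an operator form a subspace. -/
lemma exists_extremal_submodule (W : Submodule ℂ V) (hW : W ≠ ⊥) (M : V →ₗ[ℂ] V) :
    ∃ (l : ℝ) (E : Submodule ℂ V), 0 ≤ l ∧ (∀ f ∈ W, ‖M f‖ ^ 2 ≤ l * ‖f‖ ^ 2) ∧ E ≠ ⊥ ∧
      ∀ f, f ∈ E ↔ f ∈ W ∧ ‖M f‖ ^ 2 = l * ‖f‖ ^ 2 := by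
  have : ProperSpace V := FiniteDimensional.proper ℂ V
  have hcomp : IsCompact (Metric.sphere (0 : V) 1 ∩ W) :=
    (isCompact_sphere 0 1).inter_right W.closed_of_finiteDimensional
  have hscale : ∀ f : V, f ≠ 0 → f ∈ W → ((‖f‖⁻¹ : ℝ) : ℂ) • f ∈ Metric.sphere (0 : V) 1 ∩ W := by
    intro f hf hfW
    refine ⟨?_, W.smul_mem _ hfW⟩
    rw [mem_sphere_zero_iff_norm, norm_smul, Complex.norm_real, norm_inv, norm_norm,
      inv_mul_cancel₀ (norm_ne_zero_iff.2 hf)]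
  obtain ⟨w, hwW, hw0⟩ := W.exists_mem_ne_zero_of_ne_bot hW
  obtain ⟨f₀, hf₀, hmax⟩ := hcomp.exists_isMaxOn ⟨_, hscale w hw0 hwW⟩
    (f := fun f => ‖M f‖ ^ 2) (by
      have := M.continuous_of_finiteDimensional
      fun_prop)
  set l := ‖M f₀‖ ^ 2 with hl
  have hle : ∀ f ∈ W, ‖M f‖ ^ 2 ≤ l * ‖f‖ ^ 2 := by
    intro f hf
    rcases eq_or_ne f 0 with rfl | h0
    · simp
    · have h1 : ‖M (((‖f‖⁻¹ : ℝ) : ℂ) • f)‖ ^ 2 ≤ l := hmax (hscale f h0 hf)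
      have h2 : 0 < ‖f‖ := norm_pos_iff.2 h0
      rw [map_smul, norm_smul, Complex.norm_real, norm_inv, norm_norm, mul_pow, inv_pow,
        inv_mul_le_iff₀ (by positivity)] at h1
      linarith
  have hpar : ∀ f g : V, ‖f + g‖ ^ 2 + ‖f - g‖ ^ 2 = 2 * (‖f‖ ^ 2 + ‖g‖ ^ 2) := fun f g => by
    have := parallelogram_law_with_norm ℂ f g
    nlinarith
  refine ⟨l, ⟨⟨⟨{f | f ∈ W ∧ ‖M f‖ ^ 2 = l * ‖f‖ ^ 2}, ?_⟩, ?_⟩, ?_⟩, by positivity, hle, ?_,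
    fun f => Iff.rfl⟩
  · rintro f g ⟨hf, hf'⟩ ⟨hg, hg'⟩
    refine ⟨W.add_mem hf hg, le_antisymm (hle _ (W.add_mem hf hg)) ?_⟩
    have h1 := hpar f g
    have h2 := hpar (M f) (M g)
    have h3 := hle _ (W.sub_mem hf hg)
    rw [← map_add, ← map_sub] at h2
    have h4 : l * ‖f + g‖ ^ 2 + l * ‖f - g‖ ^ 2 = 2 * (l * ‖f‖ ^ 2 + l * ‖g‖ ^ 2) := by
      rw [← mul_add, h1]; ring
    linarith
  · exact ⟨W.zero_mem, by simp⟩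
  · rintro c f ⟨hf, hf'⟩
    refine ⟨W.smul_mem c hf, ?_⟩
    rw [map_smul, norm_smul, norm_smul, mul_pow, mul_pow, hf']
    ring
  · intro h
    have h1 : f₀ ∈ (⊥ : Submodule ℂ V) := by
      rw [← h]
      refine ⟨hf₀.2, ?_⟩
      rw [mem_sphere_zero_iff_norm.1 hf₀.1]
      simp [hl]
    have h2 := mem_sphere_zero_iff_norm.1 hf₀.1
    rw [(Submodule.mem_bot ℂ).1 h1] at h2
    simp at h2

end Extremal

section Gowers

variable {G : Type} [Group G] [Fintype G]

/-- Left translation of functions on a finite group. -/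
noncomputable def leftTranslate (x : G) : EuclideanSpace ℂ G →ₗ[ℂ] EuclideanSpace ℂ G where
  toFun f := WithLp.toLp 2 fun g => f (x⁻¹ * g)
  map_add' f g := by ext; simp
  map_smul' c f := by ext; simp

@[simp] lemma leftTranslate_apply (x : G) (f : EuclideanSpace ℂ G) (g : G) :
    leftTranslate x f g = f (x⁻¹ * g) := rfl

lemma leftTranslate_mul (x y : G) (f : EuclideanSpace ℂ G) :
    leftTranslate (x * y) f = leftTranslate x (leftTranslate y f) := by
  ext g
  simp [mul_assoc]

lemma leftTranslate_one (f : EuclideanSpace ℂ G) : leftTranslate (1 : G) f = f := by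
  ext g
  simp

lemma inner_leftTranslate (x : G) (f h : EuclideanSpace ℂ G) :
    inner ℂ (leftTranslate x f) (leftTranslate x h) = inner ℂ f h := by
  rw [PiLp.inner_apply, PiLp.inner_apply]
  exact Fintype.sum_equiv (Equiv.mulLeft x⁻¹) _ _ fun g => rfl

lemma norm_leftTranslate (x : G) (f : EuclideanSpace ℂ G) : ‖leftTranslate x f‖ = ‖f‖ := by
  rw [@norm_eq_sqrt_re_inner ℂ, inner_leftTranslate, ← @norm_eq_sqrt_re_inner ℂ]

/-- Averaging over right translates by a finite set. -/
noncomputable def rightSum (B : Finset G) : EuclideanSpace ℂ G →ₗ[ℂ] EuclideanSpace ℂ G where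
  toFun f := WithLp.toLp 2 fun g => ∑ b ∈ B, f (g * b)
  map_add' f g := by ext; simp [Finset.sum_add_distrib]
  map_smul' c f := by ext; simp [Finset.mul_sum]

@[simp] lemma rightSum_apply (B : Finset G) (f : EuclideanSpace ℂ G) (g : G) :
    rightSum B f g = ∑ b ∈ B, f (g * b) := rfl

lemma rightSum_leftTranslate (B : Finset G) (x : G) (f : EuclideanSpace ℂ G) :
    rightSum B (leftTranslate x f) = leftTranslate x (rightSum B f) := by
  ext g
  simp [mul_assoc]

lemma sum_norm_rightSum_le (B : Finset G) {κ : Type} [Fintype κ] (v : κ → EuclideanSpace ℂ G)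
    (hv : Orthonormal ℂ v) :
    ∑ i, ‖rightSum B (v i)‖ ^ 2 ≤ Fintype.card G * B.card := by
  classical
  set row : G → EuclideanSpace ℂ G := fun g => WithLp.toLp 2 fun x => if g⁻¹ * x ∈ B then 1 else 0
    with hrow
  have h1 : ∀ g (f : EuclideanSpace ℂ G), rightSum B f g = inner ℂ (row g) f := by
    intro g f
    rw [PiLp.inner_apply, rightSum_apply]
    rw [← Fintype.sum_equiv (Equiv.mulLeft g)
      (fun b => if b ∈ B then f (g * b) else 0) _
      (fun b => by by_cases h : b ∈ B <;> simp [hrow, h])]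
    simp
  have h2 : ∀ g, ‖row g‖ ^ 2 = B.card := by
    intro g
    rw [EuclideanSpace.norm_sq_eq]
    rw [← Fintype.sum_equiv (Equiv.mulLeft g)
      (fun b => if b ∈ B then (1 : ℝ) else 0) _
      (fun b => by by_cases h : b ∈ B <;> simp [hrow, h])]
    simp
  calc ∑ i, ‖rightSum B (v i)‖ ^ 2 = ∑ g, ∑ i, ‖inner ℂ (v i) (row g)‖ ^ 2 := by
        rw [Finset.sum_comm]
        refine Finset.sum_congr rfl fun i _ => ?_
        rw [EuclideanSpace.norm_sq_eq]
        refine Finset.sum_congr rfl fun g _ => ?_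
        rw [h1, norm_inner_symm]
    _ ≤ ∑ g : G, ‖row g‖ ^ 2 := Finset.sum_le_sum fun g _ => hv.sum_inner_products_le _
    _ = _ := by simp [h2]

variable (G) in
/-- Every nonzero translation-invariant space of functions of mean zero contains an orthonormal
family with at least `m` elements. -/
def IsQuasirandom (m : ℕ) : Prop :=
  ∀ E : Submodule ℂ (EuclideanSpace ℂ G), E ≠ ⊥ → (∀ f ∈ E, ∑ g, f g = 0) →
    (∀ x, ∀ f ∈ E, leftTranslate x f ∈ E) →
    ∃ (κ : Type) (_ : Fintype κ) (v : κ → EuclideanSpace ℂ G),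
      m ≤ Fintype.card κ ∧ Orthonormal ℂ v ∧ ∀ i, v i ∈ E

/-- The functions of mean zero. -/
def meanZero (G : Type) [Fintype G] : Submodule ℂ (EuclideanSpace ℂ G) where
  carrier := {f | ∑ g, f g = 0}
  add_mem' {f h} hf hh := by
    have h1 : ∑ g, f g = 0 := hf
    have h2 : ∑ g, h g = 0 := hh
    simp [Finset.sum_add_distrib, h1, h2]
  zero_mem' := by simp
  smul_mem' c f hf := by
    have h1 : ∑ g, f g = 0 := hf
    simp [← Finset.mul_sum, h1]

lemma IsQuasirandom.norm_rightSum_le {m : ℕ} (hG : IsQuasirandom G m) (B : Finset G)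
    {f : EuclideanSpace ℂ G} (hf : f ∈ meanZero G) :
    m * ‖rightSum B f‖ ^ 2 ≤ Fintype.card G * B.card * ‖f‖ ^ 2 := by
  by_cases hW : meanZero G = ⊥
  · rw [hW, Submodule.mem_bot] at hf
    simp [hf]
  obtain ⟨l, E, hl, hle, hE, hEm⟩ := exists_extremal_submodule (meanZero G) hW (rightSum B)
  obtain ⟨κ, _, v, hm, hv, hvE⟩ := hG E hE (fun f hf => ((hEm f).1 hf).1) (by
    intro x f hf
    obtain ⟨h1, h2⟩ := (hEm f).1 hf
    refine (hEm _).2 ⟨?_, ?_⟩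
    · change ∑ g, _ = _
      rw [← show ∑ g, f g = 0 from h1]
      exact Fintype.sum_equiv (Equiv.mulLeft x⁻¹) _ _ fun g => rfl
    · rw [rightSum_leftTranslate, norm_leftTranslate, norm_leftTranslate, h2])
  have h1 := sum_norm_rightSum_le B v hv
  have h2 : ∀ i, ‖rightSum B (v i)‖ ^ 2 = l := fun i => by
    rw [((hEm _).1 (hvE i)).2, hv.1 i]; simp
  simp only [h2, Finset.sum_const, Finset.card_univ, nsmul_eq_mul] at h1
  have h3 : (m : ℝ) ≤ Fintype.card κ := by exact_mod_cast hm
  calc m * ‖rightSum B f‖ ^ 2 ≤ m * (l * ‖f‖ ^ 2) := by gcongr; exact hle f hf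
    _ = (m * l) * ‖f‖ ^ 2 := by ring
    _ ≤ _ := mul_le_mul_of_nonneg_right ((mul_le_mul_of_nonneg_right h3 hl).trans h1)
      (by positivity)

theorem IsQuasirandom.mul_mul_eq_univ {m : ℕ} (hG : IsQuasirandom G m) (B : Set G)
    (hB : Nat.card G ^ 3 < m * B.ncard ^ 3) : B * B * B = Set.univ := by
  classical
  refine Set.eq_univ_of_forall fun g => ?_
  by_contra hg
  rw [Nat.card_eq_fintype_card, Set.ncard_eq_toFinset_card'] at hB
  set S := B.toFinset with hS
  have hmem : ∀ x, x ∈ S ↔ x ∈ B := fun x => Set.mem_toFinset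
  set N : ℝ := (Fintype.card G : ℝ)
  have hN : 0 < N := by
    have : 0 < Fintype.card G := Fintype.card_pos
    exact Nat.cast_pos.2 this
  set b : ℝ := (S.card : ℝ) with hb
  have hb0 : 0 < b := by
    have : 0 < S.card := by
      by_contra! h
      rw [Nat.le_zero.1 h] at hB
      simp at hB
    exact Nat.cast_pos.2 this
  set χ : G → ℝ := fun x => if x⁻¹ * g ∈ S then 1 else 0 with hχ
  have hsum : ∑ x, χ x = b := by
    rw [← Fintype.sum_equiv ((Equiv.inv G).trans (Equiv.mulLeft g))
      (fun b => if b ∈ S then (1 : ℝ) else 0) _ (fun b => by simp [hχ])]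
    simp [hb]
  set f : EuclideanSpace ℂ G := WithLp.toLp 2 fun x => ((χ x - b / N : ℝ) : ℂ) with hf
  have hfm : f ∈ meanZero G := by
    change ∑ x, ((χ x - b / N : ℝ) : ℂ) = 0
    rw [← Complex.ofReal_sum, Finset.sum_sub_distrib, hsum]
    simp only [Finset.sum_const, Finset.card_univ, nsmul_eq_mul]
    rw [mul_div_cancel₀ _ hN.ne', sub_self, Complex.ofReal_zero]
  have hfn : ‖f‖ ^ 2 ≤ b := by
    rw [EuclideanSpace.norm_sq_eq]
    have h1 : ∀ x, ‖f x‖ ^ 2 = (1 - 2 * (b / N)) * χ x + (b / N) ^ 2 := by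
      intro x
      have h2 : f x = ((χ x - b / N : ℝ) : ℂ) := rfl
      rw [h2, Complex.norm_real, Real.norm_eq_abs, sq_abs]
      have h3 : χ x ^ 2 = χ x := by simp [hχ]
      linear_combination h3
    simp only [h1, Finset.sum_add_distrib, ← Finset.mul_sum, hsum, Finset.sum_const,
      Finset.card_univ, nsmul_eq_mul]
    have h4 : N * (b / N) ^ 2 = b * (b / N) := by field_simp
    change (1 - 2 * (b / N)) * b + N * (b / N) ^ 2 ≤ b
    rw [h4]
    have : 0 ≤ b * (b / N) := by positivity
    linarith
  have hval : ∀ x ∈ S, ‖rightSum S f x‖ ^ 2 = (b ^ 2 / N) ^ 2 := by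
    intro x hx
    have h1 : rightSum S f x = ((-(b ^ 2 / N) : ℝ) : ℂ) := by
      rw [rightSum_apply]
      have h2 : ∀ y ∈ S, f (x * y) = ((-(b / N) : ℝ) : ℂ) := by
        intro y hy
        have h3 : χ (x * y) = 0 := by
          refine if_neg fun h => hg ?_
          have h4 : g = x * y * ((x * y)⁻¹ * g) := by group
          rw [h4]
          exact Set.mul_mem_mul (Set.mul_mem_mul ((hmem x).1 hx) ((hmem y).1 hy)) ((hmem _).1 h)
        change ((χ (x * y) - b / N : ℝ) : ℂ) = _
        rw [h3, zero_sub]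
      rw [Finset.sum_congr rfl h2, Finset.sum_const, nsmul_eq_mul]
      push_cast
      rw [show ((S.card : ℕ) : ℂ) = ((b : ℝ) : ℂ) by simp [hb]]
      ring
    rw [h1, Complex.norm_real, Real.norm_eq_abs, sq_abs, neg_sq]
  have hlow : b * (b ^ 2 / N) ^ 2 ≤ ‖rightSum S f‖ ^ 2 := by
    rw [EuclideanSpace.norm_sq_eq]
    calc b * (b ^ 2 / N) ^ 2 = ∑ x ∈ S, ‖rightSum S f x‖ ^ 2 := by
          rw [Finset.sum_congr rfl hval, Finset.sum_const, nsmul_eq_mul]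
      _ ≤ _ := Finset.sum_le_univ_sum_of_nonneg fun _ => by positivity
  have h1 := hG.norm_rightSum_le S hfm
  have h2 : (m : ℝ) * (b * (b ^ 2 / N) ^ 2) ≤ N * b * b :=
    (mul_le_mul_of_nonneg_left hlow (by positivity)).trans
      (h1.trans (mul_le_mul_of_nonneg_left hfn (by positivity)))
  have h3 : (m : ℝ) * b ^ 3 ≤ N ^ 3 := by
    have h4 : (m : ℝ) * (b * (b ^ 2 / N) ^ 2) = m * b ^ 3 * (b ^ 2 / N ^ 2) := by ring
    have h5 : N * b * b = N ^ 3 * (b ^ 2 / N ^ 2) := by field_simp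
    rw [h4, h5] at h2
    exact le_of_mul_le_mul_right h2 (by positivity)
  have h4 : N ^ 3 < (m : ℝ) * b ^ 3 := by
    have h5 : (Fintype.card G : ℝ) ^ 3 < m * (S.card : ℝ) ^ 3 := by exact_mod_cast hB
    exact h5
  linarith

end Gowers

section Transvections

variable {ι : Type} [Fintype ι] [DecidableEq ι] {F : Type} [Field F]

lemma transvection_add {i j : ι} (hij : i ≠ j) (s t : F) :
    SpecialLinearGroup.transvection hij (s + t) =
      SpecialLinearGroup.transvection hij s * SpecialLinearGroup.transvection hij t := by
  apply mat_injective
  rw [mat_mul, mat_transvection, mat_transvection, mat_transvection, Matrix.mul_add, Matrix.mul_one,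
    Matrix.add_mul, Matrix.one_mul, single_mul_single_of_ne _ _ _ _ hij.symm, single_add]
  abel

lemma transvection_zero {i j : ι} (hij : i ≠ j) :
    SpecialLinearGroup.transvection hij (0 : F) = 1 := by
  apply mat_injective
  rw [mat_transvection, single_zero, add_zero, mat_one]

lemma transvection_mul_diag2n {i j : ι} (hij : i ≠ j) (s a : F) (ha : a ≠ 0) :
    SpecialLinearGroup.transvection hij (a * a * s) * SpecialLinearGroup.diag2n hij a ha =
      SpecialLinearGroup.diag2n hij a ha * SpecialLinearGroup.transvection hij s := by
  apply mat_injective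
  have hd : mat (SpecialLinearGroup.diag2n hij a ha) =
    diagonal (fun k => if k = i then a else if k = j then a⁻¹ else 1) := rfl
  rw [mat_mul, mat_mul, mat_transvection, mat_transvection, hd]
  refine Matrix.ext fun k l => ?_
  rw [mul_diagonal, diagonal_mul, Matrix.add_apply, Matrix.add_apply, single_apply, single_apply,
    one_apply]
  by_cases hk : i = k
  · subst hk
    by_cases hl : j = l
    · subst hl
      have := hij.symm
      simp [hij, this]
      field_simp
    · simp [hl]
      by_cases hkl : i = l <;> simp [hkl]
  · simp [hk]
    by_cases hkl : k = l <;> simp [hkl]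

end Transvections

section Quasirandom

variable {ι : Type} [Fintype ι] [DecidableEq ι] [Nontrivial ι] {F : Type} [Field F] [Fintype F]

/-- The component of a function on which a root subgroup acts by a character. -/
noncomputable def charPart [Fintype (SpecialLinearGroup ι F)] {i j : ι} (hij : i ≠ j)
    (ψ : AddChar F ℂ) (f : EuclideanSpace ℂ (SpecialLinearGroup ι F)) :
    EuclideanSpace ℂ (SpecialLinearGroup ι F) :=
  ∑ t, ψ (-t) • leftTranslate (SpecialLinearGroup.transvection hij t) f

variable [Fintype (SpecialLinearGroup ι F)]

lemma leftTranslate_charPart {i j : ι} (hij : i ≠ j) (ψ : AddChar F ℂ)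
    (f : EuclideanSpace ℂ (SpecialLinearGroup ι F)) (s : F) :
    leftTranslate (SpecialLinearGroup.transvection hij s) (charPart hij ψ f) =
      ψ s • charPart hij ψ f := by
  rw [charPart, map_sum, Finset.smul_sum]
  refine Fintype.sum_equiv (Equiv.addLeft s) _ _ fun t => ?_
  rw [map_smul, ← leftTranslate_mul, ← transvection_add, smul_smul]
  change _ = (ψ s * ψ (-(s + t))) • leftTranslate (SpecialLinearGroup.transvection hij (s + t)) f
  rw [← AddChar.map_add_eq_mul]
  congr 2
  ring

lemma sum_charPart [DecidableEq F] {i j : ι} (hij : i ≠ j)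
    (f : EuclideanSpace ℂ (SpecialLinearGroup ι F)) :
    ∑ ψ : AddChar F ℂ, charPart hij ψ f = (Fintype.card F : ℂ) • f := by
  simp only [charPart]
  rw [Finset.sum_comm]
  simp only [← Finset.sum_smul, AddChar.sum_apply_eq_ite, neg_eq_zero]
  rw [Finset.sum_eq_single 0]
  · rw [if_pos rfl, transvection_zero, leftTranslate_one]
  · intro b _ hb
    rw [if_neg hb, zero_smul]
  · simp

lemma exists_char_eigenvector {E : Submodule ℂ (EuclideanSpace ℂ (SpecialLinearGroup ι F))}
    (hE : E ≠ ⊥) (h0 : ∀ f ∈ E, ∑ g, f g = 0) (hinv : ∀ x, ∀ f ∈ E, leftTranslate x f ∈ E) :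
    ∃ (i j : ι) (hij : i ≠ j) (ψ : AddChar F ℂ) (f : _), ψ ≠ 1 ∧ f ∈ E ∧ f ≠ 0 ∧
      ∀ s, leftTranslate (SpecialLinearGroup.transvection hij s) f = ψ s • f := by
  classical
  by_contra! hcon
  obtain ⟨f, hfE, hf0⟩ := E.exists_mem_ne_zero_of_ne_bot hE
  have hzero : ∀ {i j : ι} (hij : i ≠ j) (ψ : AddChar F ℂ), ψ ≠ 1 → charPart hij ψ f = 0 := by
    intro i j hij ψ hψ
    by_contra hne
    obtain ⟨s, hs⟩ := hcon i j hij ψ _ hψ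
      (E.sum_mem fun t _ => E.smul_mem _ (hinv _ _ hfE)) hne
    exact hs (leftTranslate_charPart hij ψ f s)
  have hfix : ∀ {i j : ι} (hij : i ≠ j) (s : F),
      leftTranslate (SpecialLinearGroup.transvection hij s) f = f := by
    intro i j hij s
    have h1 := sum_charPart hij f
    rw [Finset.sum_eq_single 1 (fun ψ _ hψ => hzero hij ψ hψ) (by simp)] at h1
    have h2 := leftTranslate_charPart hij 1 f s
    rw [h1, map_smul, AddChar.one_apply, one_smul] at h2
    exact smul_right_injective _ (by simp : (Fintype.card F : ℂ) ≠ 0) h2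
  have hall : ∀ x : SpecialLinearGroup ι F, leftTranslate x f = f := by
    intro x
    refine mem_of_transvection_mem (⟨⟨{x | leftTranslate x f = f}, ?_⟩, ?_⟩ : Submonoid _)
      (fun i j hij t => hfix hij t) x
    · intro a b ha hb
      have ha' : leftTranslate a f = f := ha
      have hb' : leftTranslate b f = f := hb
      change leftTranslate (a * b) f = f
      rw [leftTranslate_mul, hb', ha']
    · exact leftTranslate_one f
  have hconst : ∀ x, f x = f 1 := by
    intro x
    have h1 := congrArg (fun h : EuclideanSpace ℂ (SpecialLinearGroup ι F) => h x) (hall x)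
    simpa using h1.symm
  refine hf0 ?_
  have h1 := h0 f hfE
  simp only [hconst, Finset.sum_const, Finset.card_univ, nsmul_eq_mul, mul_eq_zero,
    Nat.cast_eq_zero, Fintype.card_ne_zero, false_or] at h1
  ext x
  rw [hconst, h1]
  rfl

theorem isQuasirandom_specialLinearGroup :
    IsQuasirandom (SpecialLinearGroup ι F) ((Fintype.card F - 1) / 2) := by
  classical
  intro E hE h0 hinv
  obtain ⟨i, j, hij, ψ, f, hψ, hfE, hf0, hf⟩ := exists_char_eigenvector hE h0 hinv
  set S : Finset F := (Finset.univ.erase 0).image fun a => a * a with hS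
  have hcard : Fintype.card F - 1 ≤ 2 * S.card := by
    rw [← Finset.card_univ, ← Finset.card_erase_of_mem (Finset.mem_univ (0 : F))]
    refine Finset.card_le_mul_card_image _ _ fun b hb => ?_
    obtain ⟨a, -, rfl⟩ := Finset.mem_image.1 hb
    refine (Finset.card_le_card (t := {a, -a}) fun y hy => ?_).trans Finset.card_le_two
    have h1 := (Finset.mem_filter.1 hy).2
    simpa using mul_self_eq_mul_self_iff.1 h1
  have hroot : ∀ c : S, ∃ a : F, a ≠ 0 ∧ a * a = c := by
    rintro ⟨c, hc⟩
    obtain ⟨a, ha, rfl⟩ := Finset.mem_image.1 hc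
    exact ⟨a, (Finset.mem_erase.1 ha).1, rfl⟩
  choose a ha hac using hroot
  set v : S → EuclideanSpace ℂ (SpecialLinearGroup ι F) := fun c =>
    ((‖f‖⁻¹ : ℝ) : ℂ) • leftTranslate (SpecialLinearGroup.diag2n hij (a c) (ha c)) f with hv
  have hvt : ∀ (c : S) (s : F), leftTranslate (SpecialLinearGroup.transvection hij ((c : F) * s)) (v c) =
      ψ s • v c := by
    intro c s
    simp only [hv]
    rw [map_smul, ← leftTranslate_mul, ← hac c, transvection_mul_diag2n, leftTranslate_mul, hf,
      map_smul, smul_comm]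
  have hvt' : ∀ (c : S) (s : F), leftTranslate (SpecialLinearGroup.transvection hij s) (v c) =
      ψ ((c : F)⁻¹ * s) • v c := by
    intro c s
    rw [← hvt, mul_inv_cancel_left₀]
    rw [← hac c]
    exact mul_ne_zero (ha c) (ha c)
  refine ⟨S, inferInstance, v, ?_, ⟨fun c => ?_, fun c d hcd => ?_⟩, fun c =>
    E.smul_mem _ (hinv _ _ hfE)⟩
  · rw [Fintype.card_coe]
    omega
  · simp only [hv]
    rw [norm_smul, norm_leftTranslate, Complex.norm_real, norm_inv, norm_norm,
      inv_mul_cancel₀ (norm_ne_zero_iff.2 hf0)]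
  · have h1 : (d : F)⁻¹ - (c : F)⁻¹ ≠ 0 := by
      rw [sub_ne_zero]
      intro h
      exact hcd (Subtype.ext (inv_injective h).symm)
    have h2 := AddChar.IsPrimitive.of_ne_one hψ h1
    obtain ⟨s, hs⟩ := AddChar.ne_one_iff.1 h2
    rw [AddChar.mulShift_apply, sub_mul, sub_eq_add_neg, AddChar.map_add_eq_mul,
      AddChar.map_neg_eq_conj] at hs
    have h3 := inner_leftTranslate (SpecialLinearGroup.transvection hij s) (v c) (v d)
    rw [hvt', hvt', inner_smul_left, inner_smul_right, ← mul_assoc] at h3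
    by_contra h4
    refine hs ?_
    rw [mul_comm]
    exact mul_right_cancel₀ h4 (h3.trans (one_mul _).symm)

end Quasirandom

section Tripling

variable {G : Type} [Group G] [DecidableEq G]

lemma card_union_inv_pow_le {A : Finset G} {K : ℝ} (hA : ((A ^ 3).card : ℝ) ≤ K * A.card) {m : ℕ}
    (hm : 3 ≤ m) :
    (((A ∪ A⁻¹) ^ m).card : ℝ) ≤ 2 ^ m * (K ^ (3 * (m - 2)) * A.card) := by
  set sgn : Bool → ℤ := fun b => if b then 1 else -1 with hsgn
  have h1 : (A ∪ A⁻¹) ^ m ⊆ Finset.univ.biUnion fun e : Fin m → Bool =>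
      ((List.finRange m).map fun i => A ^ sgn (e i)).prod := by
    intro x hx
    obtain ⟨f, rfl⟩ := Finset.mem_pow.1 hx
    have h2 : ∀ i, ∃ b : Bool, (f i : G) ∈ A ^ sgn b := by
      intro i
      rcases Finset.mem_union.1 (f i).2 with h | h
      · exact ⟨true, by simpa [hsgn] using h⟩
      · exact ⟨false, by simpa [hsgn] using h⟩
    choose e he using h2
    refine Finset.mem_biUnion.2 ⟨e, Finset.mem_univ _, ?_⟩
    rw [← List.ofFn_eq_map, Finset.mem_prod_list_ofFn]
    exact ⟨fun i => ⟨f i, he i⟩, rfl⟩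
  have h2 : ((A ∪ A⁻¹) ^ m).card ≤ ∑ e : Fin m → Bool,
      ((List.finRange m).map fun i => A ^ sgn (e i)).prod.card :=
    (Finset.card_le_card h1).trans Finset.card_biUnion_le
  calc (((A ∪ A⁻¹) ^ m).card : ℝ) ≤ ∑ e : Fin m → Bool,
        (((List.finRange m).map fun i => A ^ sgn (e i)).prod.card : ℝ) := by exact_mod_cast h2
    _ ≤ ∑ e : Fin m → Bool, K ^ (3 * (m - 2)) * A.card := by
        refine Finset.sum_le_sum fun e _ =>
          Finset.small_alternating_pow_of_small_tripling hm hA _ fun i => ?_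
        cases e i <;> simp [hsgn]
    _ = _ := by simp

lemma card_insert_one_pow_le {A : Finset G} (hA₀ : A.Nonempty) {K : ℝ}
    (hA : ((A ^ 3).card : ℝ) ≤ K * A.card) (k : ℕ) :
    (((insert 1 (A ∪ A⁻¹)) ^ k).card : ℝ) ≤
      (k + 1) * (2 ^ (k + 3) * (K ^ (3 * (k + 1)) * A.card)) := by
  have h1 : ∀ j, (insert 1 (A ∪ A⁻¹)) ^ j ⊆
      (Finset.range (j + 1)).biUnion fun m => (A ∪ A⁻¹) ^ m := by
    intro j
    induction j with
    | zero => simp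
    | succ j ih =>
      intro x hx
      rw [pow_succ] at hx
      obtain ⟨y, hy, b, hb, rfl⟩ := Finset.mem_mul.1 hx
      obtain ⟨m, hm, hym⟩ := Finset.mem_biUnion.1 (ih hy)
      rw [Finset.mem_range] at hm
      rcases Finset.mem_insert.1 hb with rfl | hb
      · exact Finset.mem_biUnion.2 ⟨m, Finset.mem_range.2 (by omega), by simpa using hym⟩
      · refine Finset.mem_biUnion.2 ⟨m + 1, Finset.mem_range.2 (by omega), ?_⟩
        rw [pow_succ]
        exact Finset.mul_mem_mul hym hb
  have hne : (A ∪ A⁻¹).Nonempty := hA₀.mono Finset.subset_union_left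
  have h2 : ((insert 1 (A ∪ A⁻¹)) ^ k).card ≤ (k + 1) * ((A ∪ A⁻¹) ^ (k + 3)).card := by
    refine (Finset.card_le_card (h1 k)).trans (Finset.card_biUnion_le.trans ?_)
    refine (Finset.sum_le_card_nsmul _ _ ((A ∪ A⁻¹) ^ (k + 3)).card fun m hm => ?_).trans (by simp)
    rw [Finset.mem_range] at hm
    exact hne.card_pow_mono (by omega)
  have h3 := card_union_inv_pow_le hA (show 3 ≤ k + 3 by omega)
  rw [show k + 3 - 2 = k + 1 by omega] at h3
  calc (((insert 1 (A ∪ A⁻¹)) ^ k).card : ℝ) ≤ (k + 1) * ((A ∪ A⁻¹) ^ (k + 3)).card := by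
        exact_mod_cast h2
    _ ≤ _ := by gcongr

end Tripling

section Cardinality

variable {F : Type} [Field F] [Fintype F]

lemma card_specialLinearGroup_le (n : ℕ) :
    Nat.card (SpecialLinearGroup (Fin n) F) ≤ Fintype.card F ^ (n * n) := by
  refine (Nat.card_le_card_of_injective _ (mat_injective (ι := Fin n) (R := F))).trans (le_of_eq ?_)
  rw [Matrix, Nat.card_fun, Nat.card_fun, Nat.card_eq_fintype_card, Nat.card_eq_fintype_card,
    Fintype.card_fin, ← pow_mul]

lemma le_card_specialLinearGroup (m : ℕ) :
    Fintype.card F ^ (m * (m + 2)) ≤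
      2 ^ (m + 1) * Nat.card (SpecialLinearGroup (Fin (m + 1)) F) := by
  classical
  set q := Fintype.card F with hq
  have hq2 : 2 ≤ q := Fintype.one_lt_card
  have h1 : q ^ ((m + 1) * (m + 1)) ≤ 2 ^ (m + 1) * Nat.card (GL (Fin (m + 1)) F) := by
    rw [Matrix.card_GL_field]
    have h2 : ∏ _i : Fin (m + 1), q ^ (m + 1) ≤
        ∏ i : Fin (m + 1), 2 * (q ^ (m + 1) - q ^ (i : ℕ)) := by
      refine Finset.prod_le_prod' fun i _ => ?_
      have h3 : q ^ (i : ℕ) * 2 ≤ q ^ (m + 1) :=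
        (Nat.mul_le_mul_left _ hq2).trans ((pow_succ q (i : ℕ)).symm.le.trans
          (Nat.pow_le_pow_right (by omega) i.2))
      omega
    rw [Finset.prod_mul_distrib] at h2
    simpa [← pow_mul] using h2
  have h2 : Nat.card (GL (Fin (m + 1)) F) ≤ Nat.card (SpecialLinearGroup (Fin (m + 1)) F) * q := by
    have h3 := ncard_le_of_image_subset (S := (Set.univ : Set (GL (Fin (m + 1)) F)))
      (U := (Set.univ : Set F)) (fun x => (x : Matrix (Fin (m + 1)) (Fin (m + 1)) F).det)
      (N := Nat.card (SpecialLinearGroup (Fin (m + 1)) F)) (fun _ _ => trivial) (fun x _ => by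
        rw [← Set.ncard_univ (SpecialLinearGroup (Fin (m + 1)) F)]
        have hdet : ∀ y : GL (Fin (m + 1)) F, ∃ g : SpecialLinearGroup (Fin (m + 1)) F,
            (y : Matrix (Fin (m + 1)) (Fin (m + 1)) F).det =
              (x : Matrix (Fin (m + 1)) (Fin (m + 1)) F).det → mat g = (x⁻¹ * y).val := by
          intro y
          by_cases hy : (y : Matrix (Fin (m + 1)) (Fin (m + 1)) F).det =
              (x : Matrix (Fin (m + 1)) (Fin (m + 1)) F).det
          · refine ⟨⟨(x⁻¹ * y).val, ?_⟩, fun _ => rfl⟩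
            rw [Units.val_mul, det_mul, hy, ← det_mul, ← Units.val_mul, inv_mul_cancel,
              Units.val_one, det_one]
          · exact ⟨1, fun h => absurd h hy⟩
        choose s hs using hdet
        refine Set.ncard_le_ncard_of_injOn s (fun _ _ => trivial) ?_
        rintro y ⟨-, hy⟩ z ⟨-, hz⟩ hyz
        refine mul_left_cancel (a := x⁻¹) (Units.ext ?_)
        rw [← hs y hy, ← hs z hz, hyz])
    simpa [Set.ncard_univ] using h3
  refine le_of_mul_le_mul_right (a := q) ?_ (by omega)
  calc q ^ (m * (m + 2)) * q = q ^ ((m + 1) * (m + 1)) := by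
        rw [← pow_succ]; congr 1; ring
    _ ≤ 2 ^ (m + 1) * (Nat.card (SpecialLinearGroup (Fin (m + 1)) F) * q) :=
      h1.trans (Nat.mul_le_mul_left _ h2)
    _ = _ := by ring

end Cardinality

section Growth

lemma ncard_le_of_not_univ (m : ℕ) (hm : 1 ≤ m) : ∃ k D E : ℕ, ∀ (F : Type) [Field F] [Fintype F]
    (A H : Set (SpecialLinearGroup (Fin (m + 1)) F)), Subgroup.closure A = ⊤ →
    A * A * A ≠ Set.univ → A ⊆ H → 1 ∈ H → H⁻¹ = H → H.ncard ≤ 3 * A.ncard →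
    ∀ κ : ℕ, (H ^ k).ncard ≤ κ * H.ncard → A.ncard ≤ D * κ ^ E := by
  have : Nontrivial (Fin (m + 1)) := Fin.nontrivial_iff_two_le.2 (by omega)
  obtain ⟨k, C, Q, hdich⟩ := exists_pivot_dichotomy (Fin (m + 1))
  set n := m + 1 with hn
  set D := (4 ^ n * (2 ^ n * C * 3 ^ n) ^ 3) ^ n with hD
  refine ⟨k + 1, (Q + 3) ^ (n * n) + C + D, C + 3 * C * n, fun F _ _ A H hA hA3 hAH h1 hs hH κ hκ => ?_⟩
  classical
  have hN : 0 < H.ncard := (Set.ncard_pos (Set.toFinite _)).2 ⟨1, h1⟩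
  have hκ0 : 0 < κ := by
    rcases Nat.eq_zero_or_pos κ with rfl | h
    · have h2 := ncard_pow_le h1 (show 1 ≤ k + 1 by omega)
      rw [pow_one] at h2
      omega
    · exact h
  have hκp : ∀ {i j : ℕ}, i ≤ j → κ ^ i ≤ κ ^ j := fun h => Nat.pow_le_pow_right hκ0 h
  have hAG : A.ncard ≤ Nat.card (SpecialLinearGroup (Fin n) F) := by
    rw [← Set.ncard_univ]
    exact Set.ncard_le_ncard (Set.subset_univ _)
  have hAq := hAG.trans (card_specialLinearGroup_le n)
  have hAH' := Set.ncard_le_ncard hAH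
  have hA0 : 0 < A.ncard := by omega
  by_cases hQ : Q + 3 < Fintype.card F
  · rcases hdich F (by omega) H h1 hs (top_le_iff.1 (hA ▸ Subgroup.closure_mono hAH)) κ
      ((ncard_pow_le h1 (by omega)).trans hκ) with h | h
    · calc A.ncard ≤ C * κ ^ C := hAH'.trans h
        _ ≤ _ := Nat.mul_le_mul (by omega) (hκp (by omega))
    · set g := Nat.card (SpecialLinearGroup (Fin n) F)
      set q := Fintype.card F
      set a := A.ncard
      have hg : 0 < g := Nat.card_pos
      have h2 : g ^ n ≤ 2 ^ n * C * 3 ^ n * κ ^ C * a ^ n := by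
        refine le_of_mul_le_mul_right (a := g) ?_ hg
        calc g ^ n * g = g ^ (n + 1) := by ring
          _ ≤ C * κ ^ C * q ^ (m * (m + 2)) * H.ncard ^ n := by
            simpa [hn] using h
          _ ≤ C * κ ^ C * (2 ^ n * g) * (3 * a) ^ n := by
            gcongr
            exact le_card_specialLinearGroup m
          _ = _ := by rw [mul_pow]; ring
      have h3 : q * a ^ 3 ≤ 4 * g ^ 3 := by
        by_contra! hlt
        refine hA3 ((isQuasirandom_specialLinearGroup (ι := Fin n) (F := F)).mul_mul_eq_univ A ?_)
        have h4 : q ≤ 4 * ((q - 1) / 2) := by omega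
        have h5 : q * a ^ 3 ≤ 4 * ((q - 1) / 2) * a ^ 3 := Nat.mul_le_mul_right _ h4
        have h6 : 4 * g ^ 3 < 4 * ((q - 1) / 2 * a ^ 3) := by
          rw [← mul_assoc]; exact hlt.trans_le h5
        exact Nat.lt_of_mul_lt_mul_left h6
      have h4 : q ^ n ≤ 4 ^ n * (2 ^ n * C * 3 ^ n) ^ 3 * κ ^ (3 * C) := by
        refine le_of_mul_le_mul_right (a := a ^ (n * 3)) ?_ (pow_pos hA0 _)
        calc q ^ n * a ^ (n * 3) = (q * a ^ 3) ^ n := by ring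
          _ ≤ (4 * g ^ 3) ^ n := Nat.pow_le_pow_left h3 _
          _ = 4 ^ n * (g ^ n) ^ 3 := by rw [mul_pow]; ring
          _ ≤ 4 ^ n * (2 ^ n * C * 3 ^ n * κ ^ C * a ^ n) ^ 3 := by gcongr
          _ = _ := by
            rw [mul_pow _ (a ^ n), mul_pow _ (κ ^ C)]; ring
      calc a ≤ (q ^ n) ^ n := by rw [← pow_mul]; exact hAq
        _ ≤ (4 ^ n * (2 ^ n * C * 3 ^ n) ^ 3 * κ ^ (3 * C)) ^ n := Nat.pow_le_pow_left h4 _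
        _ = D * κ ^ (3 * C * n) := by rw [mul_pow, ← pow_mul κ]
        _ ≤ _ := Nat.mul_le_mul (by omega) (hκp (by omega))
  · calc A.ncard ≤ (Q + 3) ^ (n * n) := hAq.trans (Nat.pow_le_pow_left (by omega) _)
      _ ≤ ((Q + 3) ^ (n * n) + C + D) * 1 := by omega
      _ ≤ _ := Nat.mul_le_mul_left _ (Nat.one_le_pow _ _ hκ0)

end Growth

section Main

lemma le_mul_pow_of_le_mul_ceil_pow {a D M X : ℝ} {κ r E : ℕ} (hD : 0 ≤ D)
    (hκ : (κ : ℝ) ≤ 2 * M * X ^ r) (ha : a ≤ D * (κ : ℝ) ^ E) :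
    a ≤ D * (2 * M) ^ E * X ^ (r * E) := by
  refine ha.trans ?_
  rw [pow_mul, mul_assoc, ← mul_pow]
  exact mul_le_mul_of_nonneg_left (pow_le_pow_left₀ (Nat.cast_nonneg _) hκ _) hD

lemma not_small_growth {D₁ a t X : ℝ} {N : ℕ} (ha1 : 1 ≤ a) (hX1 : 1 ≤ X)
    (hXp : X ^ (2 * N + 1) = a) (h1 : a ≤ D₁ * X ^ N) (hat : a ≤ t) :
    1 / (D₁ ^ 2 + 1) * (a * X) ≤ t := by
  by_contra! hlt
  have ha0 : 0 < a := by linarith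
  have h2 : a ≤ D₁ ^ 2 := by
    refine le_of_mul_le_mul_right (a := a) ?_ ha0
    calc a * a ≤ (D₁ * X ^ N) * (D₁ * X ^ N) := mul_self_le_mul_self ha0.le h1
      _ = D₁ ^ 2 * X ^ (2 * N) := by ring
      _ ≤ D₁ ^ 2 * X ^ (2 * N + 1) :=
        mul_le_mul_of_nonneg_left (pow_le_pow_right₀ hX1 (by omega)) (sq_nonneg _)
      _ = D₁ ^ 2 * a := by rw [hXp]
  have h3 : X ≤ a := hXp ▸ le_self_pow₀ hX1 (by omega)
  have h4 : a < 1 / (D₁ ^ 2 + 1) * (a * X) := hat.trans_lt hlt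
  rw [one_div, inv_mul_eq_div, lt_div_iff₀ (by positivity)] at h4
  have h5 : D₁ ^ 2 + 1 < X := lt_of_mul_lt_mul_left h4 ha0.le
  linarith

theorem product_theorem_SL (m : ℕ) (hm : 1 ≤ m) :
    ∃ ε > (0 : ℝ), ∃ c > (0 : ℝ), ∀ (F : Type) [Field F] [Fintype F]
      (A : Set (SpecialLinearGroup (Fin (m + 1)) F)), Subgroup.closure A = ⊤ →
        A * A * A = Set.univ ∨ c * (A.ncard : ℝ) ^ (1 + ε) ≤ ((A * A * A).ncard : ℝ) := by
  obtain ⟨k, D, E, h⟩ := ncard_le_of_not_univ m hm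
  set N := 3 * (k + 1) * E with hN
  set M : ℝ := (k + 1) * 2 ^ (k + 3) with hM
  set D₁ : ℝ := D * (2 * M) ^ E with hD₁
  have hM1 : 1 ≤ M := one_le_mul_of_one_le_of_one_le (by linarith [Nat.cast_nonneg (α := ℝ) k])
    (one_le_pow₀ one_le_two)
  have hε : 0 < (1 : ℝ) / (2 * N + 1) := by positivity
  have hε1 : (1 : ℝ) / (2 * N + 1) ≤ 1 := by
    rw [div_le_one (by positivity)]
    linarith [Nat.cast_nonneg (α := ℝ) N]
  have hc : 0 < 1 / (D₁ ^ 2 + 1) := by positivity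
  refine ⟨_, hε, _, hc, fun F _ _ A hA => ?_⟩
  by_contra! hcon
  obtain ⟨hne, hlt⟩ := hcon
  classical
  rcases A.eq_empty_or_nonempty with rfl | hA₀
  · rw [Set.ncard_empty, Nat.cast_zero, Real.zero_rpow (by positivity), mul_zero] at hlt
    exact absurd hlt (not_lt.2 (Nat.cast_nonneg _))
  set S := A.toFinset with hS
  have hSA : (S : Set (SpecialLinearGroup (Fin (m + 1)) F)) = A := Set.coe_toFinset A
  have hS0 : S.Nonempty := by
    rw [← Finset.coe_nonempty, hSA]; exact hA₀
  have hcardA : A.ncard = S.card := by rw [← hSA, Set.ncard_coe_finset]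
  have hcard3 : (A * A * A).ncard = (S ^ 3).card := by
    rw [← pow_three', ← hSA, ← Finset.coe_pow, Set.ncard_coe_finset]
  have ha1 : 1 ≤ S.card := hS0.card_pos
  have h13 : (S.card : ℝ) ≤ (S ^ 3).card := by
    exact_mod_cast Finset.card_le_card_pow (by simp)
  rw [hcardA, hcard3] at hlt
  set a : ℝ := (S.card : ℝ) with ha
  have ha1' : 1 ≤ a := by rw [ha]; exact_mod_cast ha1
  have ha0 : 0 < a := by linarith
  set X : ℝ := a ^ ((1 : ℝ) / (2 * N + 1)) with hX
  have hX1 : 1 ≤ X := Real.one_le_rpow ha1' hε.le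
  have hXp : X ^ (2 * N + 1) = a := by
    rw [hX, ← Real.rpow_natCast, ← Real.rpow_mul ha0.le]
    push_cast
    rw [one_div_mul_cancel (by positivity), Real.rpow_one]
  rw [Real.rpow_add ha0, Real.rpow_one, ← hX] at hlt
  have hc1 : 1 / (D₁ ^ 2 + 1) ≤ 1 := by
    rw [div_le_one (by positivity)]
    linarith [sq_nonneg D₁]
  have htrip : ((S ^ 3).card : ℝ) ≤ X * a := by
    refine hlt.le.trans ?_
    calc 1 / (D₁ ^ 2 + 1) * (a * X) ≤ 1 * (a * X) :=
          mul_le_mul_of_nonneg_right hc1 (by positivity)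
      _ = _ := by ring
  have hpow := card_insert_one_pow_le hS0 htrip k
  set B := insert 1 (S ∪ S⁻¹) with hB
  have hSB : S ⊆ B := Finset.subset_union_left.trans (Finset.subset_insert _ _)
  have hBS : (S.card : ℝ) ≤ B.card := by exact_mod_cast Finset.card_le_card hSB
  set κ := ⌈M * X ^ (3 * (k + 1))⌉₊ with hκ
  have hκle : (κ : ℝ) ≤ 2 * M * X ^ (3 * (k + 1)) := by
    have h1 : 1 ≤ M * X ^ (3 * (k + 1)) :=
      one_le_mul_of_one_le_of_one_le hM1 (one_le_pow₀ hX1)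
    have h2 := Nat.ceil_lt_add_one (zero_le_one.trans h1)
    rw [← hκ] at h2
    linarith
  have hfin := h F A B hA hne (by rw [← hSA]; exact_mod_cast hSB) (by simp [hB])
    (by
      rw [← Finset.coe_inv, hB]
      congr 1
      ext x
      simp [or_comm])
    (by
      rw [hcardA, Set.ncard_coe_finset, hB]
      have h1 := Finset.card_insert_le 1 (S ∪ S⁻¹)
      have h2 := Finset.card_union_le S S⁻¹
      rw [Finset.card_inv] at h2
      omega) κ (by
      rw [← Finset.coe_pow, Set.ncard_coe_finset, Set.ncard_coe_finset]
      have h1 : ((B ^ k).card : ℝ) ≤ κ * B.card := by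
        calc ((B ^ k).card : ℝ) ≤ M * X ^ (3 * (k + 1)) * a := by
              refine hpow.trans (le_of_eq ?_)
              rw [hM]; ring
          _ ≤ κ * B.card := mul_le_mul (Nat.le_ceil _) hBS ha0.le (Nat.cast_nonneg _)
      exact_mod_cast h1)
  rw [hcardA] at hfin
  exact not_lt.2 (not_small_growth ha1' hX1 hXp (le_mul_pow_of_le_mul_ceil_pow
    (Nat.cast_nonneg _) hκle (by rw [ha]; exact_mod_cast hfin)) h13) hlt

lemma ncard_preimage_mk {G : Type} [Group G] (Z : Subgroup G) (A : Set (G ⧸ Z)) :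
    ((QuotientGroup.mk : G → G ⧸ Z) ⁻¹' A).ncard = Nat.card Z * A.ncard := by
  rw [← Nat.card_coe_set_eq, ← Nat.card_coe_set_eq, ← Nat.card_prod]
  exact Nat.card_congr (QuotientGroup.preimageMkEquivSubgroupProdSet Z A)

lemma closure_preimage_mk {G : Type} [Group G] (Z : Subgroup G) [Z.Normal] (A : Set (G ⧸ Z))
    (hA₀ : A.Nonempty) (hA : Subgroup.closure A = ⊤) :
    Subgroup.closure ((QuotientGroup.mk : G → G ⧸ Z) ⁻¹' A) = ⊤ := by
  set S := Subgroup.closure ((QuotientGroup.mk : G → G ⧸ Z) ⁻¹' A) with hS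
  have hZ : Z ≤ S := by
    intro z hz
    obtain ⟨a, ha⟩ := hA₀
    obtain ⟨a, rfl⟩ := QuotientGroup.mk_surjective a
    have h1 : a ∈ S := Subgroup.subset_closure ha
    have h2 : a * z ∈ S := Subgroup.subset_closure (by
      change ((a * z : G) : G ⧸ Z) ∈ A
      rwa [QuotientGroup.mk_mul_of_mem a hz])
    simpa using S.mul_mem (S.inv_mem h1) h2
  have hmap : S.map (QuotientGroup.mk' Z) = ⊤ := by
    rw [hS, MonoidHom.map_closure, ← hA]
    congr 1
    exact Set.image_preimage_eq _ (QuotientGroup.mk'_surjective Z)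
  have h1 := Subgroup.comap_map_eq (QuotientGroup.mk' Z) S
  rw [hmap, Subgroup.comap_top, QuotientGroup.ker_mk', sup_eq_left.2 hZ] at h1
  exact h1.symm

end Main

end ProductPSL

open scoped MatrixGroups Pointwise

/-- **Product theorem** for `PSL(n,q)`: for every `n ≥ 2` there exist `ε, c > 0`
(depending only on `n`) such that for every finite field `F` (of size `q`) and
every generating set `A` of `L = PSL(n,q)`, either `A³ = L` or `|A³| ≥ c·|A|^(1+ε)`. -/
theorem product_theorem_PSL (n : ℕ) (hn : 2 ≤ n) :
    ∃ ε > (0 : ℝ), ∃ c > (0 : ℝ),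
      ∀ (F : Type) [Field F] [Fintype F],
        ∀ A : Set (Matrix.ProjectiveSpecialLinearGroup (Fin n) F),
          Subgroup.closure A = ⊤ →
            A * A * A = Set.univ ∨
              c * (Nat.card ↥A : ℝ) ^ (1 + ε) ≤ (Nat.card ↥(A * A * A) : ℝ) := by
  obtain ⟨m, rfl⟩ : ∃ m, n = m + 1 := ⟨n - 1, by omega⟩
  obtain ⟨ε, hε, c, hc, h⟩ := ProductPSL.product_theorem_SL m (by omega)
  refine ⟨ε, hε, c, hc, fun F _ _ A hA => ?_⟩
  rw [Nat.card_coe_set_eq, Nat.card_coe_set_eq]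
  rcases A.eq_empty_or_nonempty with rfl | hA₀
  · right
    rw [Set.ncard_empty, Nat.cast_zero, Real.zero_rpow (by positivity), mul_zero]
    exact Nat.cast_nonneg _
  set Z := Subgroup.center (Matrix.SpecialLinearGroup (Fin (m + 1)) F)
  set P := (QuotientGroup.mk : Matrix.SpecialLinearGroup (Fin (m + 1)) F → _ ⧸ Z) ⁻¹' A with hP
  have hsub : P * P * P ⊆ QuotientGroup.mk ⁻¹' (A * A * A) := by
    rintro _ ⟨_, ⟨x, hx, y, hy, rfl⟩, z, hz, rfl⟩
    exact Set.mul_mem_mul (Set.mul_mem_mul (s := A) (t := A) hx hy) hz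
  rcases h F P (ProductPSL.closure_preimage_mk Z A hA₀ hA) with h | h
  · left
    refine Set.eq_univ_of_forall fun x => ?_
    obtain ⟨x, rfl⟩ := QuotientGroup.mk_surjective x
    exact hsub (h ▸ Set.mem_univ x)
  · right
    have h1 : (P * P * P).ncard ≤ Nat.card Z * (A * A * A).ncard := by
      rw [← ProductPSL.ncard_preimage_mk]
      exact Set.ncard_le_ncard hsub
    rw [hP, ProductPSL.ncard_preimage_mk, ← hP] at h
    set z := Nat.card Z with hz
    have hz0 : 1 ≤ z := Nat.card_pos
    have hz1 : (1 : ℝ) ≤ z := by exact_mod_cast hz0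
    have h2 : (((P * P * P).ncard : ℕ) : ℝ) ≤ z * (A * A * A).ncard := by exact_mod_cast h1
    refine le_of_mul_le_mul_left (a := (z : ℝ)) ?_ (by linarith)
    refine le_trans ?_ (h.trans h2)
    push_cast
    rw [Real.mul_rpow (by positivity) (by positivity)]
    have h3 : (z : ℝ) ≤ (z : ℝ) ^ (1 + ε) := by
      calc (z : ℝ) = (z : ℝ) ^ (1 : ℝ) := (Real.rpow_one _).symm
        _ ≤ _ := Real.rpow_le_rpow_of_exponent_le hz1 (by linarith)
    have h4 : 0 ≤ c * (A.ncard : ℝ) ^ (1 + ε) := by positivity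
    nlinarith [mul_le_mul_of_nonneg_right h3 h4]
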